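/- arXiv:2504.14711 — 2 statements merged into one kernel-verified Lean document; each statement's English description precedes it below -/
import Mathlib

section
/- Let k be a positive integer and let G be a graph such that d(x) + d(y) < 2k for every edge xy of G. Then G has an equitable k-coloring. -/
namespace OreColoring

open Finset

section Reach

variable {C : Type*} {E : C → C → Prop} {r : C}

/-- `Reach E r F c` says that the relation `E` has a simple path from `c` to `r`
all of whose vertices lie outside `F`. -/
inductive Reach (E : C → C → Prop) (r : C) : Set C → C → Prop
  | root {F : Set C} : r ∉ F → Reach E r F r
  | step {F : Set C} {c d : C} : c ∉ F → E c d → Reach E r (insert c F) d → Reach E r F c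

theorem Reach.notMem {F : Set C} {c : C} (h : Reach E r F c) : c ∉ F := by
  cases h <;> assumption

theorem Reach.root_notMem {F : Set C} {c : C} (h : Reach E r F c) : r ∉ F := by
  induction h with
  | root h => exact h
  | step _ _ _ ih => exact fun hr => ih (Set.mem_insert_of_mem _ hr)

theorem Reach.anti {F F' : Set C} {c : C} (h : Reach E r F c) (hF : F' ⊆ F) :
    Reach E r F' c := by
  induction h generalizing F' with
  | root h => exact .root fun hr => h (hF hr)
  | step hc hE _ ih => exact .step (fun h => hc (hF h)) hE (ih (Set.insert_subset_insert hF))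

theorem Reach.passes_or_avoids {F : Set C} {c d : C} (h : Reach E r F d) (hc : c ∉ F) :
    Reach E r F c ∨ Reach E r (insert c F) d := by
  induction h with
  | @root F h =>
    by_cases hcr : c = r
    · subst hcr
      exact .inl (.root h)
    · refine .inr (.root ?_)
      rintro (h' | h')
      · exact hcr h'.symm
      · exact h h'
  | @step F d e hd hE hR ih =>
    by_cases hcd : c = d
    · subst hcd
      exact .inl (.step hd hE hR)
    · have hc' : c ∉ insert d F := by
        rintro (h' | h')
        · exact hcd h'
        · exact hc h'
      rcases ih hc' with h | h
      · exact .inl (h.anti (Set.subset_insert _ _))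
      · refine .inr (.step ?_ hE ?_)
        · rintro (h' | h')
          · exact hcd h'.symm
          · exact hd h'
        · rwa [Set.insert_comm]

theorem Reach.cons {F : Set C} {c d : C} (hc : c ∉ F) (hE : E c d) (h : Reach E r F d) :
    Reach E r F c := by
  rcases h.passes_or_avoids hc with h | h
  · exact h
  · exact .step hc hE h

/-- Among the vertices that reach the root there is a nonempty set `T` of terminal ones (deleting
one of them disconnects none of the others from the root) whose out-neighbours
lie in `T` with at most one exception. -/
theorem exists_terminal_family [DecidableEq C] (E : C → C → Prop) (r : C) (A : Finset C)
    (hA : ∀ c, c ∈ A ↔ Reach E r ∅ c) :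
    ∃ T ⊆ A, T.Nonempty ∧ (∀ W ∈ T, ∀ c ∈ A, c ≠ W → Reach E r {W} c) ∧
      ∃ U, ∀ W ∈ T, ∀ c ∈ A, E W c → c ∈ T ∨ c = U := by
  classical
  have hr : r ∈ A := (hA r).2 (.root (Set.notMem_empty r))
  by_cases hne : ∃ c ∈ A, c ≠ r
  · let T : C → Finset C := fun U => A.filter fun c => c ≠ U ∧ ¬ Reach E r {U} c
    have hT : ∀ U c, c ∈ T U ↔ c ∈ A ∧ c ≠ U ∧ ¬ Reach E r {U} c := by
      intro U c; simp [T]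
    obtain ⟨c₀, hc₀, hc₀r⟩ := hne
    obtain ⟨U, hU, hmin⟩ := Finset.exists_min_image (A.filter fun U => (T U).Nonempty)
      (fun U => #(T U))
      ⟨r, mem_filter.2 ⟨hr, c₀, (hT _ _).2 ⟨hc₀, hc₀r, fun h => h.root_notMem rfl⟩⟩⟩
    rw [mem_filter] at hU
    refine ⟨T U, filter_subset _ _, hU.2, ?_, U, ?_⟩
    · intro W hW c hc hcW
      by_contra hcon
      obtain ⟨hWA, hWU, hWR⟩ := (hT _ _).1 hW
      have hUW : Reach E r {W} U := by
        have h := (hA U).1 hU.1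
        cases h with
        | root h => exact .root (by simpa using hWU.symm)
        | @step _ _ d h hE hR =>
          rcases hR.passes_or_avoids (c := W) (by simpa using hWU) with h | h
          · exact absurd (h.anti (by simp)) hWR
          · refine .step (by simpa using hWU.symm) hE (h.anti ?_)
            intro x; simp; tauto
      have hsub : T W ⊆ T U := by
        intro c' hc'
        obtain ⟨h1, h2, h3⟩ := (hT _ _).1 hc'
        refine (hT _ _).2 ⟨h1, ?_, ?_⟩
        · rintro rfl; exact h3 hUW
        · intro h
          rcases h.passes_or_avoids (c := W) (by simpa using hWU) with h | h
          · exact hWR h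
          · exact h3 (h.anti (by simp))
      have hlt : #(T W) < #(T U) := card_lt_card <| (Finset.ssubset_iff_of_subset hsub).2
        ⟨W, hW, fun h => ((hT _ _).1 h).2.1 rfl⟩
      exact absurd (hmin W (mem_filter.2 ⟨hWA, c, (hT _ _).2 ⟨hc, hcW, hcon⟩⟩)) (by omega)
    · intro W hW c hc hE
      obtain ⟨hWA, hWU, hWR⟩ := (hT _ _).1 hW
      by_contra! hcon
      refine hcon.1 ((hT _ _).2 ⟨hc, hcon.2, fun h => hWR (h.cons (by simpa using hWU) hE)⟩)
  · push Not at hne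
    refine ⟨{r}, by simpa using hr, by simp, ?_, r, ?_⟩
    · intro W hW c hc hcW
      rw [mem_singleton] at hW
      exact absurd (hne c hc) (hW ▸ hcW)
    · intro W _ c hc _
      exact .inr (hne c hc)

end Reach

section Coloring

open scoped Classical

variable {V : Type*} (G : SimpleGraph V)

/-- The neighbours of `v` in `X`. -/
noncomputable def nbr (X : Finset V) (v : V) : Finset V := X.filter fun u => G.Adj v u

/-- The color class of `c` in `X`. -/
noncomputable def cls (X : Finset V) (f : V → ℕ) (c : ℕ) : Finset V := X.filter fun v => f v = c

/-- The Ore-degree of the subgraph induced on `X` is less than `2 * k`. -/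
def OreBound (X : Finset V) (k : ℕ) : Prop :=
  ∀ x ∈ X, ∀ y ∈ X, G.Adj x y → #(nbr G X x) + #(nbr G X y) < 2 * k

/-- `f` properly colors the subgraph induced on `X` with colors from `K`. -/
structure IsColoring (X : Finset V) (K : Finset ℕ) (f : V → ℕ) : Prop where
  maps : ∀ x ∈ X, f x ∈ K
  proper : ∀ x ∈ X, ∀ y ∈ X, G.Adj x y → f x ≠ f y

/-- The subgraph induced on `X` has a proper coloring with all classes of size `s`. -/
def HasEquitable (X : Finset V) (K : Finset ℕ) (s : ℕ) : Prop :=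
  ∃ f, IsColoring G X K f ∧ ∀ c ∈ K, #(cls X f c) = s

/-- `f` is a proper coloring in which all classes have size `s`, except that `vm` lacks one vertex
and `vp` has one extra vertex (these cancel if `vm = vp`). -/
structure IsNearEquitable (X : Finset V) (K : Finset ℕ) (s : ℕ) (f : V → ℕ) (vm vp : ℕ) :
    Prop where
  coloring : IsColoring G X K f
  vm_mem : vm ∈ K
  vp_mem : vp ∈ K
  card_cls : ∀ c ∈ K, #(cls X f c) + (if c = vm then 1 else 0) = s + (if c = vp then 1 else 0)

/-- Some vertex of class `c` has no neighbours in class `d`. -/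
def Movable (X : Finset V) (f : V → ℕ) (c d : ℕ) : Prop :=
  ∃ x ∈ cls X f c, ∀ y ∈ cls X f d, ¬ G.Adj x y

variable {G} {X : Finset V} {K : Finset ℕ} {f f' : V → ℕ} {r : ℕ}

@[simp] theorem mem_nbr {u v : V} : u ∈ nbr G X v ↔ u ∈ X ∧ G.Adj v u := by simp [nbr]

@[simp] theorem mem_cls {v : V} {c : ℕ} : v ∈ cls X f c ↔ v ∈ X ∧ f v = c := by simp [cls]

theorem card_nbr_mono {Y : Finset V} (h : Y ⊆ X) (v : V) : #(nbr G Y v) ≤ #(nbr G X v) :=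
  card_le_card (filter_subset_filter _ h)

theorem card_cls_update {x : V} (hx : x ∈ X) (d e : ℕ) :
    #(cls X (Function.update f x d) e) + (if e = f x then 1 else 0)
      = #(cls X f e) + (if e = d then 1 else 0) := by
  have hsum : ∀ g : V → ℕ, #(cls X g e) =
      (if g x = e then 1 else 0) + ∑ v ∈ X.erase x, if g v = e then 1 else 0 := by
    intro g
    rw [cls, card_filter, ← add_sum_erase _ _ hx]
  have hrest : ∑ v ∈ X.erase x, (if Function.update f x d v = e then 1 else 0)
      = ∑ v ∈ X.erase x, if f v = e then 1 else 0 :=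
    sum_congr rfl fun v hv => by rw [Function.update_of_ne (ne_of_mem_erase hv)]
  rw [hsum, hsum, hrest, Function.update_self]
  simp only [eq_comm (a := e)]
  omega

theorem exists_shift {F : Set ℕ} {c : ℕ} (hf : IsColoring G X K f) (hr : r ∈ K)
    (h : Reach (Movable G X f) r F c) :
    ∃ f', IsColoring G X K f' ∧ (∀ x ∈ X, f' x = c → f x = c) ∧
      (∀ x ∈ X, f x ∈ F → f' x = f x) ∧ (∀ x ∈ X, f' x ∈ F → f x = f' x) ∧
      ∀ d, #(cls X f' d) + (if d = c then 1 else 0) = #(cls X f d) + if d = r then 1 else 0 := by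
  induction h with
  | root h => exact ⟨f, hf, by simp, by simp, by simp, by simp⟩
  | @step F c d hc hE hR ih =>
    obtain ⟨f', hf', hsub, hfix, hfix', hcard⟩ := ih
    obtain ⟨x, hx, hxd⟩ := hE
    rw [mem_cls] at hx
    have hdF := hR.notMem
    have hdc : d ≠ c := fun h => hdF (Or.inl h)
    have hdF' : d ∉ F := fun h => hdF (Or.inr h)
    have hdK : d ∈ K := by
      cases hR with
      | root => exact hr
      | step _ hE _ =>
        obtain ⟨y, hy, -⟩ := hE
        rw [mem_cls] at hy
        exact hy.2 ▸ hf.maps y hy.1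
    have hf'x : f' x = c := (hfix x hx.1 (Or.inl hx.2)).trans hx.2
    refine ⟨Function.update f' x d, ⟨?_, ?_⟩, ?_, ?_, ?_, ?_⟩
    · intro y hy
      by_cases hyx : y = x
      · subst hyx; simpa using hdK
      · rw [Function.update_of_ne hyx]; exact hf'.maps y hy
    · have key : ∀ y ∈ X, G.Adj x y → f' y ≠ d := fun y hy hxy hyd =>
        hxd y (mem_cls.2 ⟨hy, hsub y hy hyd⟩) hxy
      intro y hy u hu hyu
      by_cases hyx : y = x
      · subst hyx
        rw [Function.update_self, Function.update_of_ne hyu.ne']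
        exact (key u hu hyu).symm
      · rw [Function.update_of_ne hyx]
        by_cases hux : u = x
        · subst hux
          rw [Function.update_self]
          exact key y hy hyu.symm
        · rw [Function.update_of_ne hux]
          exact hf'.proper y hy u hu hyu
    · intro y hy h
      by_cases hyx : y = x
      · subst hyx; exact hx.2
      · rw [Function.update_of_ne hyx] at h
        rw [hfix' y hy (Or.inl h), h]
    · intro y hy h
      by_cases hyx : y = x
      · subst hyx; exact absurd (hx.2 ▸ h) hc
      · rw [Function.update_of_ne hyx]
        exact hfix y hy (Or.inr h)
    · intro y hy h
      by_cases hyx : y = x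
      · subst hyx
        rw [Function.update_self] at h
        exact absurd h hdF'
      · rw [Function.update_of_ne hyx] at h ⊢
        exact hfix' y hy (Or.inr h)
    · intro e
      have h1 := card_cls_update (f := f') hx.1 d e
      have h2 := hcard e
      rw [hf'x] at h1
      omega

theorem IsNearEquitable.hasEquitable {s vm vp : ℕ} (h : IsNearEquitable G X K s f vm vp)
    (hR : Reach (Movable G X f) vm ∅ vp) : HasEquitable G X K s := by
  obtain ⟨f', hf', -, -, -, hcard⟩ := exists_shift h.coloring h.vm_mem hR
  refine ⟨f', hf', fun c hc => ?_⟩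
  have h1 := hcard c
  have h2 := h.card_cls c hc
  omega

theorem Reach.of_cls_eq {F : Set ℕ} {c : ℕ} (h : Reach (Movable G X f) r F c)
    (heq : ∀ d ∉ F, d ≠ c → Reach (Movable G X f) r ∅ d → cls X f' d = cls X f d)
    (hsub : cls X f c ⊆ cls X f' c) : Reach (Movable G X f') r F c := by
  induction h with
  | root h => exact .root h
  | @step F c d hc hE hR ih =>
    have hdF := hR.notMem
    have hdc : d ≠ c := fun h => hdF (Or.inl h)
    have hd : cls X f' d = cls X f d :=
      heq d (fun h => hdF (Or.inr h)) hdc (hR.anti (Set.empty_subset _))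
    obtain ⟨x, hx, hxd⟩ := hE
    refine .step hc ⟨x, hsub hx, hd ▸ hxd⟩ (ih ?_ hd.symm.subset)
    intro e he hed hRe
    exact heq e (fun h => he (Or.inr h)) (fun h => he (Or.inl h)) hRe

/-- Accessibility survives when a terminal class `W` loses a vertex `z` that cannot be moved to
another accessible class. -/
theorem reach_of_exchange {W : ℕ} {z : V}
    (hterm : ∀ c, Reach (Movable G X f) r ∅ c → c ≠ W → Reach (Movable G X f) r {W} c)
    (heq : ∀ c, Reach (Movable G X f) r ∅ c → c ≠ W → cls X f' c = cls X f c)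
    (hW : (cls X f W).erase z ⊆ cls X f' W)
    (hz : ∀ c, Reach (Movable G X f) r ∅ c → c ≠ W → ∃ y ∈ cls X f c, G.Adj z y)
    {c : ℕ} (hc : Reach (Movable G X f) r ∅ c) : Reach (Movable G X f') r ∅ c := by
  have main : ∀ d, Reach (Movable G X f) r ∅ d → d ≠ W → Reach (Movable G X f') r {W} d := by
    intro d hd hdW
    refine (hterm d hd hdW).of_cls_eq (fun e he _ hRe => heq e hRe (by simpa using he)) ?_
    rw [heq d hd hdW]
  by_cases hcW : c = W
  · subst hcW
    cases hc with
    | root h => exact .root h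
    | @step _ _ d h hE hR =>
      have hd : Reach (Movable G X f) r ∅ d := hR.anti (by simp)
      have hdW : d ≠ c := fun h => hR.notMem (Or.inl h)
      obtain ⟨x, hx, hxd⟩ := hE
      refine .step h ⟨x, hW (mem_erase.2 ⟨?_, hx⟩), heq d hd hdW ▸ hxd⟩
        ((main d hd hdW).anti (by simp))
      rintro rfl
      obtain ⟨y, hy, hxy⟩ := hz d hd hdW
      exact hxd y hy hxy
  · exact (main c hc hcW).anti (by simp)

/-- Gluing colorings of complementary vertex sets that use disjoint sets of colors. -/
theorem IsColoring.splice {Z : Finset V} {A B : Finset ℕ} {g h : V → ℕ} (hZ : Z ⊆ X)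
    (hg : IsColoring G (X \ Z) A g) (hh : IsColoring G Z B h) (hAB : Disjoint A B) :
    IsColoring G X (A ∪ B) (fun v => if v ∈ Z then h v else g v) ∧
      (∀ c ∈ A, cls X (fun v => if v ∈ Z then h v else g v) c = cls (X \ Z) g c) ∧
      ∀ c ∈ B, cls X (fun v => if v ∈ Z then h v else g v) c = cls Z h c := by
  have hg' : ∀ v ∈ X, v ∉ Z → g v ∈ A := fun v hv hvZ => hg.maps v (mem_sdiff.2 ⟨hv, hvZ⟩)
  have hne : ∀ a ∈ A, ∀ b ∈ B, a ≠ b := fun a ha b hb hab =>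
    Finset.disjoint_left.1 hAB ha (hab ▸ hb)
  refine ⟨⟨?_, ?_⟩, ?_, ?_⟩
  · intro x hx
    rw [mem_union]
    by_cases hxZ : x ∈ Z
    · simpa [hxZ] using .inr (hh.maps x hxZ)
    · simpa [hxZ] using .inl (hg' x hx hxZ)
  · intro x hx y hy hxy
    by_cases hxZ : x ∈ Z <;> by_cases hyZ : y ∈ Z <;> simp only [hxZ, hyZ, if_true, if_false]
    · exact hh.proper x hxZ y hyZ hxy
    · exact (hne _ (hg' y hy hyZ) _ (hh.maps x hxZ)).symm
    · exact hne _ (hg' x hx hxZ) _ (hh.maps y hyZ)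
    · exact hg.proper x (mem_sdiff.2 ⟨hx, hxZ⟩) y (mem_sdiff.2 ⟨hy, hyZ⟩) hxy
  · intro c hc
    ext v
    simp only [mem_cls, mem_sdiff]
    by_cases hvZ : v ∈ Z
    · simp only [hvZ, if_true, not_true, and_false, false_and, iff_false, not_and]
      exact fun _ h => hne c hc _ (hh.maps v hvZ) h.symm
    · simp [hvZ]
  · intro c hc
    ext v
    simp only [mem_cls]
    by_cases hvZ : v ∈ Z
    · simp [hvZ, hZ hvZ]
    · simp only [hvZ, if_false, false_and, iff_false, not_and]
      exact fun hv h => hne _ (hg' v hv hvZ) c hc h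

end Coloring

section Config

open scoped Classical

variable {V : Type*} (G : SimpleGraph V)

/-- The colors accessible to `vm`. -/
noncomputable def acc (X : Finset V) (K : Finset ℕ) (f : V → ℕ) (vm : ℕ) : Finset ℕ :=
  K.filter fun c => Reach (Movable G X f) vm ∅ c

/-- The vertices whose color is not accessible to `vm`. -/
noncomputable def outer (X : Finset V) (K : Finset ℕ) (f : V → ℕ) (vm : ℕ) : Finset V :=
  X.filter fun v => f v ∉ acc G X K f vm

/-- A nearly equitable coloring of a graph that satisfies the Ore-degree bound, has no equitable
coloring, and all of whose smaller induced subgraphs satisfy the theorem. -/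
structure Config (X : Finset V) (K : Finset ℕ) (s : ℕ) (f : V → ℕ) (vm vp : ℕ) : Prop where
  near : IsNearEquitable G X K s f vm vp
  ore : OreBound G X #K
  not_hasEquitable : ¬ HasEquitable G X K s
  ih : ∀ Y ⊂ X, ∀ L : Finset ℕ, OreBound G Y #L → #Y = #L * s → HasEquitable G Y L s

/-- The class `W` is not needed by the other accessible classes. -/
def Terminal (X : Finset V) (K : Finset ℕ) (f : V → ℕ) (vm W : ℕ) : Prop :=
  W ∈ acc G X K f vm ∧ ∀ c ∈ acc G X K f vm, c ≠ W → Reach (Movable G X f) vm {W} c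

/-- `z` is the only neighbour in class `W` of the vertex `y` of `outer`. -/
def Solo (X : Finset V) (K : Finset ℕ) (f : V → ℕ) (vm W : ℕ) (z y : V) : Prop :=
  y ∈ outer G X K f vm ∧ nbr G (cls X f W) y = {z}

variable {G} {X : Finset V} {K : Finset ℕ} {s : ℕ} {f : V → ℕ} {vm vp : ℕ}

theorem IsColoring.mem_of_reach (hf : IsColoring G X K f) (hvm : vm ∈ K) {F : Set ℕ} {c : ℕ}
    (h : Reach (Movable G X f) vm F c) : c ∈ K := by
  cases h with
  | root => exact hvm
  | step _ hE _ =>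
    obtain ⟨y, hy, -⟩ := hE
    rw [mem_cls] at hy
    exact hy.2 ▸ hf.maps y hy.1

theorem IsNearEquitable.mem_acc (h : IsNearEquitable G X K s f vm vp) {c : ℕ} :
    c ∈ acc G X K f vm ↔ Reach (Movable G X f) vm ∅ c := by
  rw [acc, mem_filter]
  exact ⟨fun h => h.2, fun hc => ⟨h.coloring.mem_of_reach h.vm_mem hc, hc⟩⟩

theorem acc_subset : acc G X K f vm ⊆ K := filter_subset _ _

theorem outer_subset : outer G X K f vm ⊆ X := filter_subset _ _

theorem mem_outer {v : V} : v ∈ outer G X K f vm ↔ v ∈ X ∧ f v ∉ acc G X K f vm := by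
  simp [outer]

namespace Config

theorem vm_mem_acc (h : Config G X K s f vm vp) :
    vm ∈ acc G X K f vm := h.near.mem_acc.2 (.root (Set.notMem_empty _))

theorem vp_notMem_acc (h : Config G X K s f vm vp) : vp ∉ acc G X K f vm := fun hvp =>
  h.not_hasEquitable (h.near.hasEquitable (h.near.mem_acc.1 hvp))

theorem card_acc_lt (h : Config G X K s f vm vp) : #(acc G X K f vm) < #K :=
  card_lt_card ((ssubset_iff_of_subset acc_subset).2 ⟨vp, h.near.vp_mem, h.vp_notMem_acc⟩)

theorem card_sdiff_acc : #(K \ acc G X K f vm) = #K - #(acc G X K f vm) :=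
  card_sdiff_of_subset acc_subset

theorem card_cls_acc_le (h : Config G X K s f vm vp)
    {c : ℕ} (hc : c ∈ acc G X K f vm) : #(cls X f c) ≤ s := by
  have h1 := h.near.card_cls c (acc_subset hc)
  have h2 : c ≠ vp := fun h' => h.vp_notMem_acc (h' ▸ hc)
  rw [if_neg h2] at h1
  omega

theorem card_outer (h : Config G X K s f vm vp) :
    #(outer G X K f vm) = (#K - #(acc G X K f vm)) * s + 1 := by
  rw [card_eq_sum_card_fiberwise (f := f) (t := K \ acc G X K f vm)]
  · have : ∀ c ∈ K \ acc G X K f vm, #((outer G X K f vm).filter fun v => f v = c)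
        = s + if c = vp then 1 else 0 := by
      intro c hc
      rw [mem_sdiff] at hc
      have h1 := h.near.card_cls c hc.1
      have hcvm : c ≠ vm := fun h' => hc.2 (h' ▸ h.vm_mem_acc)
      rw [if_neg hcvm, add_zero] at h1
      rw [← h1]
      congr 1
      ext v
      simp only [mem_filter, mem_outer, mem_cls]
      constructor
      · tauto
      · rintro ⟨hv, rfl⟩; exact ⟨⟨hv, hc.2⟩, rfl⟩
    rw [sum_congr rfl this, sum_add_distrib, sum_const, card_sdiff_acc, smul_eq_mul,
      sum_ite_eq' , if_pos (mem_sdiff.2 ⟨h.near.vp_mem, h.vp_notMem_acc⟩)]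
  · intro v hv
    have hv := mem_outer.1 (mem_coe.1 hv)
    exact mem_coe.2 (mem_sdiff.2 ⟨h.near.coloring.maps v hv.1, hv.2⟩)

theorem exists_adj_of_mem_outer (h : Config G X K s f vm vp)
    {y : V} (hy : y ∈ outer G X K f vm) {c : ℕ}
    (hc : c ∈ acc G X K f vm) : ∃ u ∈ cls X f c, G.Adj y u := by
  by_contra! hcon
  rw [mem_outer] at hy
  refine hy.2 (h.near.mem_acc.2 (Reach.cons (Set.notMem_empty _) ⟨y, ?_, hcon⟩
    (h.near.mem_acc.1 hc)))
  exact mem_cls.2 ⟨hy.1, rfl⟩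

theorem card_nbr_eq (v : V) : #(nbr G X v) = #(nbr G (outer G X K f vm) v)
    + ∑ c ∈ acc G X K f vm, #(nbr G (cls X f c) v) := by
  rw [← card_filter_add_card_filter_not (s := nbr G X v) (fun u => f u ∉ acc G X K f vm)]
  congr 1
  · congr 1
    ext u
    simp only [mem_filter, mem_nbr, mem_outer]
    tauto
  · rw [card_eq_sum_card_fiberwise (f := f) (t := acc G X K f vm)]
    · refine sum_congr rfl fun c hc => ?_
      congr 1
      ext u
      simp only [mem_filter, mem_nbr, mem_cls, not_not]
      constructor
      · tauto
      · rintro ⟨⟨h1, rfl⟩, h2⟩; exact ⟨⟨⟨h1, h2⟩, hc⟩, rfl⟩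
    · intro u hu
      simpa using (mem_filter.1 (mem_coe.1 hu)).2

theorem one_le_card_nbr_cls (h : Config G X K s f vm vp) {y : V} (hy : y ∈ outer G X K f vm) {c : ℕ}
    (hc : c ∈ acc G X K f vm) : 1 ≤ #(nbr G (cls X f c) y) := by
  obtain ⟨u, hu, hyu⟩ := h.exists_adj_of_mem_outer hy hc
  exact card_pos.2 ⟨u, mem_nbr.2 ⟨hu, hyu⟩⟩

theorem card_nbr_outer_add_le (h : Config G X K s f vm vp) {y : V} (hy : y ∈ outer G X K f vm) :
    #(nbr G (outer G X K f vm) y) + #(acc G X K f vm) ≤ #(nbr G X y) := by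
  rw [card_nbr_eq (X := X) (K := K) (f := f) (vm := vm) y, card_eq_sum_ones (acc G X K f vm)]
  exact Nat.add_le_add_left (sum_le_sum fun c hc => h.one_le_card_nbr_cls hy hc) _

theorem oreBound_of_subset_outer (h : Config G X K s f vm vp)
    {Z : Finset V} (hZ : Z ⊆ outer G X K f vm) :
    OreBound G Z #(K \ acc G X K f vm) := by
  intro x hx y hy hxy
  have h1 := h.card_nbr_outer_add_le (hZ hx)
  have h2 := h.card_nbr_outer_add_le (hZ hy)
  have h3 := card_nbr_mono (G := G) hZ x
  have h4 := card_nbr_mono (G := G) hZ y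
  have h5 := h.ore x (outer_subset (hZ hx)) y (outer_subset (hZ hy)) hxy
  have h6 := h.card_acc_lt
  rw [card_sdiff_acc]
  omega

theorem hasEquitable_outer_erase (h : Config G X K s f vm vp) {y : V} (hy : y ∈ outer G X K f vm) :
    HasEquitable G ((outer G X K f vm).erase y) (K \ acc G X K f vm) s := by
  have hss : (outer G X K f vm).erase y ⊂ X :=
    Finset.ssubset_of_ssubset_of_subset (erase_ssubset hy) outer_subset
  refine h.ih _ hss _ (h.oreBound_of_subset_outer (erase_subset _ _)) ?_
  rw [card_erase_of_mem hy, h.card_outer, card_sdiff_acc, Nat.add_sub_cancel]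

theorem acc_union_sdiff : acc G X K f vm ∪ (K \ acc G X K f vm) = K :=
  union_sdiff_of_subset acc_subset

theorem exists_adj_of_solo (h : Config G X K s f vm vp)
    {W : ℕ} (hW : Terminal G X K f vm W) {z y : V}
    (hzy : Solo G X K f vm W z y) {c : ℕ} (hc : c ∈ acc G X K f vm) (hcW : c ≠ W) :
    ∃ u ∈ cls X f c, G.Adj z u := by
  by_contra! hcon
  obtain ⟨hy, hsolo⟩ := hzy
  obtain ⟨hyX, hfy⟩ := mem_outer.1 hy
  have hz : z ∈ nbr G (cls X f W) y := by rw [hsolo]; exact mem_singleton_self z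
  obtain ⟨hzW, hyz⟩ := mem_nbr.1 hz
  obtain ⟨hzX, hfz⟩ := mem_cls.1 hzW
  have honly : ∀ u ∈ X, f u = W → G.Adj y u → u = z := fun u hu hfu hyu => by
    have : u ∈ nbr G (cls X f W) y := mem_nbr.2 ⟨mem_cls.2 ⟨hu, hfu⟩, hyu⟩
    rwa [hsolo, mem_singleton] at this
  obtain ⟨g, hg, hgcard⟩ := h.hasEquitable_outer_erase hy
  set Z := (outer G X K f vm).erase y with hZ
  have hZX : Z ⊆ X := (erase_subset _ _).trans outer_subset
  have hmem : ∀ v, v ∈ X \ Z ↔ v ∈ X ∧ (v = y ∨ f v ∈ acc G X K f vm) := by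
    intro v
    simp only [hZ, mem_sdiff, mem_erase, mem_outer]
    tauto
  have hzyne : z ≠ y := by rintro rfl; exact hfy (hfz ▸ hW.1)
  have hcls : ∀ e ∈ acc G X K f vm, cls (X \ Z) f e = cls X f e := by
    intro e he
    ext v
    simp only [mem_cls, hmem]
    constructor
    · tauto
    · rintro ⟨hv, rfl⟩; tauto
  set f₁ := Function.update (Function.update f z c) y W with hf₁
  have f₁y : f₁ y = W := by simp [hf₁]
  have f₁z : f₁ z = c := by simp [hf₁, hzyne]
  have f₁o : ∀ v, v ≠ y → v ≠ z → f₁ v = f v := fun v h1 h2 => by simp [hf₁, h1, h2]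
  have hcol : IsColoring G (X \ Z) (acc G X K f vm) f₁ := by
    refine ⟨?_, ?_⟩
    · intro v hv
      obtain ⟨-, hv⟩ := (hmem v).1 hv
      by_cases hvy : v = y
      · rw [hvy, f₁y]; exact hW.1
      · by_cases hvz : v = z
        · rw [hvz, f₁z]; exact hc
        · rw [f₁o v hvy hvz]; tauto
    · have keyy : ∀ u ∈ X, u ≠ y → G.Adj y u → f₁ u ≠ W := by
        intro u hu huy hyu
        by_cases huz : u = z
        · rw [huz, f₁z]; exact hcW
        · rw [f₁o u huy huz]; exact fun hfu => huz (honly u hu hfu hyu)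
      have keyz : ∀ u ∈ X, u ≠ y → u ≠ z → G.Adj z u → f₁ u ≠ c := by
        intro u hu huy huz hzu
        rw [f₁o u huy huz]; exact fun hfu => hcon u (mem_cls.2 ⟨hu, hfu⟩) hzu
      intro u hu v hv huv
      replace hu := ((hmem u).1 hu).1
      replace hv := ((hmem v).1 hv).1
      by_cases huy : u = y
      · subst huy; rw [f₁y]; exact (keyy v hv huv.ne' huv).symm
      by_cases hvy : v = y
      · subst hvy; rw [f₁y]; exact keyy u hu huv.ne huv.symm
      by_cases huz : u = z
      · subst huz; rw [f₁z]; exact (keyz v hv hvy huv.ne' huv).symm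
      by_cases hvz : v = z
      · subst hvz; rw [f₁z]; exact keyz u hu huy huv.ne huv.symm
      rw [f₁o u huy huz, f₁o v hvy hvz]
      exact h.near.coloring.proper u hu v hv huv
  have hcard : ∀ e ∈ acc G X K f vm, #(cls (X \ Z) f₁ e) = #(cls X f e) + if e = c then 1 else 0 := by
    intro e he
    have h1 := card_cls_update (f := f) (X := X \ Z) ((hmem z).2 ⟨hzX, .inr (hfz ▸ hW.1)⟩) c e
    have h2 := card_cls_update (f := Function.update f z c) (X := X \ Z)
      ((hmem y).2 ⟨hyX, .inl rfl⟩) W e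
    have hey : e ≠ f y := fun h' => hfy (h' ▸ he)
    rw [Function.update_of_ne hzyne.symm, if_neg hey] at h2
    rw [hcls e he, hfz] at h1
    rw [hf₁]
    omega
  obtain ⟨hcolX, hclsA, hclsB⟩ := hcol.splice hZX hg disjoint_sdiff
  rw [acc_union_sdiff] at hcolX
  set F : V → ℕ := fun v => if v ∈ Z then g v else f₁ v
  have hnear : IsNearEquitable G X K s F vm c := by
    refine ⟨hcolX, h.near.vm_mem, acc_subset hc, fun e he => ?_⟩
    have h0 := h.near.card_cls e he
    by_cases heA : e ∈ acc G X K f vm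
    · have hevp : e ≠ vp := fun h' => h.vp_notMem_acc (h' ▸ heA)
      rw [if_neg hevp] at h0
      rw [hclsA e heA, hcard e heA]
      omega
    · have heB : e ∈ K \ acc G X K f vm := mem_sdiff.2 ⟨he, heA⟩
      have hevm : e ≠ vm := fun h' => heA (h' ▸ h.vm_mem_acc)
      have hec : e ≠ c := fun h' => heA (h' ▸ hc)
      rw [hclsB e heB, hgcard e heB, if_neg hevm, if_neg hec]
  refine h.not_hasEquitable (hnear.hasEquitable (Reach.anti ?_ (Set.empty_subset {W})))
  refine (hW.2 c hc hcW).of_cls_eq ?_ ?_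
  · intro d hd hdc hR
    have hdA := h.near.mem_acc.2 hR
    rw [hclsA d hdA, ← hcls d hdA]
    ext v
    simp only [mem_cls, hmem]
    by_cases hvy : v = y
    · subst hvy; rw [f₁y]
      simp only [Set.mem_singleton_iff] at hd
      constructor
      · rintro ⟨-, h'⟩; exact absurd h'.symm hd
      · rintro ⟨-, rfl⟩; exact absurd hdA hfy
    · by_cases hvz : v = z
      · subst hvz; rw [f₁z, hfz]
        simp only [Set.mem_singleton_iff] at hd
        tauto
      · rw [f₁o v hvy hvz]
  · rw [hclsA c hc, ← hcls c hc]
    intro v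
    simp only [mem_cls, hmem]
    rintro ⟨h1, h2⟩
    refine ⟨h1, ?_⟩
    rw [f₁o v (by rintro rfl; exact hfy (h2 ▸ hc)) (by rintro rfl; exact hcW (h2 ▸ hfz))]
    exact h2

/-- Exchanging a solo vertex `z` of a terminal class with an independent set `P` of its solo
neighbours. -/
theorem exists_exchange (h : Config G X K s f vm vp)
    {W : ℕ} (hW : Terminal G X K f vm W) {z : V} {P : Finset V}
    (hP : ∀ y ∈ P, Solo G X K f vm W z y) (hPne : P.Nonempty)
    (hPind : ∀ y ∈ P, ∀ y' ∈ P, ¬ G.Adj y y') {g : V → ℕ}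
    (hg : IsColoring G (insert z (outer G X K f vm \ P)) (K \ acc G X K f vm) g) :
    ∃ F, IsColoring G X K F ∧ (∀ c ∈ acc G X K f vm, c ≠ W → cls X F c = cls X f c) ∧
      cls X F W = (cls X f W).erase z ∪ P ∧
      (∀ c ∈ K \ acc G X K f vm,
        cls X F c = cls (insert z (outer G X K f vm \ P)) g c) ∧
      ∀ c ∈ acc G X K f vm, Reach (Movable G X F) vm ∅ c := by
  obtain ⟨y₀, hy₀⟩ := hPne
  have hz₀ : z ∈ nbr G (cls X f W) y₀ := by rw [(hP y₀ hy₀).2]; exact mem_singleton_self z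
  obtain ⟨hzX, hfz⟩ := mem_cls.1 (mem_nbr.1 hz₀).1
  have honly : ∀ y ∈ P, ∀ u ∈ X, f u = W → G.Adj y u → u = z := fun y hy u hu hfu hyu => by
    have : u ∈ nbr G (cls X f W) y := mem_nbr.2 ⟨mem_cls.2 ⟨hu, hfu⟩, hyu⟩
    rwa [(hP y hy).2, mem_singleton] at this
  have hPX : ∀ y ∈ P, y ∈ X ∧ f y ∉ acc G X K f vm := fun y hy => mem_outer.1 (hP y hy).1
  set Z := insert z (outer G X K f vm \ P) with hZ
  have hZX : Z ⊆ X := insert_subset hzX (sdiff_subset.trans outer_subset)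
  have hzP : z ∉ P := fun hz => (hPX z hz).2 (hfz ▸ hW.1)
  have hmem : ∀ v, v ∈ X \ Z ↔ v ∈ X ∧ v ≠ z ∧ (v ∈ P ∨ f v ∈ acc G X K f vm) := by
    intro v
    simp only [hZ, mem_sdiff, mem_insert, mem_outer]
    tauto
  have hcol : IsColoring G (X \ Z) (acc G X K f vm) (fun v => if v ∈ P then W else f v) := by
    refine ⟨?_, ?_⟩
    · intro v hv
      obtain ⟨-, -, hv⟩ := (hmem v).1 hv
      by_cases hvP : v ∈ P
      · simpa [hvP] using hW.1
      · simpa [hvP] using hv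
    · intro u hu v hv huv
      obtain ⟨huX, huz, -⟩ := (hmem u).1 hu
      obtain ⟨hvX, hvz, -⟩ := (hmem v).1 hv
      by_cases huP : u ∈ P <;> by_cases hvP : v ∈ P <;> simp only [huP, hvP, if_true, if_false]
      · exact absurd huv (hPind u huP v hvP)
      · exact fun h' => hvz (honly u huP v hvX h'.symm huv)
      · exact fun h' => huz (honly v hvP u huX h' huv.symm)
      · exact h.near.coloring.proper u huX v hvX huv
  obtain ⟨hcolX, hclsA, hclsB⟩ := hcol.splice hZX hg disjoint_sdiff
  rw [acc_union_sdiff] at hcolX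
  set F : V → ℕ := fun v => if v ∈ Z then g v else if v ∈ P then W else f v
  have hother : ∀ c ∈ acc G X K f vm, c ≠ W → cls X F c = cls X f c := by
    intro c hc hcW
    rw [hclsA c hc]
    ext v
    simp only [mem_cls, hmem]
    by_cases hvP : v ∈ P
    · simp only [hvP, if_true]
      constructor
      · rintro ⟨-, h'⟩; exact absurd h'.symm hcW
      · rintro ⟨-, h'⟩; exact absurd (h' ▸ hc) (hPX v hvP).2
    · simp only [hvP, if_false]
      constructor
      · tauto
      · rintro ⟨h1, rfl⟩
        exact ⟨⟨h1, by rintro rfl; exact hcW hfz, .inr hc⟩, rfl⟩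
  have hclsW : cls X F W = (cls X f W).erase z ∪ P := by
    rw [hclsA W hW.1]
    ext v
    simp only [mem_cls, hmem, mem_union, mem_erase]
    by_cases hvP : v ∈ P
    · have : v ≠ z := by rintro rfl; exact hzP hvP
      have := (hPX v hvP).1
      simp only [hvP, if_true]
      tauto
    · simp only [hvP, if_false, false_or, or_false]
      constructor
      · tauto
      · rintro ⟨h0, h1, rfl⟩; exact ⟨⟨h1, h0, hW.1⟩, rfl⟩
  refine ⟨F, hcolX, hother, hclsW, hclsB, ?_⟩
  intro c hc
  refine reach_of_exchange (f := f) (W := W) (z := z) ?_ ?_ ?_ ?_ (h.near.mem_acc.1 hc)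
  · exact fun d hd => hW.2 d (h.near.mem_acc.2 hd)
  · exact fun d hd => hother d (h.near.mem_acc.2 hd)
  · rw [hclsW]; exact subset_union_left
  · exact fun d hd hdW => h.exists_adj_of_solo hW (hP y₀ hy₀) (h.near.mem_acc.2 hd) hdW

end Config

end Config

section Swap

open scoped Classical

variable {V : Type*} {G : SimpleGraph V} {X Y : Finset V} {K L : Finset ℕ} {s : ℕ} {f g : V → ℕ}
  {vm vp : ℕ}

theorem IsColoring.mono (hg : IsColoring G X L g) (hYX : Y ⊆ X) : IsColoring G Y L g :=
  ⟨fun x hx => hg.maps x (hYX hx), fun x hx y hy => hg.proper x (hYX hx) y (hYX hy)⟩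

theorem IsColoring.insert (hg : IsColoring G Y L g) {x : V} (hx : x ∉ Y) {c : ℕ} (hc : c ∈ L)
    (hno : ∀ u ∈ cls Y g c, ¬ G.Adj x u) :
    IsColoring G (insert x Y) L (Function.update g x c) ∧
      ∀ e, #(cls (insert x Y) (Function.update g x c) e)
        = #(cls Y g e) + if e = c then 1 else 0 := by
  have hup : ∀ v ∈ Y, Function.update g x c v = g v := fun v hv =>
    Function.update_of_ne (by rintro rfl; exact hx hv) _ _
  refine ⟨⟨?_, ?_⟩, ?_⟩
  · intro v hv
    rcases mem_insert.1 hv with rfl | hv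
    · simpa using hc
    · rw [hup v hv]; exact hg.maps v hv
  · intro u hu v hv huv
    rcases mem_insert.1 hu with rfl | huY <;> rcases mem_insert.1 hv with rfl | hvY
    · exact absurd huv (G.loopless.irrefl _)
    · rw [hup v hvY, Function.update_self]
      exact fun h => hno v (mem_cls.2 ⟨hvY, h.symm⟩) huv
    · rw [hup u huY, Function.update_self]
      exact fun h => hno u (mem_cls.2 ⟨huY, h⟩) huv.symm
    · rw [hup u huY, hup v hvY]
      exact hg.proper u huY v hvY huv
  · intro e
    rw [cls, filter_insert, Function.update_self]
    have : filter (fun v => Function.update g x c v = e) Y = cls Y g e :=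
      filter_congr fun v hv => by rw [hup v hv]
    rw [this]
    by_cases hce : c = e
    · rw [if_pos hce, if_pos hce.symm, card_insert_of_notMem]
      exact fun h => hx (mem_cls.1 h).1
    · rw [if_neg hce, if_neg (Ne.symm hce), add_zero]

theorem card_cls_erase {y : V} (hy : y ∈ Y) (e : ℕ) :
    #(cls (Y.erase y) g e) + (if e = g y then 1 else 0) = #(cls Y g e) := by
  have : cls (Y.erase y) g e = (cls Y g e).erase y := by
    ext v; simp only [mem_cls, mem_erase]; tauto
  rw [this]
  split_ifs with h
  · rw [card_erase_add_one]
    exact mem_cls.2 ⟨hy, h.symm⟩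
  · rw [erase_eq_of_notMem, add_zero]
    exact fun h' => h (mem_cls.1 h').2.symm

theorem IsColoring.card_nbr_eq_sum (hg : IsColoring G Y L g) (v : V) :
    #(nbr G Y v) = ∑ c ∈ L, #(nbr G (cls Y g c) v) := by
  rw [card_eq_sum_card_fiberwise (f := g) (t := L)]
  · refine sum_congr rfl fun c _ => ?_
    congr 1
    ext u
    simp only [mem_filter, mem_nbr, mem_cls]
    tauto
  · exact fun u hu => hg.maps u (mem_nbr.1 (mem_coe.1 hu)).1

namespace Config

theorem Solo.mem_cls_adj {W : ℕ} {z y : V} (hzy : Solo G X K f vm W z y) :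
    z ∈ X ∧ f z = W ∧ G.Adj y z := by
  have hz : z ∈ nbr G (cls X f W) y := by rw [hzy.2]; exact mem_singleton_self z
  simpa [and_assoc] using hz

theorem card_nbr_outer_solo (h : Config G X K s f vm vp)
    {W : ℕ} (hW : Terminal G X K f vm W) {z y : V}
    (hzy : Solo G X K f vm W z y) :
    #(nbr G (outer G X K f vm) z) + #(acc G X K f vm) ≤ #(nbr G X z) + 1 := by
  rw [card_nbr_eq (X := X) (K := K) (f := f) (vm := vm) z, ← card_erase_add_one hW.1,
    ← add_assoc, ← add_sum_erase _ _ hW.1, card_eq_sum_ones ((acc G X K f vm).erase W)]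
  have : ∑ c ∈ (acc G X K f vm).erase W, 1
      ≤ ∑ c ∈ (acc G X K f vm).erase W, #(nbr G (cls X f c) z) := by
    refine sum_le_sum fun c hc => ?_
    obtain ⟨hcW, hc⟩ := mem_erase.1 hc
    obtain ⟨u, hu, hzu⟩ := h.exists_adj_of_solo hW hzy hc hcW
    exact card_pos.2 ⟨u, mem_nbr.2 ⟨hu, hzu⟩⟩
  omega

/-- Removing `y` from the outer part and adding its solo neighbour `z` leaves a nearly equitably
colorable graph. -/
theorem exists_coloring_insert_erase (h : Config G X K s f vm vp)
    {W : ℕ} (hW : Terminal G X K f vm W) {z y : V}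
    (hzy : Solo G X K f vm W z y) :
    ∃ g, ∃ p ∈ K \ acc G X K f vm,
      IsColoring G (insert z (outer G X K f vm \ {y})) (K \ acc G X K f vm) g ∧
      ∀ c ∈ K \ acc G X K f vm, #(cls (insert z (outer G X K f vm \ {y})) g c)
        = s + if c = p then 1 else 0 := by
  obtain ⟨hzX, hfz, hyz⟩ := Solo.mem_cls_adj hzy
  have hy := hzy.1
  obtain ⟨g, hg, hgs⟩ := h.hasEquitable_outer_erase hy
  rw [← erase_eq]
  have hLcard : #(K \ acc G X K f vm) = #K - #(acc G X K f vm) := card_sdiff_acc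
  have hlt := h.card_acc_lt
  set B := outer G X K f vm with hB
  set L := K \ acc G X K f vm with hL
  have hzB : z ∉ B := fun hz => (mem_outer.1 hz).2 (hfz ▸ hW.1)
  have hzY : z ∉ B.erase y := fun hz => hzB (mem_of_mem_erase hz)
  by_cases hfree : ∃ c ∈ L, ∀ u ∈ cls (B.erase y) g c, ¬ G.Adj z u
  · obtain ⟨c, hc, hno⟩ := hfree
    obtain ⟨h1, h2⟩ := hg.insert hzY hc hno
    exact ⟨_, c, hc, h1, fun e he => by rw [h2, hgs e he]⟩
  push Not at hfree
  have hone : ∀ c ∈ L, 1 ≤ #(nbr G (cls (B.erase y) g c) z) := fun c hc => by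
    obtain ⟨u, hu, hzu⟩ := hfree c hc
    exact card_pos.2 ⟨u, mem_nbr.2 ⟨hu, hzu⟩⟩
  have hdz := h.card_nbr_outer_solo hW hzy
  have hdy := h.card_nbr_outer_add_le hy
  rw [← hB] at hdz hdy
  have hore := h.ore y (outer_subset hy) z hzX hyz
  have herase : #(nbr G B z) = #(nbr G (B.erase y) z) + 1 := by
    have : nbr G (B.erase y) z = (nbr G B z).erase y := by
      ext v; simp only [mem_nbr, mem_erase]; tauto
    rw [this, card_erase_add_one]
    exact mem_nbr.2 ⟨hy, hyz.symm⟩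
  have hsum := hg.card_nbr_eq_sum z
  have hge : #L ≤ #(nbr G (B.erase y) z) := by
    rw [hsum, card_eq_sum_ones]; exact sum_le_sum hone
  have hex : ∃ c ∈ L, #(nbr G (cls (B.erase y) g c) z) < 2 := by
    by_contra! hcon
    have : ∑ c ∈ L, 2 ≤ #(nbr G (B.erase y) z) := by rw [hsum]; exact sum_le_sum hcon
    rw [sum_const, smul_eq_mul] at this
    omega
  obtain ⟨c, hc, hc2⟩ := hex
  obtain ⟨y', hy'⟩ := card_eq_one.1 (le_antisymm (Nat.lt_succ_iff.1 hc2) (hone c hc))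
  have hy'mem : y' ∈ nbr G (cls (B.erase y) g c) z := by rw [hy']; exact mem_singleton_self _
  obtain ⟨hy'c, hzy'⟩ := mem_nbr.1 hy'mem
  obtain ⟨hy'Y, hgy'⟩ := mem_cls.1 hy'c
  obtain ⟨hy'y, hy'B⟩ := mem_erase.1 hy'Y
  have hno : ∀ u ∈ cls ((B.erase y).erase y') g c, ¬ G.Adj z u := by
    intro u hu hzu
    obtain ⟨hu, hgu⟩ := mem_cls.1 hu
    obtain ⟨huy', hu⟩ := mem_erase.1 hu
    have : u ∈ nbr G (cls (B.erase y) g c) z := mem_nbr.2 ⟨mem_cls.2 ⟨hu, hgu⟩, hzu⟩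
    rw [hy', mem_singleton] at this
    exact huy' this
  have hzY' : z ∉ (B.erase y).erase y' := fun hz => hzY (mem_of_mem_erase hz)
  obtain ⟨hcol, hcard⟩ := (hg.mono (erase_subset y' _)).insert hzY' hc hno
  have hcard' : ∀ e ∈ L, #(cls (Insert.insert z ((B.erase y).erase y')) (Function.update g z c) e)
      = s := by
    intro e he
    have h1 := card_cls_erase (g := g) hy'Y e
    rw [hgs e he, hgy'] at h1
    rw [hcard e, h1]
  have hcol_eq : ∀ u ∈ (B.erase y).erase y', Function.update g z c u = g u := fun u hu =>
    Function.update_of_ne (by rintro rfl; exact hzY' hu) _ _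
  by_cases hfree' : ∃ e ∈ L, e ≠ c ∧ ∀ u ∈ cls (B.erase y) g e, ¬ G.Adj y' u
  · obtain ⟨e, he, hec, hno'⟩ := hfree'
    have hy'Z : y' ∉ Insert.insert z ((B.erase y).erase y') := by
      simp only [mem_insert, mem_erase, not_or, ne_eq, not_true, false_and, not_false_iff, and_true]
      exact hzy'.ne'
    have hno'' : ∀ u ∈ cls (Insert.insert z ((B.erase y).erase y')) (Function.update g z c) e,
        ¬ G.Adj y' u := by
      intro u hu
      obtain ⟨hu, hgu⟩ := mem_cls.1 hu
      rcases mem_insert.1 hu with rfl | hu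
      · rw [Function.update_self] at hgu; exact absurd hgu.symm hec
      · rw [hcol_eq u hu] at hgu
        exact hno' u (mem_cls.2 ⟨mem_of_mem_erase hu, hgu⟩)
    obtain ⟨h1, h2⟩ := hcol.insert hy'Z he hno''
    rw [Finset.insert_comm, insert_erase hy'Y] at h1 h2
    exact ⟨_, e, he, h1, fun e' he' => by rw [h2, hcard' e' he']⟩
  exfalso
  push Not at hfree'
  have hdy' := h.ore z hzX y' (outer_subset hy'B) hzy'
  have hdeg' : #L ≤ #(nbr G (B.erase y) y') + 1 := by
    rw [hg.card_nbr_eq_sum y', ← card_erase_add_one hc, card_eq_sum_ones]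
    refine Nat.succ_le_succ ((sum_le_sum fun e he => ?_).trans
      (sum_le_sum_of_subset (erase_subset c L)))
    obtain ⟨hec, he⟩ := mem_erase.1 he
    obtain ⟨u, hu, hu'⟩ := hfree' e he hec
    exact card_pos.2 ⟨u, mem_nbr.2 ⟨hu, hu'⟩⟩
  have hmono := card_nbr_mono (G := G) (erase_subset y B) y'
  have hsplit := card_nbr_eq (G := G) (X := X) (K := K) (f := f) (vm := vm) y'
  rw [← hB, ← add_sum_erase _ _ hW.1] at hsplit
  have hrest : #((acc G X K f vm).erase W)
      ≤ ∑ e ∈ (acc G X K f vm).erase W, #(nbr G (cls X f e) y') := by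
    rw [card_eq_sum_ones]
    exact sum_le_sum fun e he => h.one_le_card_nbr_cls hy'B (mem_of_mem_erase he)
  rw [card_erase_of_mem hW.1] at hrest
  have hWy' := h.one_le_card_nbr_cls hy'B hW.1
  have hsolo' : Solo G X K f vm W z y' := by
    refine ⟨hy'B, (eq_of_subset_of_card_le ?_ ?_).symm⟩
    · rw [singleton_subset_iff]
      exact mem_nbr.2 ⟨mem_cls.2 ⟨hzX, hfz⟩, hzy'.symm⟩
    · rw [card_singleton]; omega
  have hnadj : ¬ G.Adj y' y := by
    intro hadj
    have : nbr G (B.erase y) y' = (nbr G B y').erase y := by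
      ext v; simp only [mem_nbr, mem_erase]; tauto
    have hlt' : #(nbr G (B.erase y) y') < #(nbr G B y') := by
      rw [this]; exact card_erase_lt_of_mem (mem_nbr.2 ⟨hy, hadj⟩)
    omega
  have hPeq : B \ {y, y'} = (B.erase y).erase y' := by
    ext v; simp only [mem_sdiff, mem_insert, mem_singleton, mem_erase]; tauto
  obtain ⟨F, hF, hFA, hFW, hFL, hFR⟩ := h.exists_exchange hW (z := z) (P := {y, y'})
    (by simp [hzy, hsolo']) (by simp)
    (by
      simp only [mem_insert, mem_singleton]
      rintro u (rfl | rfl) v (rfl | rfl)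
      · exact G.loopless.irrefl _
      · exact fun h' => hnadj h'.symm
      · exact hnadj
      · exact G.loopless.irrefl _)
    (g := Function.update g z c) (by rw [← hB, hPeq]; exact hcol)
  rw [← hB, hPeq] at hFL
  refine h.not_hasEquitable (IsNearEquitable.hasEquitable (f := F) (vm := vm) (vp := W)
    ⟨hF, h.near.vm_mem, acc_subset hW.1, fun e he => ?_⟩ (hFR W hW.1))
  have h0 := h.near.card_cls e he
  by_cases heA : e ∈ acc G X K f vm
  · have hevp : e ≠ vp := fun h' => h.vp_notMem_acc (h' ▸ heA)
    rw [if_neg hevp] at h0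
    by_cases heW : e = W
    · subst heW
      have : #(cls X F e) = #(cls X f e) + 1 := by
        rw [hFW, card_union_of_disjoint, card_erase_of_mem (mem_cls.2 ⟨hzX, hfz⟩),
          card_pair hy'y.symm]
        · have := card_pos.2 ⟨z, mem_cls.2 ⟨hzX, hfz⟩⟩
          omega
        · rw [disjoint_left]
          intro v hv hv'
          have hv := (mem_cls.1 (mem_of_mem_erase hv)).2
          have : v ∈ B := by
            rcases mem_insert.1 hv' with rfl | hv'
            · exact hy
            · rw [mem_singleton.1 hv']; exact hy'B
          exact (mem_outer.1 this).2 (hv ▸ hW.1)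
      rw [if_pos rfl, this]
      omega
    · rw [hFA e heA heW, if_neg heW]
      exact h0
  · have heL : e ∈ L := mem_sdiff.2 ⟨he, heA⟩
    have hevm : e ≠ vm := fun h' => heA (h' ▸ h.vm_mem_acc)
    have heW : e ≠ W := fun h' => heA (h' ▸ hW.1)
    rw [hFL e heL, hcard' e heL, if_neg hevm, if_neg heW]

/-- Exchanging a solo vertex of a terminal class with one of its solo neighbours gives another
nearly equitable coloring. -/
theorem exists_swap (h : Config G X K s f vm vp) {W : ℕ} (hW : Terminal G X K f vm W) {z y : V}
    (hzy : Solo G X K f vm W z y) :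
    ∃ F p, Config G X K s F vm p ∧ acc G X K f vm ⊆ acc G X K F vm ∧
      cls X F W = insert y ((cls X f W).erase z) ∧
      ∀ v ∈ X, F v ∈ acc G X K f vm ↔ v ∉ insert z ((outer G X K f vm).erase y) := by
  obtain ⟨hzX, hfz, hyz⟩ := Solo.mem_cls_adj hzy
  obtain ⟨g, p, hp, hg, hgs⟩ := h.exists_coloring_insert_erase hW hzy
  obtain ⟨F, hF, hFA, hFW, hFL, hFR⟩ := h.exists_exchange hW (z := z) (P := {y})
    (by simpa using hzy) (by simp) (by simp) hg
  have hzy_ne : y ∉ (cls X f W).erase z := fun hmem =>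
    (mem_outer.1 hzy.1).2 ((mem_cls.1 (mem_of_mem_erase hmem)).2 ▸ hW.1)
  have hFW' : cls X F W = Insert.insert y ((cls X f W).erase z) := by
    rw [hFW, union_comm]; rfl
  have hnear : IsNearEquitable G X K s F vm p := by
    refine ⟨hF, h.near.vm_mem, (mem_sdiff.1 hp).1, fun e he => ?_⟩
    have h0 := h.near.card_cls e he
    by_cases heA : e ∈ acc G X K f vm
    · have hevp : e ≠ vp := fun h' => h.vp_notMem_acc (h' ▸ heA)
      have hep : e ≠ p := fun h' => (mem_sdiff.1 hp).2 (h' ▸ heA)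
      rw [if_neg hevp] at h0
      rw [if_neg hep]
      by_cases heW : e = W
      · subst heW
        rwa [hFW', card_insert_of_notMem hzy_ne, card_erase_add_one (mem_cls.2 ⟨hzX, hfz⟩)]
      · rwa [hFA e heA heW]
    · have heL := mem_sdiff.2 ⟨he, heA⟩
      have hevm : e ≠ vm := fun h' => heA (h' ▸ h.vm_mem_acc)
      rw [hFL e heL, hgs e heL, if_neg hevm, add_zero]
  refine ⟨F, p, ⟨hnear, h.ore, h.not_hasEquitable, h.ih⟩, ?_, hFW', ?_⟩
  · exact fun c hc => hnear.mem_acc.2 (hFR c hc)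
  · intro v hv
    rw [erase_eq]
    constructor
    · intro hFv hmem
      by_cases hvW : F v = W
      · have : v ∈ cls X F W := mem_cls.2 ⟨hv, hvW⟩
        rw [hFW'] at this
        simp only [mem_insert, mem_erase, mem_cls, mem_sdiff, mem_singleton, mem_outer] at this hmem
        rcases this with rfl | ⟨h1, h2, h3⟩
        · rcases hmem with h' | h'
          · exact hyz.ne h'
          · exact h'.2 rfl
        · rcases hmem with h' | h'
          · exact h1 h'
          · exact h'.1.2 (h3 ▸ hW.1)
      · have : v ∈ cls X F (F v) := mem_cls.2 ⟨hv, rfl⟩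
        rw [hFA _ hFv hvW, mem_cls] at this
        simp only [mem_insert, mem_sdiff, mem_outer] at hmem
        rcases hmem with rfl | h'
        · exact hvW (this.2.symm.trans hfz)
        · exact h'.1.2 (this.2 ▸ hFv)
    · intro hmem
      by_contra hFv
      have : v ∈ cls X F (F v) := mem_cls.2 ⟨hv, rfl⟩
      rw [hFL _ (mem_sdiff.2 ⟨hF.maps v hv, hFv⟩), mem_cls] at this
      exact hmem this.1

end Config

end Swap

section Extremal

open scoped Classical

variable {V : Type*} (G : SimpleGraph V)

/-- The secondary quantity that is minimized among the nearly equitable colorings with the largest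
number of accessible classes. -/
noncomputable def potential (X : Finset V) (K : Finset ℕ) (f : V → ℕ) (vm : ℕ) : ℕ :=
  if #K = #(acc G X K f vm) + 1 then ∑ v ∈ outer G X K f vm, #(nbr G X v)
  else ∑ v ∈ X \ outer G X K f vm, #(nbr G X v)

/-- A nearly equitable coloring with the largest number of accessible classes and, subject to
this, the least potential. -/
structure Extremal (X : Finset V) (K : Finset ℕ) (s : ℕ) (f : V → ℕ) (vm vp : ℕ) : Prop
    extends Config G X K s f vm vp where
  card_acc_le : ∀ F p, Config G X K s F vm p → #(acc G X K F vm) ≤ #(acc G X K f vm)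
  potential_le : ∀ F p, Config G X K s F vm p → #(acc G X K F vm) = #(acc G X K f vm) →
    potential G X K f vm ≤ potential G X K F vm

variable {G} {X : Finset V} {K : Finset ℕ} {s : ℕ} {f : V → ℕ} {vm vp : ℕ}

theorem Config.exists_extremal (h : Config G X K s f vm vp) : ∃ F p, Extremal G X K s F vm p := by
  let μ : (V → ℕ) → ℕ ×ₗ ℕ := fun F =>
    toLex (#K - #(acc G X K F vm), potential G X K F vm)
  obtain ⟨F, ⟨p, hF⟩, hmin⟩ := (InvImage.wf μ wellFounded_lt).has_min
    {F | ∃ p, Config G X K s F vm p} ⟨f, vp, h⟩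
  have hmin' : ∀ F' p', Config G X K s F' vm p' → μ F ≤ μ F' := fun F' p' h' =>
    not_lt.1 (hmin F' ⟨p', h'⟩)
  refine ⟨F, p, hF, fun F' p' h' => ?_, fun F' p' h' heq => ?_⟩
  · have h1 := Prod.Lex.toLex_le_toLex.1 (hmin' F' p' h')
    have h2 := h'.card_acc_lt
    have h3 := hF.card_acc_lt
    simp only at h1
    omega
  · have h1 := Prod.Lex.toLex_le_toLex.1 (hmin' F' p' h')
    simp only [heq, lt_irrefl, true_and, false_or] at h1
    exact h1

namespace Extremal

theorem exists_swap (h : Extremal G X K s f vm vp) {W : ℕ} (hW : Terminal G X K f vm W) {z y : V}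
    (hzy : Solo G X K f vm W z y) :
    ∃ F p, Config G X K s F vm p ∧ acc G X K F vm = acc G X K f vm ∧
      cls X F W = insert y ((cls X f W).erase z) ∧
      outer G X K F vm = insert z ((outer G X K f vm).erase y) := by
  obtain ⟨F, p, hF, hacc, hcls, houter⟩ := h.toConfig.exists_swap hW hzy
  have heq := (eq_of_subset_of_card_le hacc (h.card_acc_le F p hF)).symm
  refine ⟨F, p, hF, heq, hcls, ?_⟩
  ext v
  rw [mem_outer, heq]
  constructor
  · rintro ⟨hv, hFv⟩
    by_contra hcon
    exact hFv ((houter v hv).2 hcon)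
  · intro hv
    have hvX : v ∈ X := by
      rcases mem_insert.1 hv with rfl | hv
      · exact (Config.Solo.mem_cls_adj hzy).1
      · exact outer_subset (mem_of_mem_erase hv)
    exact ⟨hvX, fun hFv => (houter v hvX).1 hFv hv⟩

theorem adj_of_solo (h : Extremal G X K s f vm vp) {W : ℕ} (hW : Terminal G X K f vm W) {z y y' : V}
    (hzy : Solo G X K f vm W z y) (hzy' : Solo G X K f vm W z y') (hne : y ≠ y') :
    G.Adj y y' := by
  obtain ⟨F, p, hF, hacc, hcls, houter⟩ := h.exists_swap hW hzy
  have hy' : y' ∈ outer G X K F vm := by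
    rw [houter]; exact mem_insert_of_mem (mem_erase.2 ⟨hne.symm, hzy'.1⟩)
  obtain ⟨u, hu, hyu⟩ := hF.exists_adj_of_mem_outer hy' (hacc ▸ hW.1)
  rw [hcls] at hu
  rcases mem_insert.1 hu with rfl | hu
  · exact hyu.symm
  · obtain ⟨huz, hu⟩ := mem_erase.1 hu
    have : u ∈ nbr G (cls X f W) y' := mem_nbr.2 ⟨hu, hyu⟩
    rw [hzy'.2, mem_singleton] at this
    exact absurd this huz

theorem solo_notMem_outer {W : ℕ} (hW : Terminal G X K f vm W) {z y : V}
    (hzy : Solo G X K f vm W z y) : z ∉ outer G X K f vm := fun hz =>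
  (mem_outer.1 hz).2 ((Config.Solo.mem_cls_adj hzy).2.1 ▸ hW.1)

theorem degree_le_of_solo (h : Extremal G X K s f vm vp)
    {W : ℕ} (hW : Terminal G X K f vm W) {z y : V}
    (hzy : Solo G X K f vm W z y) (hq : #K ≠ #(acc G X K f vm) + 1) :
    #(nbr G X z) ≤ #(nbr G X y) := by
  obtain ⟨F, p, hF, hacc, hcls, houter⟩ := h.exists_swap hW hzy
  have hzX := (Config.Solo.mem_cls_adj hzy).1
  have hzB := solo_notMem_outer hW hzy
  have hpot := h.potential_le F p hF (by rw [hacc])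
  rw [potential, potential, hacc, if_neg hq, if_neg hq, houter] at hpot
  have hsub : insert z ((outer G X K f vm).erase y) ⊆ X := houter ▸ outer_subset
  have h1 := sum_sdiff (f := fun v => #(nbr G X v))
    (outer_subset (G := G) (X := X) (K := K) (f := f) (vm := vm))
  have h2 := sum_sdiff (f := fun v => #(nbr G X v)) hsub
  rw [sum_insert (fun hz => hzB (mem_of_mem_erase hz))] at h2
  have h3 := add_sum_erase (f := fun v => #(nbr G X v)) _ hzy.1
  omega

theorem degree_le_of_solo' (h : Extremal G X K s f vm vp)
    {W : ℕ} (hW : Terminal G X K f vm W) {z y : V}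
    (hzy : Solo G X K f vm W z y) (hq : #K = #(acc G X K f vm) + 1) :
    #(nbr G X y) ≤ #(nbr G X z) := by
  obtain ⟨F, p, hF, hacc, hcls, houter⟩ := h.exists_swap hW hzy
  have hzB := solo_notMem_outer hW hzy
  have hpot := h.potential_le F p hF (by rw [hacc])
  rw [potential, potential, hacc, if_pos hq, if_pos hq, houter,
    sum_insert (fun hz => hzB (mem_of_mem_erase hz))] at hpot
  have h3 := add_sum_erase (f := fun v => #(nbr G X v)) _ hzy.1
  omega

theorem nbr_outer_of_solo (h : Extremal G X K s f vm vp)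
    {W : ℕ} (hW : Terminal G X K f vm W) {z y : V}
    (hzy : Solo G X K f vm W z y) (hq : #K = #(acc G X K f vm) + 1) :
    nbr G (outer G X K f vm) z ⊆ {y} := by
  obtain ⟨F, p, hF, hacc, hcls, houter⟩ := h.exists_swap hW hzy
  obtain ⟨c, hc⟩ : ∃ c, K \ acc G X K f vm = {c} := by
    rw [← card_eq_one, Config.card_sdiff_acc]; omega
  have hcol : ∀ v ∈ outer G X K F vm, F v = c := fun v hv => by
    obtain ⟨hvX, hv⟩ := mem_outer.1 hv
    have : F v ∈ K \ acc G X K f vm := mem_sdiff.2 ⟨hF.near.coloring.maps v hvX, hacc ▸ hv⟩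
    rwa [hc, mem_singleton] at this
  intro u hu
  obtain ⟨huB, hzu⟩ := mem_nbr.1 hu
  rw [mem_singleton]
  by_contra huy
  have hz : z ∈ outer G X K F vm := by rw [houter]; exact mem_insert_self _ _
  have hu : u ∈ outer G X K F vm := by
    rw [houter]; exact mem_insert_of_mem (mem_erase.2 ⟨huy, huB⟩)
  exact hF.near.coloring.proper z (outer_subset hz) u (outer_subset hu) hzu
    ((hcol z hz).trans (hcol u hu).symm)

end Extremal

end Extremal

section Family

open scoped Classical

variable {V : Type*} (G : SimpleGraph V)

/-- A family of terminal classes whose vertices have neighbours in almost all the other accessible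
classes. -/
structure TerminalFamily (X : Finset V) (K : Finset ℕ) (f : V → ℕ) (vm : ℕ) (T : Finset ℕ) :
    Prop where
  nonempty : T.Nonempty
  terminal : ∀ W ∈ T, Terminal G X K f vm W
  card_nbr_outer_le : ∀ W ∈ T, ∀ z ∈ cls X f W,
    #(nbr G (outer G X K f vm) z) + #(acc G X K f vm) ≤ #(nbr G X z) + #T + 1

/-- The classes of `T` in which `y` has several neighbours. -/
noncomputable def heavy (X : Finset V) (f : V → ℕ) (T : Finset ℕ) (y : V) : Finset ℕ :=
  T.filter fun W => 2 ≤ #(nbr G (cls X f W) y)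

variable {G} {X : Finset V} {K T : Finset ℕ} {s : ℕ} {f : V → ℕ} {vm vp : ℕ}

theorem sum_nbr_comm {M : Type*} [AddCommMonoid M] (A B : Finset V) (φ : V → V → M) :
    ∑ y ∈ B, ∑ z ∈ nbr G A y, φ z y = ∑ z ∈ A, ∑ y ∈ nbr G B z, φ z y := by
  refine sum_comm' fun y z => ?_
  simp only [mem_nbr, G.adj_comm y z]
  tauto

theorem Config.exists_terminalFamily (h : Config G X K s f vm vp) :
    ∃ T, TerminalFamily G X K f vm T := by
  obtain ⟨T, hT, hne, hterm, U, hU⟩ := exists_terminal_family (Movable G X f) vm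
    (acc G X K f vm) fun c => h.near.mem_acc
  refine ⟨T, hne, fun W hW => ⟨hT hW, hterm W hW⟩, fun W hW z hz => ?_⟩
  rw [card_nbr_eq (X := X) (K := K) (f := f) (vm := vm) z]
  have h1 : #(acc G X K f vm \ insert U T) ≤ ∑ c ∈ acc G X K f vm, #(nbr G (cls X f c) z) := by
    rw [card_eq_sum_ones]
    refine (sum_le_sum fun c hc => ?_).trans (sum_le_sum_of_subset sdiff_subset)
    obtain ⟨hc, hcT⟩ := mem_sdiff.1 hc
    by_contra hcon
    have : nbr G (cls X f c) z = ∅ := by rw [← card_eq_zero]; omega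
    have hmov : Movable G X f W c :=
      ⟨z, hz, fun u hu hzu => Finset.notMem_empty u (this ▸ mem_nbr.2 ⟨hu, hzu⟩)⟩
    rcases hU W hW c hc hmov with h' | h'
    · exact hcT (mem_insert_of_mem h')
    · exact hcT (h' ▸ mem_insert_self _ _)
  have h2 := le_card_sdiff (insert U T) (acc G X K f vm)
  have h3 := card_insert_le U T
  omega

namespace TerminalFamily

theorem subset_acc (hT : TerminalFamily G X K f vm T) : T ⊆ acc G X K f vm :=
  fun W hW => (hT.terminal W hW).1

theorem card_nbr_ge (hT : TerminalFamily G X K f vm T) (h : Config G X K s f vm vp) {y : V}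
    (hy : y ∈ outer G X K f vm) :
    #(nbr G (outer G X K f vm) y) + #(acc G X K f vm) + #(heavy G X f T y) ≤ #(nbr G X y) := by
  rw [Config.card_nbr_eq (X := X) (K := K) (f := f) (vm := vm) y]
  have : #(acc G X K f vm) + #(heavy G X f T y)
      ≤ ∑ c ∈ acc G X K f vm, #(nbr G (cls X f c) y) := by
    have hsub : heavy G X f T y ⊆ acc G X K f vm := (filter_subset _ _).trans hT.subset_acc
    rw [card_eq_sum_ones (acc G X K f vm), card_eq_sum_ones (heavy G X f T y),
      ← sum_sdiff hsub (f := fun _ => 1), ← sum_sdiff hsub (f := fun c => #(nbr G (cls X f c) y)),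
      add_assoc, ← sum_add_distrib]
    refine Nat.add_le_add (sum_le_sum fun c hc => ?_) (sum_le_sum fun c hc => ?_)
    · exact h.one_le_card_nbr_cls hy (mem_sdiff.1 hc).1
    · exact (mem_filter.1 hc).2
  omega

theorem exists_solo (hT : TerminalFamily G X K f vm T) (h : Config G X K s f vm vp) {y : V}
    (hy : y ∈ outer G X K f vm) {W : ℕ} (hW : W ∈ T) (hWy : W ∉ heavy G X f T y) :
    ∃ z, Solo G X K f vm W z y := by
  have h1 := h.one_le_card_nbr_cls hy (hT.subset_acc hW)
  have h2 : ¬ 2 ≤ #(nbr G (cls X f W) y) := fun h' => hWy (mem_filter.2 ⟨hW, h'⟩)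
  obtain ⟨z, hz⟩ := card_eq_one.1 (show #(nbr G (cls X f W) y) = 1 by omega)
  exact ⟨z, hy, hz⟩

end TerminalFamily

theorem Extremal.card_ne_card_acc_add_one (h : Extremal G X K s f vm vp) :
    #K ≠ #(acc G X K f vm) + 1 := by
  intro hq
  obtain ⟨T, hT⟩ := h.exists_terminalFamily
  obtain ⟨W, hW⟩ := hT.nonempty
  have hcardB := h.card_outer
  have hcardW := h.card_cls_acc_le (hT.subset_acc hW)
  have hone : ∀ y ∈ outer G X K f vm, (1 : ℚ) ≤
      ∑ z ∈ nbr G (cls X f W) y, 1 / (#(nbr G (outer G X K f vm) z) : ℚ) := by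
    intro y hy
    have hpos : ∀ z ∈ nbr G (cls X f W) y, 0 < (#(nbr G (outer G X K f vm) z) : ℚ) := by
      intro z hz
      exact_mod_cast card_pos.2 ⟨y, mem_nbr.2 ⟨hy, (mem_nbr.1 hz).2.symm⟩⟩
    by_cases hWy : W ∈ heavy G X f T y
    · have hall : heavy G X f T y = T := by
        refine (filter_subset _ _).antisymm fun W' hW' => ?_
        by_contra hW'y
        obtain ⟨z', hz'⟩ := hT.exists_solo h.toConfig hy hW' hW'y
        have h1 := h.degree_le_of_solo' (hT.terminal W' hW') hz' hq
        obtain ⟨hz'X, -, hyz'⟩ := Config.Solo.mem_cls_adj hz'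
        have h2 := h.ore y (outer_subset hy) z' hz'X hyz'
        have h3 := hT.card_nbr_ge h.toConfig hy
        have h4 := card_pos.2 ⟨W, hWy⟩
        omega
      have hle : ∀ z ∈ nbr G (cls X f W) y,
          (1 / 2 : ℚ) ≤ 1 / (#(nbr G (outer G X K f vm) z) : ℚ) := by
        intro z hz
        refine one_div_le_one_div_of_le (hpos z hz) ?_
        obtain ⟨hzW, hyz⟩ := mem_nbr.1 hz
        have h1 := hT.card_nbr_outer_le W hW z hzW
        have h2 := h.ore y (outer_subset hy) z (mem_cls.1 hzW).1 hyz
        have h3 := hT.card_nbr_ge h.toConfig hy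
        rw [hall] at h3
        have : #(nbr G (outer G X K f vm) z) ≤ 2 := by omega
        exact_mod_cast this
      refine le_trans ?_ (sum_le_sum hle)
      rw [sum_const, nsmul_eq_mul]
      have : (2 : ℚ) ≤ #(nbr G (cls X f W) y) := by exact_mod_cast (mem_filter.1 hWy).2
      linarith
    · obtain ⟨z, hz⟩ := hT.exists_solo h.toConfig hy hW hWy
      rw [hz.2, sum_singleton]
      have h1 := card_le_card (h.nbr_outer_of_solo (hT.terminal W hW) hz hq)
      rw [card_singleton] at h1
      have h2 := hpos z (by rw [hz.2]; exact mem_singleton_self z)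
      rw [le_div_iff₀ h2, one_mul]
      exact_mod_cast h1
  have hload : ∀ z ∈ cls X f W,
      ∑ y ∈ nbr G (outer G X K f vm) z, 1 / (#(nbr G (outer G X K f vm) z) : ℚ) ≤ 1 := by
    intro z _
    rw [sum_const, nsmul_eq_mul, mul_one_div]
    exact div_self_le_one _
  have htot := (sum_le_sum hone).trans_eq
    (sum_nbr_comm (cls X f W) _ fun z _ => 1 / (#(nbr G (outer G X K f vm) z) : ℚ))
  have htot' := htot.trans (sum_le_sum hload)
  rw [sum_const, sum_const, nsmul_eq_mul, nsmul_eq_mul, mul_one, mul_one] at htot'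
  have : #(outer G X K f vm) ≤ #(cls X f W) := by exact_mod_cast htot'
  rw [hcardB, hq, Nat.add_sub_cancel_left] at this
  omega

end Family

section Inequalities

variable {t n q c w m M β h γ : ℚ}

theorem bound_of_class_bound (hq : 0 < q) (hw : 1 / q ≤ w) (hm : 0 < m)
    (hmq : m ≤ q + t) (hM : 0 < M) (hMq : M ≤ 2 * q) (hn : 0 ≤ n) (hnt : n ≤ t) :
    t / q ≤ (t - n) * (t * w + 1) / m + 2 * n / M := by
  have ht : 0 ≤ t := hn.trans hnt
  have h1 : 1 / q ≤ (t * w + 1) / m := by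
    rw [div_le_div_iff₀ hq hm]
    have : 1 ≤ w * q := by rwa [div_le_iff₀ hq] at hw
    nlinarith
  have h2 : 1 / q ≤ 2 / M := by
    rw [div_le_div_iff₀ hq hM]; linarith
  calc t / q = (t - n) * (1 / q) + n * (1 / q) := by ring
    _ ≤ (t - n) * ((t * w + 1) / m) + n * (2 / M) :=
      add_le_add (mul_le_mul_of_nonneg_left h1 (sub_nonneg.2 hnt)) (mul_le_mul_of_nonneg_left h2 hn)
    _ = _ := by ring

theorem mul_le_mul_of_budget (hq : 0 < q) (ht : 0 ≤ t) (hβ : 1 ≤ β) (hn : 0 ≤ n) (hc : 1 ≤ c)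
    (hb : β + n ≤ q + 1 - c) (htc : q + 1 ≤ t + c) : t * β ≤ (t - n) * q := by
  have h1 : t * β ≤ t * (q + 1 - c - n) := mul_le_mul_of_nonneg_left (by linarith) ht
  refine h1.trans ?_
  rcases le_total t q with htq | htq
  · nlinarith [mul_nonneg (show 0 ≤ q + 1 - c - n by linarith) (sub_nonneg.2 htq),
      mul_nonneg hq.le (show 0 ≤ t - (q + 1 - c) by linarith)]
  · nlinarith [mul_nonneg hn (sub_nonneg.2 htq), mul_nonneg ht (sub_nonneg.2 hc)]

theorem bound_of_low (hq : 1 < q) (ht : 0 ≤ t) (hβ : 1 ≤ β) (hn : 0 ≤ n) (hc : 1 ≤ c)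
    (hb : β + n ≤ q + 1 - c) (htc : q + 1 ≤ t + c) (hh : h = 0 ∨ 1 ≤ h) (hhβ : h + 1 ≤ β) :
    t / q + h * (t ^ 2 / (q * (q - 1) * (q + t)))
      ≤ (t - n) * (t * (1 / (β - h)) + 1) / (q + t) + 2 * n / (q + t + c) := by
  have hL := mul_le_mul_of_budget (by linarith) ht hβ hn hc hb htc
  have hqt : 0 < q + t := by linarith
  have h0 : 0 ≤ h := by rcases hh with h' | h' <;> linarith
  have hβh : 0 < β - h := by linarith
  have h2 : n / (q + t) ≤ 2 * n / (q + t + c) := by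
    rw [div_le_div_iff₀ hqt (by linarith)]
    nlinarith
  have h3 : t / q * (1 + h / (q - 1)) ≤ (t - n) * (1 / (β - h)) := by
    have h4 : 1 + h / (q - 1) ≤ β / (β - h) := by
      have : β / (β - h) = 1 + h / (β - h) := by field_simp; ring
      rw [this]
      rcases hh with rfl | h'
      · simp
      · gcongr; linarith
    have h5 : t / q * β ≤ t - n := by
      rw [div_mul_eq_mul_div, div_le_iff₀ (by linarith)]; exact hL
    calc t / q * (1 + h / (q - 1)) ≤ t / q * (β / (β - h)) := by gcongr
      _ = t / q * β * (1 / (β - h)) := by ring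
      _ ≤ _ := by gcongr
  calc t / q + h * (t ^ 2 / (q * (q - 1) * (q + t)))
      = t * (t / q * (1 + h / (q - 1))) / (q + t) + t / (q + t) := by
        have : q - 1 ≠ 0 := by linarith
        field_simp
        ring
    _ ≤ t * ((t - n) * (1 / (β - h))) / (q + t) + t / (q + t) := by gcongr
    _ = (t - n) * (t * (1 / (β - h)) + 1) / (q + t) + n / (q + t) := by ring
    _ ≤ _ := by gcongr

theorem div_eq_div_add_mul (hq : 1 < q) (ht : 0 < t) :
    t / q = t / (q + t) + t ^ 2 / (q * (q - 1) * (q + t)) * (q - 1) := by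
  have : q - 1 ≠ 0 := by linarith
  have : q ≠ 0 := by linarith
  have : q + t ≠ 0 := by linarith
  field_simp

theorem bound_of_high (htq : q < t) (hγ : 0 ≤ γ) (hβ : 1 ≤ β) (hβq : β + 1 ≤ q) (hn : 0 ≤ n)
    (hnt : n ≤ t) (hb : β + n ≤ q + 1 + γ) (hM : 0 < q + t - γ)
    (ht : t ≤ q + γ ∨ q + γ + 1 ≤ t) :
    t / q ≤ (t - n) * (t * (1 / β) + 1) / (q + t - γ) + 2 * n / (q + t - γ) := by
  have hq : 0 < q := by linarith
  rcases ht with ht | ht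
  · refine bound_of_class_bound hq ?_ hM (by linarith) hM (by linarith) hn hnt
    exact one_div_le_one_div_of_le (by linarith) (by linarith)
  · rw [← add_div, div_le_div_iff₀ hq hM]
    obtain ⟨e, rfl⟩ : ∃ e, t = q + γ + e := ⟨t - q - γ, by ring⟩
    have he : 1 ≤ e := by linarith
    have hβ0 : 0 < β := by linarith
    set t := q + γ + e with ht_def
    set N := q + γ + 1 - β with hN
    have hnN : n ≤ N := by rw [hN]; linarith
    have hslope : (t - N) * (t * (1 / β) + 1) + 2 * N ≤ (t - n) * (t * (1 / β) + 1) + 2 * n := by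
      have : 1 ≤ t * (1 / β) := by rw [mul_one_div, le_div_iff₀ hβ0]; linarith
      nlinarith
    have hval : (t - N) * (t * (1 / β) + 1) + 2 * N = (e - 1) * (t / β) + 2 * t + N := by
      have : t - N = e - 1 + β := by rw [hN, ht_def]; ring
      rw [this]
      field_simp
      linear_combination this
    have hdiv : t / (q - 1) ≤ t / β := by
      gcongr; linarith
    have hmain : t * (q - e) ≤ N * (q * (q - 1)) := by
      have h1 : t * (q - e) ≤ (q - 1) * (q + 1 + γ) := by
        rw [ht_def]; nlinarith
      have h2 : (q - 1) * (q + 1 + γ) ≤ (q - 1) * ((γ + 2) * q) := by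
        gcongr
        · linarith
        · nlinarith
      have h3 : (γ + 2) * (q * (q - 1)) ≤ N * (q * (q - 1)) := by
        have : 0 ≤ q * (q - 1) := mul_nonneg hq.le (by linarith)
        gcongr
        rw [hN]; linarith
      linarith
    have hfin : t * e ≤ ((e - 1) * (t / (q - 1)) + N) * q := by
      have hq1 : 0 < q - 1 := by linarith
      have : ((e - 1) * (t / (q - 1)) + N) * q = ((e - 1) * t * q + N * (q * (q - 1))) / (q - 1) := by
        field_simp
      rw [this, le_div_iff₀ hq1]
      linarith
    have hstep : (e - 1) * (t / (q - 1)) ≤ (e - 1) * (t / β) := by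
      have : 0 ≤ e - 1 := by linarith
      gcongr
    calc t * (q + t - γ) = t * e + 2 * t * q := by rw [ht_def]; ring
      _ ≤ ((e - 1) * (t / (q - 1)) + N) * q + 2 * t * q := by linarith
      _ ≤ ((e - 1) * (t / β) + N) * q + 2 * t * q := by
        have := mul_le_mul_of_nonneg_right hstep hq.le
        linarith
      _ = ((e - 1) * (t / β) + 2 * t + N) * q := by ring
      _ ≤ _ := by rw [← hval]; exact mul_le_mul_of_nonneg_right hslope hq.le

end Inequalities

section Weights

open scoped Classical

variable {V : Type*} {G : SimpleGraph V} {X : Finset V} {K T : Finset ℕ} {s : ℕ} {f : V → ℕ}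
  {vm vp : ℕ}

/-- A lower bound for the total weight that the classes of a terminal family send to an outer
vertex of degree `#K - c` with `n` heavy classes and solo weight `w`. -/
def share (q t c n w : ℚ) : ℚ :=
  (t - n) * (t * w + 1) / (q + t + min c 0) + 2 * n / (q + t + c)

theorem TerminalFamily.slack_bounds (hT : TerminalFamily G X K f vm T)
    (h : Extremal G X K s f vm vp) {y z : V} {W : ℕ} (hW : W ∈ T) (hy : y ∈ outer G X K f vm)
    (hz : z ∈ nbr G (cls X f W) y) :
    (0 : ℚ) < #(nbr G X z) + #T + 1 - #(acc G X K f vm) ∧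
      (#(nbr G X z) + #T + 1 - #(acc G X K f vm) : ℚ)
        ≤ (#K - #(acc G X K f vm)) + #T + (#K - #(nbr G X y)) ∧
      (Solo G X K f vm W z y → (#(nbr G X z) + #T + 1 - #(acc G X K f vm) : ℚ)
        ≤ (#K - #(acc G X K f vm)) + #T) := by
  obtain ⟨hzW, hyz⟩ := mem_nbr.1 hz
  have h1 := hT.card_nbr_outer_le W hW z hzW
  have h2 := h.ore y (outer_subset hy) z (mem_cls.1 hzW).1 hyz
  have h3 : 0 < #(nbr G (outer G X K f vm) z) := card_pos.2 ⟨y, mem_nbr.2 ⟨hy, hyz.symm⟩⟩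
  refine ⟨?_, ?_, fun hsolo => ?_⟩
  · have : #(acc G X K f vm) < #(nbr G X z) + #T + 1 := by omega
    have : (#(acc G X K f vm) : ℚ) < #(nbr G X z) + #T + 1 := by exact_mod_cast this
    linarith
  · have : #(nbr G X z) + 1 + #(nbr G X y) ≤ #K + #K := by omega
    have : (#(nbr G X z) + 1 + #(nbr G X y) : ℚ) ≤ #K + #K := by exact_mod_cast this
    linarith
  · have h4 := h.degree_le_of_solo (hT.terminal W hW) hsolo h.card_ne_card_acc_add_one
    have : #(nbr G X z) + 1 ≤ #K := by omega
    have : (#(nbr G X z) + 1 : ℚ) ≤ #K := by exact_mod_cast this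
    linarith

theorem TerminalFamily.sum_share_le (hT : TerminalFamily G X K f vm T)
    (h : Extremal G X K s f vm vp) (w : V → ℚ) (hw0 : ∀ y, 0 ≤ w y)
    (hw : ∀ W ∈ T, ∀ z, ∑ y ∈ (outer G X K f vm).filter (Solo G X K f vm W z), w y ≤ 1) :
    ∑ y ∈ outer G X K f vm, share (#K - #(acc G X K f vm)) #T (#K - #(nbr G X y))
      #(heavy G X f T y) (w y) ≤ #T * s := by
  set B := outer G X K f vm with hB
  set a := #(acc G X K f vm) with ha
  let D : V → ℚ := fun z => #(nbr G X z) + #T + 1 - a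
  let ω : ℕ → V → V → ℚ := fun W z y =>
    ((if Solo G X K f vm W z y then #T * w y else 0) + 1) / D z
  have hload : ∀ W ∈ T, ∀ z ∈ cls X f W, ∑ y ∈ nbr G B z, ω W z y ≤ 1 := by
    intro W hW z hz
    have h1 : (#(nbr G B z) : ℚ) ≤ D z := by
      have := hT.card_nbr_outer_le W hW z hz
      have : (#(nbr G B z) + a : ℚ) ≤ #(nbr G X z) + #T + 1 := by exact_mod_cast this
      simp only [D]; linarith
    have hD0 : 0 ≤ D z := le_trans (Nat.cast_nonneg _) h1
    simp only [ω]
    rw [← sum_div]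
    refine div_le_one_of_le₀ ?_ hD0
    rw [sum_add_distrib, sum_const, nsmul_eq_mul, mul_one, ← sum_filter, ← mul_sum]
    by_cases hex : ∃ y, Solo G X K f vm W z y
    · obtain ⟨y, hy⟩ := hex
      have h2 := h.card_nbr_outer_solo (hT.terminal W hW) hy
      have h3 : (#(nbr G B z) + a : ℚ) ≤ #(nbr G X z) + 1 := by exact_mod_cast h2
      have h4 : ∑ y ∈ (nbr G B z).filter (Solo G X K f vm W z), w y ≤ 1 := by
        refine le_trans (sum_le_sum_of_subset_of_nonneg ?_ fun _ _ _ => hw0 _) (hw W hW z)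
        exact filter_subset_filter _ (filter_subset _ _)
      have h5 := mul_le_mul_of_nonneg_left h4 (Nat.cast_nonneg (α := ℚ) #T)
      simp only [D]
      linarith
    · push Not at hex
      rw [filter_false_of_mem fun y _ => hex y]
      simpa using h1
  have hgain : ∀ y ∈ B, share (#K - a) #T (#K - #(nbr G X y)) #(heavy G X f T y) (w y)
      ≤ ∑ W ∈ T, ∑ z ∈ nbr G (cls X f W) y, ω W z y := by
    intro y hy
    have hsub : heavy G X f T y ⊆ T := filter_subset _ _
    rw [← sum_sdiff hsub, share]
    refine add_le_add ?_ ?_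
    · have hcard : (#T - #(heavy G X f T y) : ℚ) = #(T \ heavy G X f T y) := by
        rw [card_sdiff_of_subset hsub, Nat.cast_sub (card_le_card hsub)]
      rw [hcard, mul_div_assoc, ← nsmul_eq_mul, ← sum_const]
      refine sum_le_sum fun W hWmem => ?_
      obtain ⟨hW, hWy⟩ := mem_sdiff.1 hWmem
      obtain ⟨z, hz⟩ := hT.exists_solo h.toConfig hy hW hWy
      rw [hz.2, sum_singleton]
      have hzmem : z ∈ nbr G (cls X f W) y := by rw [hz.2]; exact mem_singleton_self z
      obtain ⟨h1, h2, h3⟩ := hT.slack_bounds h hW hy hzmem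
      simp only [ω, if_pos hz]
      refine div_le_div_of_nonneg_left ?_ h1 ?_
      · have := mul_nonneg (Nat.cast_nonneg (α := ℚ) #T) (hw0 y)
        linarith
      · rcases min_cases (#K - #(nbr G X y) : ℚ) 0 with ⟨h', -⟩ | ⟨h', -⟩ <;> rw [h']
        · exact h2
        · rw [add_zero]; exact h3 hz
    · rw [mul_comm, mul_div_assoc, ← nsmul_eq_mul, ← sum_const]
      refine sum_le_sum fun W hWy => ?_
      have hW := hsub hWy
      have h2 : (2 : ℚ) ≤ #(nbr G (cls X f W) y) := by exact_mod_cast (mem_filter.1 hWy).2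
      obtain ⟨z₀, hz₀⟩ := card_pos.1 (lt_of_lt_of_le two_pos (mem_filter.1 hWy).2)
      obtain ⟨h3, h4, -⟩ := hT.slack_bounds h hW hy hz₀
      have hM : 0 < (#K - a : ℚ) + #T + (#K - #(nbr G X y)) := lt_of_lt_of_le h3 h4
      calc 2 / ((#K - a : ℚ) + #T + (#K - #(nbr G X y)))
          ≤ #(nbr G (cls X f W) y) / ((#K - a : ℚ) + #T + (#K - #(nbr G X y))) := by gcongr
        _ = ∑ z ∈ nbr G (cls X f W) y, 1 / ((#K - a : ℚ) + #T + (#K - #(nbr G X y))) := by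
          rw [sum_const, nsmul_eq_mul, mul_one_div]
        _ ≤ _ := by
          refine sum_le_sum fun z hz => ?_
          obtain ⟨h5, h6, -⟩ := hT.slack_bounds h hW hy hz
          refine div_le_div₀ ?_ ?_ h5 h6
          · have := mul_nonneg (Nat.cast_nonneg (α := ℚ) #T) (hw0 y)
            split_ifs <;> linarith
          · have := mul_nonneg (Nat.cast_nonneg (α := ℚ) #T) (hw0 y)
            split_ifs <;> linarith
  calc _ ≤ ∑ y ∈ B, ∑ W ∈ T, ∑ z ∈ nbr G (cls X f W) y, ω W z y := sum_le_sum hgain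
    _ = ∑ W ∈ T, ∑ z ∈ cls X f W, ∑ y ∈ nbr G B z, ω W z y := by
      rw [sum_comm]
      exact sum_congr rfl fun W _ => sum_nbr_comm _ _ _
    _ ≤ ∑ W ∈ T, ∑ z ∈ cls X f W, (1 : ℚ) :=
      sum_le_sum fun W hW => sum_le_sum fun z hz => hload W hW z hz
    _ ≤ ∑ W ∈ T, (s : ℚ) := by
      refine sum_le_sum fun W hW => ?_
      rw [sum_const, nsmul_eq_mul, mul_one]
      exact_mod_cast h.card_cls_acc_le (hT.subset_acc hW)
    _ = #T * s := by rw [sum_const, nsmul_eq_mul]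

end Weights

section Counting

open scoped Classical

variable {V : Type*} {G : SimpleGraph V} {X : Finset V} {K T : Finset ℕ} {s : ℕ} {f : V → ℕ}
  {vm vp : ℕ}

theorem sum_le_one_of_le_one_div {S : Finset V} {w : V → ℚ} (h : ∀ y ∈ S, w y ≤ 1 / #S) :
    ∑ y ∈ S, w y ≤ 1 := by
  refine (sum_le_sum h).trans ?_
  rw [sum_const, nsmul_eq_mul, mul_one_div]
  exact div_self_le_one _

theorem Extremal.card_filter_solo_le (h : Extremal G X K s f vm vp) {W : ℕ}
    (hW : Terminal G X K f vm W) {z y : V} {Y : Finset V}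
    (hy : y ∈ Y.filter (Solo G X K f vm W z)) :
    #(Y.filter (Solo G X K f vm W z)) ≤ #(nbr G Y y) + 1 := by
  rw [← card_erase_add_one hy]
  refine Nat.succ_le_succ (card_le_card fun u hu => ?_)
  obtain ⟨huy, hu⟩ := mem_erase.1 hu
  obtain ⟨huY, hu⟩ := mem_filter.1 hu
  exact mem_nbr.2 ⟨huY, h.adj_of_solo hW (mem_filter.1 hy).2 hu huy.symm⟩

theorem Extremal.card_filter_solo_add_le (h : Extremal G X K s f vm vp) {W : ℕ}
    (hW : Terminal G X K f vm W) {z y : V} (hzy : Solo G X K f vm W z y) :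
    #((outer G X K f vm).filter (Solo G X K f vm W z)) + #(acc G X K f vm) ≤ #K := by
  have h1 : #((outer G X K f vm).filter (Solo G X K f vm W z))
      ≤ #(nbr G (outer G X K f vm) z) := card_le_card fun u hu =>
    mem_nbr.2 ⟨(mem_filter.1 hu).1, (Config.Solo.mem_cls_adj (mem_filter.1 hu).2).2.2.symm⟩
  have h2 := h.card_nbr_outer_solo hW hzy
  have h3 := h.degree_le_of_solo hW hzy h.card_ne_card_acc_add_one
  obtain ⟨hzX, -, hyz⟩ := Config.Solo.mem_cls_adj hzy
  have h4 := h.ore y (outer_subset hzy.1) z hzX hyz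
  omega

theorem TerminalFamily.slack_pos (hT : TerminalFamily G X K f vm T)
    (h : Extremal G X K s f vm vp) {y : V} (hy : y ∈ outer G X K f vm) :
    (0 : ℚ) < (#K - #(acc G X K f vm)) + #T + (#K - #(nbr G X y)) := by
  obtain ⟨W, hW⟩ := hT.nonempty
  obtain ⟨z, hz⟩ := card_pos.1 (h.one_le_card_nbr_cls hy (hT.subset_acc hW))
  obtain ⟨h1, h2, -⟩ := hT.slack_bounds h hW hy hz
  exact lt_of_lt_of_le h1 h2

theorem TerminalFamily.budget (hT : TerminalFamily G X K f vm T) (h : Extremal G X K s f vm vp)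
    {y : V} (hy : y ∈ outer G X K f vm) :
    ((#(nbr G (outer G X K f vm) y) + 1 : ℕ) : ℚ) + #(heavy G X f T y)
      ≤ (#K - #(acc G X K f vm)) + 1 - (#K - #(nbr G X y)) := by
  have h1 := hT.card_nbr_ge h.toConfig hy
  have h2 : (#(nbr G (outer G X K f vm) y) + #(acc G X K f vm) + #(heavy G X f T y) : ℚ)
    ≤ #(nbr G X y) := by exact_mod_cast h1
  push_cast
  linarith

theorem TerminalFamily.sum_share_lt (hT : TerminalFamily G X K f vm T)
    (h : Extremal G X K s f vm vp) (w : V → ℚ) (hw0 : ∀ y, 0 ≤ w y)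
    (hw : ∀ W ∈ T, ∀ z, ∑ y ∈ (outer G X K f vm).filter (Solo G X K f vm W z), w y ≤ 1) :
    ∑ y ∈ outer G X K f vm, share (#K - #(acc G X K f vm)) #T (#K - #(nbr G X y))
        #(heavy G X f T y) (w y)
      < ∑ _y ∈ outer G X K f vm, (#T / (#K - #(acc G X K f vm)) : ℚ) := by
  refine (hT.sum_share_le h w hw0 hw).trans_lt ?_
  have hlt := h.card_acc_lt
  have hq : (0 : ℚ) < #K - #(acc G X K f vm) := by
    rw [sub_pos]; exact_mod_cast hlt
  have ht : (0 : ℚ) < #T := by exact_mod_cast card_pos.2 hT.nonempty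
  rw [sum_const, nsmul_eq_mul, h.card_outer, ← mul_div_assoc, lt_div_iff₀ hq]
  push_cast [Nat.cast_sub hlt.le]
  nlinarith

theorem TerminalFamily.card_lt_card (hT : TerminalFamily G X K f vm T)
    (h : Extremal G X K s f vm vp) : #K < #(acc G X K f vm) + #T := by
  by_contra! htq
  have hlt := h.card_acc_lt
  have hne := h.card_ne_card_acc_add_one
  set a := #(acc G X K f vm) with ha
  set B := outer G X K f vm with hB
  let w : V → ℚ := fun y => 1 / ((min (#K - a) (#(nbr G B y) + 1) : ℕ) : ℚ)
  refine (hT.sum_share_lt h w (fun y => by positivity) ?_).not_ge ?_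
  · intro W hW z
    refine sum_le_one_of_le_one_div fun y hy => ?_
    have h1 := h.card_filter_solo_le (hT.terminal W hW) hy
    have h2 := h.card_filter_solo_add_le (hT.terminal W hW) (mem_filter.1 hy).2
    have h3 := card_pos.2 ⟨y, hy⟩
    refine one_div_le_one_div_of_le (by exact_mod_cast h3) ?_
    rw [Nat.cast_le]
    exact le_min (by omega) h1
  · refine sum_le_sum fun y hy => ?_
    have hM := hT.slack_pos h hy
    have hb := hT.budget h hy
    rw [← ha] at hM hb
    rw [← hB] at hb
    have hn : #(heavy G X f T y) ≤ #T := card_le_card (filter_subset _ _)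
    have hnQ : (#(heavy G X f T y) : ℚ) ≤ #T := by exact_mod_cast hn
    have hq : (0 : ℚ) < #K - a := by rw [sub_pos]; exact_mod_cast hlt
    have htQ : (#T : ℚ) ≤ #K - a := by
      have : (a + #T : ℚ) ≤ #K := by exact_mod_cast htq
      linarith
    have hcast : ((#K - a : ℕ) : ℚ) = #K - a := Nat.cast_sub hlt.le
    have hw : 1 / (#K - a : ℚ) ≤ w y := by
      rw [← hcast]
      refine one_div_le_one_div_of_le ?_ (by exact_mod_cast min_le_left _ _)
      exact_mod_cast lt_min (by omega) (by omega)
    rw [share]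
    rcases le_or_gt #K #(nbr G X y) with hhigh | hlow
    · have hc : (#K - #(nbr G X y) : ℚ) ≤ 0 := by
        rw [sub_nonpos]; exact_mod_cast hhigh
      rw [min_eq_left hc]
      exact bound_of_class_bound hq hw hM (by linarith) hM (by linarith) (by positivity) hnQ
    · have hc : (1 : ℚ) ≤ #K - #(nbr G X y) := by
        have : (#(nbr G X y) + 1 : ℚ) ≤ #K := by exact_mod_cast hlow
        linarith
      rw [min_eq_right (by linarith), add_zero]
      rcases le_or_gt (#T + (#K - #(nbr G X y))) (#K - a) with hsmall | hbig
      · have : (#T + (#K - #(nbr G X y)) : ℚ) ≤ #K - a := by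
          rw [← hcast, ← Nat.cast_sub hlow.le]; exact_mod_cast hsmall
        exact bound_of_class_bound hq hw (by positivity) (by linarith) hM (by linarith)
          (by positivity) hnQ
      · have hbig' : (#K - a : ℚ) + 1 ≤ #T + (#K - #(nbr G X y)) := by
          rw [← hcast, ← Nat.cast_sub hlow.le]; exact_mod_cast hbig
        have hβ : #(nbr G B y) + 1 ≤ #K - a := by
          have : ((#(nbr G B y) + 1 : ℕ) : ℚ) ≤ (#K - a : ℕ) := by
            rw [hcast]
            have : (0 : ℚ) ≤ #(heavy G X f T y) := by positivity
            linarith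
          exact_mod_cast this
        have hq1 : (1 : ℚ) < #K - a := by
          rw [← hcast]; exact_mod_cast (show 1 < #K - a by omega)
        have := bound_of_low (h := 0) hq1 (Nat.cast_nonneg #T)
          (by exact_mod_cast Nat.succ_pos (#(nbr G B y))) (Nat.cast_nonneg #(heavy G X f T y))
          hc hb hbig' (.inl rfl) (by rw [zero_add]; exact_mod_cast Nat.succ_pos (#(nbr G B y)))
        rw [zero_mul, add_zero, sub_zero] at this
        simpa only [w, min_eq_right hβ] using this

theorem Extremal.elim (h : Extremal G X K s f vm vp) : False := by
  obtain ⟨T, hT⟩ := h.exists_terminalFamily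
  have htq := hT.card_lt_card h
  have hlt := h.card_acc_lt
  have hne := h.card_ne_card_acc_add_one
  set a := #(acc G X K f vm) with ha
  set B := outer G X K f vm with hB
  set H : Finset V := B.filter fun y => #K ≤ #(nbr G X y) ∧ #K ≤ a + #(nbr G B y) + 1 with hH
  have hHB : H ⊆ B := filter_subset _ _
  have hsplit : ∀ y, #(nbr G B y) = #(nbr G (B \ H) y) + #(nbr G H y) := by
    intro y
    rw [← card_union_of_disjoint]
    · congr 1
      ext u
      have := @hHB u
      simp only [mem_union, mem_nbr, mem_sdiff]
      tauto
    · rw [disjoint_left]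
      simp only [mem_nbr, mem_sdiff]
      tauto
  have hlowH : ∀ y ∈ B, #K ≤ #(nbr G X y) → #(nbr G H y) = 0 := by
    intro y hy hdy
    rw [card_eq_zero, eq_empty_iff_forall_notMem]
    intro u hu
    obtain ⟨huH, hyu⟩ := mem_nbr.1 hu
    obtain ⟨huB, hdu, -⟩ := mem_filter.1 huH
    have := h.ore y (outer_subset hy) u (outer_subset huB) hyu
    omega
  obtain ⟨w, hwH, hwB⟩ : ∃ w : V → ℚ, (∀ y ∈ H, w y = 0) ∧
      ∀ y ∉ H, w y = 1 / ((#(nbr G (B \ H) y) + 1 : ℕ) : ℚ) :=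
    ⟨fun y => if y ∈ H then 0 else 1 / ((#(nbr G (B \ H) y) + 1 : ℕ) : ℚ),
      fun _ hy => if_pos hy, fun _ hy => if_neg hy⟩
  have hcast : ((#K - a : ℕ) : ℚ) = #K - a := Nat.cast_sub hlt.le
  have hq1 : (1 : ℚ) < #K - a := by
    rw [← hcast]; exact_mod_cast (show 1 < #K - a by omega)
  have hQ : (#K - a : ℚ) < #T := by
    have : (#K : ℚ) < a + #T := by exact_mod_cast htq
    linarith
  have ht0 : (0 : ℚ) < #T := by linarith
  set q : ℚ := #K - a with hq
  set κ : ℚ := #T ^ 2 / (q * (q - 1) * (q + #T)) with hκ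
  clear_value κ q
  have hκ0 : 0 ≤ κ := by
    have : 0 < q - 1 := by linarith
    rw [hκ]
    exact div_nonneg (sq_nonneg _)
      (mul_nonneg (mul_nonneg (by linarith) this.le) (by linarith))
  refine (hT.sum_share_lt h w (fun y => ?_) ?_).not_ge ?_
  · by_cases hy : y ∈ H
    · rw [hwH y hy]
    · rw [hwB y hy]
      exact one_div_nonneg.2 (Nat.cast_nonneg _)
  · intro W hW z
    have hrest : ∑ y ∈ B.filter (Solo G X K f vm W z), w y
        = ∑ y ∈ (B \ H).filter (Solo G X K f vm W z), w y := by
      refine (sum_subset (filter_subset_filter _ sdiff_subset) fun y hy hy' => ?_).symm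
      have : y ∈ H := by
        simp only [mem_filter, mem_sdiff] at hy hy'
        tauto
      exact hwH y this
    rw [hrest]
    refine sum_le_one_of_le_one_div fun y hy => ?_
    have h1 := h.card_filter_solo_le (hT.terminal W hW) hy
    have hyH : y ∉ H := (mem_sdiff.1 (mem_filter.1 hy).1).2
    rw [hwB y hyH]
    exact one_div_le_one_div_of_le (by exact_mod_cast card_pos.2 ⟨y, hy⟩) (by exact_mod_cast h1)
  · rw [← ha, ← hB, ← hq]
    have key : ∀ y ∈ B, #T / q + κ * #(nbr G H y)
        ≤ share q #T (#K - #(nbr G X y)) #(heavy G X f T y) (w y)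
          + if y ∈ H then κ * #(nbr G B y) else 0 := by
      intro y hy
      have hM := hT.slack_pos h hy
      have hb := hT.budget h hy
      rw [← ha, ← hq] at hM hb
      rw [← hB] at hb
      have hnQ : (#(heavy G X f T y) : ℚ) ≤ #T := by
        exact_mod_cast card_le_card (filter_subset _ _)
      have hn0 : (0 : ℚ) ≤ #(heavy G X f T y) := Nat.cast_nonneg _
      have hβ1 : (1 : ℚ) ≤ ((#(nbr G B y) + 1 : ℕ) : ℚ) := by exact_mod_cast Nat.succ_pos _
      rw [share]
      rcases le_or_gt #K #(nbr G X y) with hhigh | hlow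
      · have hc : (#K - #(nbr G X y) : ℚ) ≤ 0 := by
          rw [sub_nonpos]; exact_mod_cast hhigh
        rw [min_eq_left hc, hlowH y hy hhigh, Nat.cast_zero, mul_zero, add_zero]
        by_cases hyH : y ∈ H
        · have hbig : q - 1 ≤ #(nbr G B y) := by
            have : (#K : ℚ) ≤ a + #(nbr G B y) + 1 := by exact_mod_cast (mem_filter.1 hyH).2.2
            linarith
          rw [hwH y hyH, if_pos hyH, mul_zero, zero_add, mul_one]
          have h1 : (#T : ℚ) / (q + #T)
              ≤ (#T - #(heavy G X f T y)) / (q + #T + (#K - #(nbr G X y)))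
                + 2 * #(heavy G X f T y) / (q + #T + (#K - #(nbr G X y))) := by
            rw [← add_div]
            exact div_le_div₀ (by linarith) (by linarith) hM (by linarith)
          have h2 : (#T : ℚ) / q = #T / (q + #T) + κ * (q - 1) := by
            rw [hκ, div_eq_div_add_mul hq1 ht0]
          have h3 := mul_le_mul_of_nonneg_left hbig hκ0
          linarith
        · have hsmall : a + #(nbr G B y) + 1 < #K := by
            by_contra hcon
            exact hyH (mem_filter.2 ⟨hy, hhigh, by omega⟩)
          have hβq : ((#(nbr G B y) + 1 : ℕ) : ℚ) + 1 ≤ q := by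
            have : (a + #(nbr G B y) + 1 + 1 : ℚ) ≤ #K := by exact_mod_cast hsmall
            push_cast
            linarith
          rw [hwB y hyH, if_neg hyH, add_zero]
          have h1 := hsplit y
          rw [hlowH y hy hhigh, add_zero] at h1
          rw [← h1]
          have hγ : q + #T + (#K - #(nbr G X y) : ℚ) = q + #T - (#(nbr G X y) - #K) := by ring
          rw [hγ] at hM ⊢
          refine bound_of_high hQ (by linarith) hβ1 hβq hn0 hnQ (by linarith) hM ?_
          rcases le_or_gt (#T + a) #(nbr G X y) with h2 | h2
          · left
            have : (#T + a : ℚ) ≤ #(nbr G X y) := by exact_mod_cast h2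
            rw [hq]
            linarith
          · right
            have : (#(nbr G X y) + 1 : ℚ) ≤ #T + a := by exact_mod_cast h2
            rw [hq]
            linarith
      · have hc : (1 : ℚ) ≤ #K - #(nbr G X y) := by
          have : (#(nbr G X y) + 1 : ℚ) ≤ #K := by exact_mod_cast hlow
          linarith
        have hyH : y ∉ H := fun h' => absurd (mem_filter.1 h').2.1 (by omega)
        rw [min_eq_right (by linarith), add_zero, if_neg hyH, add_zero, mul_comm κ]
        have h1 := hsplit y
        have hβ : ((#(nbr G (B \ H) y) + 1 : ℕ) : ℚ)
            = ((#(nbr G B y) + 1 : ℕ) : ℚ) - #(nbr G H y) := by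
          rw [h1]; push_cast; ring
        have hh : (#(nbr G H y) : ℚ) = 0 ∨ (1 : ℚ) ≤ #(nbr G H y) := by
          rcases Nat.eq_zero_or_pos #(nbr G H y) with h' | h'
          · left; exact_mod_cast h'
          · right; exact_mod_cast h'
        have hhβ : (#(nbr G H y) : ℚ) + 1 ≤ ((#(nbr G B y) + 1 : ℕ) : ℚ) := by
          rw [h1]; exact_mod_cast (by omega)
        rw [hwB y hyH, hβ, hκ]
        exact bound_of_low hq1 ht0.le hβ1 hn0 hc hb (by linarith) hh hhβ
    have hsum := sum_le_sum key
    have hcomm : ∑ y ∈ B, κ * #(nbr G H y) = ∑ y ∈ H, κ * (#(nbr G B y) : ℚ) := by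
      rw [← mul_sum, ← mul_sum]
      congr 1
      have := sum_nbr_comm (G := G) H B fun _ _ => (1 : ℚ)
      simpa using this
    rw [sum_add_distrib, sum_add_distrib, hcomm, ← sum_filter,
      filter_mem_eq_inter, inter_eq_right.2 hHB] at hsum
    linarith

end Counting

section Induction

open scoped Classical

variable {V : Type*} {G : SimpleGraph V} {X : Finset V} {K : Finset ℕ} {s : ℕ}

theorem hasEquitable_of_forall_not_adj (hG : ∀ x ∈ X, ∀ y ∈ X, ¬ G.Adj x y)
    (hX : #X = #K * s) : HasEquitable G X K s := by
  induction K using Finset.induction_on generalizing X with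
  | empty =>
    rw [card_empty, zero_mul, card_eq_zero] at hX
    subst hX
    exact ⟨fun _ => 0, ⟨by simp, by simp⟩, by simp⟩
  | insert c K hc ih =>
    rw [card_insert_of_notMem hc, add_mul, one_mul] at hX
    obtain ⟨Z, hZX, hZ⟩ := exists_subset_card_eq (show s ≤ #X by omega)
    obtain ⟨g, hg, hgs⟩ := ih (X := X \ Z)
      (fun x hx y hy => hG x (sdiff_subset hx) y (sdiff_subset hy))
      (by rw [card_sdiff_of_subset hZX]; omega)
    have hZc : IsColoring G Z {c} fun _ => c :=
      ⟨by simp, fun x hx y hy hxy => absurd hxy (hG x (hZX hx) y (hZX hy))⟩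
    obtain ⟨h1, h2, h3⟩ := hg.splice hZX hZc (disjoint_singleton_right.2 hc)
    refine ⟨_, insert_eq c K ▸ union_comm K {c} ▸ h1, fun d hd => ?_⟩
    rcases mem_insert.1 hd with rfl | hd
    · rw [h3 d (mem_singleton_self d)]
      simpa [cls] using hZ
    · rw [h2 d hd, hgs d hd]

/-- A color class without neighbours of `u` exists if `u` has fewer than `#K` neighbours. -/
theorem exists_color_forall_not_adj {f : V → ℕ} {u : V} (hu : #(nbr G X u) < #K) :
    ∃ c ∈ K, ∀ y ∈ X, G.Adj u y → f y ≠ c := by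
  obtain ⟨c, hc, hc'⟩ := exists_mem_notMem_of_card_lt_card
    ((card_image_le (s := nbr G X u) (f := f)).trans_lt hu)
  exact ⟨c, hc, fun y hy huy hyc => hc' (mem_image.2 ⟨y, mem_nbr.2 ⟨hy, huy⟩, hyc⟩)⟩

theorem hasEquitable_of_oreBound (hG : OreBound G X #K) (hX : #X = #K * s) :
    HasEquitable G X K s := by
  induction X using Finset.strongInduction generalizing G K with
  | H X ihX =>
  induction hE : #((X ×ˢ X).filter fun p => G.Adj p.1 p.2) using Nat.strong_induction_on
    generalizing G with
  | h m ihE =>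
  subst hE
  by_cases hedge : ∃ u ∈ X, ∃ v ∈ X, G.Adj u v ∧ #(nbr G X u) < #K
  · obtain ⟨u, hu, v, hv, huv, hdu⟩ := hedge
    obtain ⟨G', hle, hadj⟩ : ∃ G' ≤ G, ∀ x y, G'.Adj x y ↔ G.Adj x y ∧ x ≠ u ∧ y ≠ u :=
      ⟨_, G.deleteIncidenceSet_le u, fun _ _ => G.deleteIncidenceSet_adj⟩
    have hG' : OreBound G' X #K := by
      have hnbr : ∀ x, #(nbr G' X x) ≤ #(nbr G X x) := fun x =>
        card_le_card fun y hy => mem_nbr.2 ⟨(mem_nbr.1 hy).1, hle (mem_nbr.1 hy).2⟩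
      intro x hx y hy hxy
      have := hG x hx y hy (hle hxy)
      have := hnbr x
      have := hnbr y
      omega
    obtain ⟨f, hf, hfs⟩ := ihE _ (card_lt_card <| (ssubset_iff_of_subset fun p hp => by
        rw [mem_filter] at hp ⊢
        exact ⟨hp.1, hle hp.2⟩).2
        ⟨(u, v), by simp [hu, hv, huv], by simp [hadj]⟩) hG' rfl
    obtain ⟨c, hc, huc⟩ := exists_color_forall_not_adj (f := f) hdu
    by_contra hcon
    have hnear : IsNearEquitable G X K s (Function.update f u c) (f u) c := by
      refine ⟨⟨fun x hx => ?_, fun x hx y hy hxy => ?_⟩, hf.maps u hu, hc, fun d hd => ?_⟩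
      · rcases eq_or_ne x u with rfl | hxu
        · rwa [Function.update_self]
        · rw [Function.update_of_ne hxu]
          exact hf.maps x hx
      · rcases eq_or_ne x u with rfl | hxu
        · rw [Function.update_self, Function.update_of_ne hxy.ne']
          exact (huc y hy hxy).symm
        · rw [Function.update_of_ne hxu]
          rcases eq_or_ne y u with rfl | hyu
          · rw [Function.update_self]
            exact huc x hx hxy.symm
          · rw [Function.update_of_ne hyu]
            exact hf.proper x hx y hy ((hadj x y).2 ⟨hxy, hxu, hyu⟩)
      · rw [card_cls_update hu, hfs d hd]
    obtain ⟨F, p, hF⟩ := Config.exists_extremal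
      ⟨hnear, hG, hcon, fun Y hY L hGY hYL => ihX Y hY hGY hYL⟩
    exact hF.elim
  · push Not at hedge
    refine hasEquitable_of_forall_not_adj (fun x hx y hy hxy => ?_) hX
    have := hG x hx y hy hxy
    have := hedge x hx y hy hxy
    have := hedge y hy x hx hxy.symm
    omega

end Induction

section Padding

open scoped Classical

variable {V : Type*} [Fintype V]

/-- Adding a disjoint clique on fewer than `k` vertices makes the number of vertices divisible by
`k`; the vertices of the clique receive distinct colors. -/
theorem exists_coloring_of_oreBound {G : SimpleGraph V} {k : ℕ} (hk : 0 < k)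
    (hG : OreBound G univ k) :
    ∃ (f : V → ℕ) (s : ℕ), IsColoring G univ (range k) f ∧
      ∀ c ∈ range k, #(cls univ f c) ≤ s ∧ s ≤ #(cls univ f c) + 1 := by
  obtain ⟨p, s, hpk, hps⟩ : ∃ p s, p < k ∧ Fintype.card V + p = k * s := by
    refine ⟨(k - Fintype.card V % k) % k,
      (Fintype.card V + (k - Fintype.card V % k) % k) / k, Nat.mod_lt _ hk, ?_⟩
    rw [Nat.mul_div_cancel']
    have h1 := Nat.mod_lt (Fintype.card V) hk
    apply Nat.dvd_of_mod_eq_zero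
    rw [Nat.add_mod, Nat.mod_mod, ← Nat.add_mod, Nat.add_mod,
      Nat.add_mod_mod, Nat.add_sub_cancel' h1.le, Nat.mod_self]
  let G' : SimpleGraph (V ⊕ Fin p) := G ⊕g ⊤
  have hl : ∀ v, nbr G' univ (.inl v) = (nbr G univ v).map .inl := by
    intro v
    ext (w | w) <;> simp [G']
  have hr : ∀ i, #(nbr G' univ (.inr i)) < k := by
    intro i
    have : nbr G' univ (.inr i) ⊆ (univ : Finset (Fin p)).map .inr := by
      rintro (w | w) <;> simp [G']
    have := card_le_card this
    rw [card_map, card_univ, Fintype.card_fin] at this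
    omega
  have hore : OreBound G' univ #(range k) := by
    rw [card_range]
    rintro (v | i) - (w | j) - hadj
    · rw [hl, hl, card_map, card_map]
      exact hG v (mem_univ v) w (mem_univ w) (by simpa [G'] using hadj)
    · simp [G'] at hadj
    · simp [G'] at hadj
    · have := hr i
      have := hr j
      omega
  obtain ⟨f, hf, hfs⟩ := hasEquitable_of_oreBound (s := s) hore (by simpa using hps)
  refine ⟨f ∘ .inl, s, ⟨fun x _ => hf.maps _ (mem_univ _), fun x _ y _ hxy =>
    hf.proper _ (mem_univ _) _ (mem_univ _) (by simpa [G'] using hxy)⟩, fun c hc => ?_⟩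
  have hsplit : #(cls univ f c) = #(cls univ (f ∘ .inl) c) + #(cls univ (f ∘ .inr) c) := by
    rw [← card_map (s := cls univ (f ∘ .inl) c) .inl, ← card_map (s := cls univ (f ∘ .inr) c) .inr,
      ← card_union_of_disjoint]
    · congr 1
      ext (v | v) <;> simp
    · rw [disjoint_left]
      rintro (v | v) <;> simp
  have hone : #(cls univ (f ∘ .inr) c) ≤ 1 := by
    rw [card_le_one]
    intro i hi j hj
    by_contra hij
    exact hf.proper (.inr i) (mem_univ _) (.inr j) (mem_univ _) (by simpa [G'] using hij)
      ((mem_cls.1 hi).2.trans (mem_cls.1 hj).2.symm)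
  have := hfs c hc
  omega

end Padding

end OreColoring

/-- **Ore-degree version of the Hajnal–Szemerédi Theorem.** If `d(x) + d(y) < 2k` for
every edge `xy` of `G` (i.e. `Θ(G) < 2k`), then `G` has an equitable `k`-coloring. -/
theorem equitable_coloring_of_ore_degree {V : Type*} [Fintype V] (G : SimpleGraph V)
    [DecidableRel G.Adj] (k : ℕ) (hk : 0 < k)
    (hore : ∀ ⦃x y : V⦄, G.Adj x y → G.degree x + G.degree y < 2 * k) :
    ∃ f : V → Fin k,
      (∀ ⦃u v : V⦄, G.Adj u v → f u ≠ f v) ∧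
      (∀ c c' : Fin k,
        (Finset.univ.filter fun v => f v = c).card ≤
          (Finset.univ.filter fun v => f v = c').card + 1) := by
  have hnbr : ∀ v, (OreColoring.nbr G Finset.univ v).card = G.degree v := by
    intro v
    rw [← G.card_neighborFinset_eq_degree]
    congr 1
    ext u
    simp
  obtain ⟨f, s, hf, hs⟩ := OreColoring.exists_coloring_of_oreBound (G := G) hk
    fun x _ y _ hxy => by rw [hnbr, hnbr]; exact hore hxy
  have hlt : ∀ v, f v < k := fun v => Finset.mem_range.1 (hf.maps v (Finset.mem_univ v))
  have hcls : ∀ c : Fin k, (Finset.univ.filter fun v => (⟨f v, hlt v⟩ : Fin k) = c)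
      = OreColoring.cls Finset.univ f c := by
    intro c
    ext v
    simp [Fin.ext_iff]
  refine ⟨fun v => ⟨f v, hlt v⟩, fun u v huv h => ?_, fun c c' => ?_⟩
  · exact hf.proper u (Finset.mem_univ u) v (Finset.mem_univ v) huv (Fin.ext_iff.1 h)
  · rw [hcls, hcls]
    have h1 := (hs c (Finset.mem_range.2 c.2)).1
    have h2 := (hs c' (Finset.mem_range.2 c'.2)).2
    omega
end

section
/- Let k be a positive integer and let G be a simple directed graph such that d⁻(v) + d⁺(v) < 2k for every vertex v, where d⁻ and d⁺ denote in-degree and out-degree. Then V(G) can be partitioned into k classes whose sizes pairwise differ by at most 1 such that each class induces an acyclic sub-digraph (i.e., each class contains no directed cycle). In other words, G has an equitable acyclic k-coloring. -/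
namespace EquitableAcyclic

open Finset Relation
open scoped Classical

variable {V K : Type*}

/-- `S` induces an acyclic subdigraph: every nonempty subset of `S` has a sink. -/
def Acyc (r : V → V → Prop) (S : Finset V) : Prop :=
  ∀ T ⊆ S, T.Nonempty → ∃ v ∈ T, ∀ u ∈ T, ¬ r v u

/-- The number of edges, in both directions, between `v` and `S`. -/
noncomputable def edgeCount (r : V → V → Prop) (v : V) (S : Finset V) : ℕ :=
  #{u ∈ S | r v u} + #{u ∈ S | r u v}

theorem Acyc.mono {r : V → V → Prop} {S T : Finset V} (h : Acyc r S) (hT : T ⊆ S) : Acyc r T :=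
  fun U hU => h U (hU.trans hT)

theorem Acyc.swap {r : V → V → Prop} {S : Finset V} (h : Acyc r S) : Acyc (Function.swap r) S := by
  induction S using Finset.strongInduction with
  | H S ih =>
    intro T hT hne
    obtain ⟨v, hv, hsink⟩ := h T hT hne
    by_cases h1 : (T.erase v).Nonempty
    · obtain ⟨u, hu, hsrc⟩ := ih (T.erase v) ((erase_ssubset hv).trans_subset hT)
        (h.mono ((erase_subset _ _).trans hT)) _ Subset.rfl h1
      refine ⟨u, mem_of_mem_erase hu, fun w hw => ?_⟩
      by_cases hwv : w = v
      · subst hwv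
        exact hsink u (mem_of_mem_erase hu)
      · exact hsrc w (mem_erase.2 ⟨hwv, hw⟩)
    · have hT1 : ∀ w ∈ T, w = v := by
        intro w hw
        by_contra hne'
        exact h1 ⟨w, mem_erase.2 ⟨hne', hw⟩⟩
      refine ⟨v, hv, fun w hw => ?_⟩
      have := hsink w hw
      rw [hT1 w hw] at this ⊢
      exact this

theorem acyc_swap {r : V → V → Prop} {S : Finset V} : Acyc (Function.swap r) S ↔ Acyc r S :=
  ⟨fun h => h.swap, fun h => h.swap⟩

theorem edgeCount_mono {r : V → V → Prop} {v : V} {S T : Finset V} (h : S ⊆ T) :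
    edgeCount r v S ≤ edgeCount r v T :=
  Nat.add_le_add (card_le_card (filter_subset_filter _ h)) (card_le_card (filter_subset_filter _ h))

/-- An out-neighbour of `y` lying on a cycle through `y`, seen from its own next step. -/
theorem exists_out_of_not_acyc_insert {r : V → V → Prop} {W : Finset V} {y : V}
    (hr : ∀ v, ¬ r v v) (hW : Acyc r W) (h : ¬ Acyc r (insert y W)) :
    ∃ u ∈ W, r y u ∧ (r u y ∨ ∃ w ∈ W, r u w) := by
  simp only [Acyc, not_forall] at h
  obtain ⟨T, hT, hne, hno⟩ := h
  push Not at hno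
  have hy : y ∈ T := by
    by_contra hy
    obtain ⟨v, hv, hs⟩ := hW T ((subset_insert_iff_of_notMem hy).1 hT) hne
    obtain ⟨u, hu, hvu⟩ := hno v hv
    exact hs u hu hvu
  obtain ⟨u, hu, hyu⟩ := hno y hy
  have huW : u ∈ W := by
    rcases mem_insert.1 (hT hu) with rfl | h
    · exact absurd hyu (hr _)
    · exact h
  refine ⟨u, huW, hyu, ?_⟩
  obtain ⟨w, hw, huw⟩ := hno u hu
  rcases mem_insert.1 (hT hw) with rfl | h
  · exact Or.inl huw
  · exact Or.inr ⟨w, h, huw⟩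

theorem exists_in_of_not_acyc_insert {r : V → V → Prop} {W : Finset V} {y : V}
    (hr : ∀ v, ¬ r v v) (hW : Acyc r W) (h : ¬ Acyc r (insert y W)) :
    ∃ u ∈ W, r u y ∧ (r y u ∨ ∃ w ∈ W, r w u) :=
  exists_out_of_not_acyc_insert (r := Function.swap r) hr hW.swap (fun h' => h (acyc_swap.1 h'))

theorem two_le_edgeCount {r : V → V → Prop} {W : Finset V} {y : V}
    (hr : ∀ v, ¬ r v v) (hW : Acyc r W) (h : ¬ Acyc r (insert y W)) : 2 ≤ edgeCount r y W := by
  obtain ⟨u, hu, hyu, -⟩ := exists_out_of_not_acyc_insert hr hW h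
  obtain ⟨w, hw, hwy, -⟩ := exists_in_of_not_acyc_insert hr hW h
  have h1 : 0 < #{u ∈ W | r y u} := card_pos.2 ⟨u, mem_filter.2 ⟨hu, hyu⟩⟩
  have h2 : 0 < #{u ∈ W | r u y} := card_pos.2 ⟨w, mem_filter.2 ⟨hw, hwy⟩⟩
  unfold edgeCount
  omega

/-- The edge between `b ∈ W` and `y` lies on no cycle of `W ∪ {y}`, as `b` is isolated in `W`,
and it is the only simple edge between `b` and `B`. -/
def IsIdle (r : V → V → Prop) (B W : Finset V) (b y : V) : Prop :=
  (∀ w ∈ W, ¬ r b w ∧ ¬ r w b) ∧ ¬ (r b y ↔ r y b) ∧ ∀ y' ∈ B, y' ≠ y → (r b y' ↔ r y' b)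

theorem isIdle_swap {r : V → V → Prop} {B W : Finset V} {b y : V} :
    IsIdle (Function.swap r) B W b y ↔ IsIdle r B W b y := by
  simp only [IsIdle, Function.swap, and_comm, iff_comm]

/-- The out-neighbours of `y` in `W` along edges that are not idle. -/
noncomputable def outN (r : V → V → Prop) (B W : Finset V) (y : V) : Finset V :=
  {u ∈ W | r y u ∧ ¬ IsIdle r B W u y}

/-- `z` is the only non-idle out-neighbour, or the only non-idle in-neighbour, of `y` in `W`. -/
def Solo (r : V → V → Prop) (B W : Finset V) (z y : V) : Prop :=
  outN r B W y = {z} ∨ outN (Function.swap r) B W y = {z}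

theorem solo_swap {r : V → V → Prop} {B W : Finset V} {z y : V} :
    Solo (Function.swap r) B W z y ↔ Solo r B W z y := by
  unfold Solo
  rw [or_comm]

theorem Solo.mem {r : V → V → Prop} {B W : Finset V} {z y : V} (h : Solo r B W z y) : z ∈ W := by
  have hz := mem_singleton_self z
  rcases h with h | h <;> rw [← h] at hz <;> exact (mem_filter.1 hz).1

theorem outN_nonempty {r : V → V → Prop} {B W : Finset V} {y : V}
    (hr : ∀ v, ¬ r v v) (hW : Acyc r W) (h : ¬ Acyc r (insert y W)) :
    ∃ u ∈ outN r B W y, r u y ∨ ∃ w ∈ W, r u w := by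
  obtain ⟨u, hu, hyu, h3⟩ := exists_out_of_not_acyc_insert hr hW h
  refine ⟨u, mem_filter.2 ⟨hu, hyu, fun hb => ?_⟩, h3⟩
  rcases h3 with h3 | ⟨w, hw, h3⟩
  · exact hb.2.1 ⟨fun _ => hyu, fun _ => h3⟩
  · exact (hb.1 w hw).1 h3

theorem not_acyc_insert_swap {r : V → V → Prop} {W : Finset V} {y : V}
    (h : ¬ Acyc r (insert y W)) : ¬ Acyc (Function.swap r) (insert y W) :=
  fun hswap => h (acyc_swap.1 hswap)

/-- A solo vertex that is isolated in its class is joined to its solo neighbour both ways. -/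
theorem Solo.double {r : V → V → Prop} {B W : Finset V} {z y : V} (hs : Solo r B W z y)
    (hr : ∀ v, ¬ r v v) (hW : Acyc r W) (h : ¬ Acyc r (insert y W))
    (hz : ∀ w ∈ W, ¬ r z w ∧ ¬ r w z) : r z y ∧ r y z := by
  rcases hs with hs | hs
  · obtain ⟨u, hu, h3⟩ := outN_nonempty (B := B) hr hW h
    have hyu := (mem_filter.1 hu).2.1
    rw [hs, mem_singleton] at hu
    subst hu
    rcases h3 with h3 | ⟨w, hw, h3⟩
    · exact ⟨h3, hyu⟩
    · exact absurd h3 (hz w hw).1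
  · obtain ⟨u, hu, h3⟩ := outN_nonempty (r := Function.swap r) (B := B) hr hW.swap
      (not_acyc_insert_swap h)
    have hyu := (mem_filter.1 hu).2.1
    rw [hs, mem_singleton] at hu
    subst hu
    rcases h3 with h3 | ⟨w, hw, h3⟩
    · exact ⟨hyu, h3⟩
    · exact absurd h3 (hz w hw).2

theorem Solo.adj {r : V → V → Prop} {B W : Finset V} {z y : V} (hs : Solo r B W z y) :
    r y z ∨ r z y := by
  have hz := mem_singleton_self z
  rcases hs with h | h <;> rw [← h] at hz
  · exact Or.inl (mem_filter.1 hz).2.1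
  · exact Or.inr (mem_filter.1 hz).2.1

theorem acyc_exchange_of_out {r : V → V → Prop} {B W : Finset V} {z y : V}
    (hs : outN r B W y = {z}) (hr : ∀ v, ¬ r v v) (hW : Acyc r W) :
    Acyc r (insert y (W.erase z)) := by
  intro T hT hne
  by_cases hb : ∃ b ∈ T, b ∈ W ∧ r y b ∧ IsIdle r B W b y
  · obtain ⟨b, hbT, -, hyb, hb⟩ := hb
    refine ⟨b, hbT, fun u hu hbu => ?_⟩
    rcases mem_insert.1 (hT hu) with rfl | hu
    · exact hb.2.1 ⟨fun _ => hyb, fun _ => hbu⟩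
    · exact (hb.1 u (mem_of_mem_erase hu)).1 hbu
  push Not at hb
  by_cases hy : y ∈ T
  · refine ⟨y, hy, fun u hu hyu => ?_⟩
    rcases mem_insert.1 (hT hu) with rfl | hu'
    · exact hr _ hyu
    · have huW := mem_of_mem_erase hu'
      have : u ∈ outN r B W y := mem_filter.2 ⟨huW, hyu, hb u hu huW hyu⟩
      rw [hs, mem_singleton] at this
      exact ne_of_mem_erase hu' this
  · exact hW T (((subset_insert_iff_of_notMem hy).1 hT).trans (erase_subset _ _)) hne

theorem Solo.acyc_exchange {r : V → V → Prop} {B W : Finset V} {z y : V}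
    (hs : Solo r B W z y) (hr : ∀ v, ¬ r v v) (hW : Acyc r W) :
    Acyc r (insert y (W.erase z)) := by
  rcases hs with h | h
  · exact acyc_exchange_of_out h hr hW
  · exact acyc_swap.1 (acyc_exchange_of_out h hr hW.swap)

/-- After exchanging `z` for its solo neighbour `y₁`, another solo neighbour `y₂` can be added. -/
theorem acyc_insert_exchange_of_out {r : V → V → Prop} {B W : Finset V} {z y₁ y₂ : V}
    (hs₁ : Solo r B W z y₁) (hs₂ : outN r B W y₂ = {z}) (hy₁ : y₁ ∈ B)
    (hne : y₁ ≠ y₂) (hr : ∀ v, ¬ r v v) (hW : Acyc r W) (hn : ¬ r y₂ y₁) :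
    Acyc r (insert y₂ (insert y₁ (W.erase z))) := by
  intro T hT hTne
  by_cases hb : ∃ b ∈ T, b ∈ W.erase z ∧ r y₂ b ∧ IsIdle r B W b y₂
  · obtain ⟨b, hbT, hbW, hyb, hb⟩ := hb
    refine ⟨b, hbT, fun u hu hbu => ?_⟩
    rcases mem_insert.1 (hT hu) with rfl | hu
    · exact hb.2.1 ⟨fun _ => hyb, fun _ => hbu⟩
    rcases mem_insert.1 hu with rfl | hu
    · have hub := (hb.2.2 u hy₁ hne).1 hbu
      have hbi : ¬ IsIdle r B W b u := fun h => h.2.1 ⟨fun _ => hub, fun _ => hbu⟩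
      rcases hs₁ with h | h
      · have : b ∈ outN r B W u := mem_filter.2 ⟨mem_of_mem_erase hbW, hub, hbi⟩
        rw [h, mem_singleton] at this
        exact ne_of_mem_erase hbW this
      · have : b ∈ outN (Function.swap r) B W u :=
          mem_filter.2 ⟨mem_of_mem_erase hbW, hbu, fun h => hbi (isIdle_swap.1 h)⟩
        rw [h, mem_singleton] at this
        exact ne_of_mem_erase hbW this
    · exact (hb.1 u (mem_of_mem_erase hu)).1 hbu
  push Not at hb
  by_cases hy : y₂ ∈ T
  · refine ⟨y₂, hy, fun u hu hyu => ?_⟩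
    rcases mem_insert.1 (hT hu) with rfl | hu'
    · exact hr _ hyu
    rcases mem_insert.1 hu' with rfl | hu'
    · exact hn hyu
    · have huW := mem_of_mem_erase hu'
      have : u ∈ outN r B W y₂ := mem_filter.2 ⟨huW, hyu, hb u hu hu' hyu⟩
      rw [hs₂, mem_singleton] at this
      exact ne_of_mem_erase hu' this
  · exact hs₁.acyc_exchange hr hW T ((subset_insert_iff_of_notMem hy).1 hT) hTne

theorem acyc_insert_exchange_of_in {r : V → V → Prop} {B W : Finset V} {z y₁ y₂ : V}
    (hs₁ : Solo r B W z y₁) (hs₂ : outN (Function.swap r) B W y₂ = {z}) (hy₁ : y₁ ∈ B)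
    (hne : y₁ ≠ y₂) (hr : ∀ v, ¬ r v v) (hW : Acyc r W) (hn : ¬ r y₁ y₂) :
    Acyc r (insert y₂ (insert y₁ (W.erase z))) :=
  acyc_swap.1 (acyc_insert_exchange_of_out (solo_swap.2 hs₁) hs₂ hy₁ hne hr hW.swap hn)

/-- The number of edges between two vertices. -/
noncomputable def pairCount (r : V → V → Prop) (v y : V) : ℕ :=
  (if r v y then 1 else 0) + (if r y v then 1 else 0)

theorem edgeCount_eq_sum (r : V → V → Prop) (v : V) (S : Finset V) :
    edgeCount r v S = ∑ y ∈ S, pairCount r v y := by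
  simp only [edgeCount, pairCount, sum_add_distrib, card_filter]

/-- A non-idle edge from `y` to `v` has weight `2` if it is the only such edge from `y` to `W`,
and weight `1` otherwise. -/
noncomputable def outWeight (r : V → V → Prop) (B W : Finset V) (v y : V) : ℕ :=
  if v ∈ outN r B W y then 1 + (if outN r B W y = {v} then 1 else 0) else 0

theorem two_le_sum_outWeight {r : V → V → Prop} {B W : Finset V} {y : V}
    (h : (outN r B W y).Nonempty) : 2 ≤ ∑ v ∈ W, outWeight r B W v y := by
  have hsub : outN r B W y ⊆ W := filter_subset _ _
  by_cases h1 : ∃ z, outN r B W y = {z}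
  · obtain ⟨z, hz⟩ := h1
    have hzm : z ∈ outN r B W y := by rw [hz]; exact mem_singleton_self z
    calc 2 = outWeight r B W z y := by simp [outWeight, hz]
      _ ≤ _ := single_le_sum (f := fun v => outWeight r B W v y) (fun _ _ => Nat.zero_le _)
          (hsub hzm)
  · have hc : 2 ≤ #(outN r B W y) := by
      have h0 := card_pos.2 h
      have : #(outN r B W y) ≠ 1 := fun hc => h1 (card_eq_one.1 hc)
      omega
    calc 2 ≤ #(outN r B W y) := hc
      _ = ∑ v ∈ outN r B W y, 1 := by simp
      _ ≤ ∑ v ∈ outN r B W y, outWeight r B W v y := by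
          refine sum_le_sum fun v hv => ?_
          simp [outWeight, hv]
      _ ≤ _ := sum_le_sum_of_subset hsub

theorem outWeight_le_two_mul (r : V → V → Prop) (B W : Finset V) (v y : V) :
    outWeight r B W v y ≤ 2 * (if r y v then 1 else 0) := by
  unfold outWeight
  by_cases h : v ∈ outN r B W y
  · have := (mem_filter.1 h).2.1
    simp only [h, this, if_true]
    split_ifs <;> omega
  · simp [h]

theorem outWeight_le_of_ne {r : V → V → Prop} {B W : Finset V} {v y : V}
    (hs : outN r B W y ≠ {v}) : outWeight r B W v y ≤ if r y v then 1 else 0 := by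
  unfold outWeight
  by_cases h : v ∈ outN r B W y
  · have := (mem_filter.1 h).2.1
    simp [h, this, hs]
  · simp [h]

theorem outWeight_eq_zero_of_idle {r : V → V → Prop} {B W : Finset V} {v y : V}
    (hi : IsIdle r B W v y) : outWeight r B W v y = 0 := by
  have : v ∉ outN r B W y := fun h => (mem_filter.1 h).2.2 hi
  simp [outWeight, this]

/-- The total weight of the pair `v`, `y`. -/
noncomputable def weight (r : V → V → Prop) (B W : Finset V) (v y : V) : ℕ :=
  outWeight r B W v y + outWeight (Function.swap r) B W v y

theorem weight_le_two_mul (r : V → V → Prop) (B W : Finset V) (v y : V) :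
    weight r B W v y ≤ 2 * pairCount r v y := by
  have h1 := outWeight_le_two_mul r B W v y
  have h2 := outWeight_le_two_mul (Function.swap r) B W v y
  simp only [weight, pairCount, Function.swap] at *
  omega

theorem weight_le_of_not_solo {r : V → V → Prop} {B W : Finset V} {v y : V}
    (hs : ¬ Solo r B W v y) : weight r B W v y ≤ pairCount r v y := by
  have h1 := outWeight_le_of_ne (fun h => hs (Or.inl h))
  have h2 := outWeight_le_of_ne (fun h => hs (Or.inr h))
  simp only [weight, pairCount, Function.swap] at *
  omega

theorem sum_weight_le_of_solo {r : V → V → Prop} {B W : Finset V} {v : V} {q : ℕ}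
    (hr : ∀ v, ¬ r v v) (hW : Acyc r W)
    (hB : ∀ y ∈ B, ¬ Acyc r (insert y W))
    (hd : edgeCount r v B + edgeCount r v W ≤ 2 * q + 1) :
    ∑ y ∈ B, weight r B W v y ≤ 4 * q := by
  have htot : ∑ y ∈ B, weight r B W v y ≤ 2 * edgeCount r v B := by
    rw [edgeCount_eq_sum, mul_sum]
    exact sum_le_sum fun y _ => weight_le_two_mul r B W v y
  by_cases hlt : edgeCount r v B ≤ 2 * q
  · omega
  have hdB : edgeCount r v B = 2 * q + 1 := by omega
  have hdW : edgeCount r v W = 0 := by omega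
  have hiso : ∀ w ∈ W, ¬ r v w ∧ ¬ r w v := by
    simp only [edgeCount, Nat.add_eq_zero_iff, card_eq_zero, filter_eq_empty_iff] at hdW
    exact fun w hw => ⟨hdW.1 hw, hdW.2 hw⟩
  set P : Finset V := {y ∈ B | ¬ (r v y ↔ r y v)} with hP
  have hsingle : ∀ y ∈ P, pairCount r v y = 1 := by
    intro y hy
    have := (mem_filter.1 hy).2
    unfold pairCount
    by_cases h1 : r v y <;> by_cases h2 : r y v <;> simp_all
  have hns : ∀ y ∈ P, ¬ Solo r B W v y := by
    intro y hy hs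
    have hy' := mem_filter.1 hy
    obtain ⟨h1, h2⟩ := hs.double hr hW (hB y hy'.1) hiso
    exact hy'.2 ⟨fun _ => h2, fun _ => h1⟩
  have key : ∀ m : ℕ, (∀ y ∈ P, weight r B W v y + m ≤ 2) →
      ∑ y ∈ B, weight r B W v y + m * #P ≤ 4 * q + 2 := by
    intro m hm
    calc ∑ y ∈ B, weight r B W v y + m * #P
        = ∑ y ∈ B, (weight r B W v y + if ¬ (r v y ↔ r y v) then m else 0) := by
          rw [sum_add_distrib, ← sum_filter, sum_const, smul_eq_mul, mul_comm]
      _ ≤ ∑ y ∈ B, 2 * pairCount r v y := by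
          refine sum_le_sum fun y hy => ?_
          by_cases hyP : ¬ (r v y ↔ r y v)
          · have hyP' : y ∈ P := mem_filter.2 ⟨hy, hyP⟩
            rw [if_pos hyP, hsingle y hyP']
            exact hm y hyP'
          · rw [if_neg hyP]
            exact weight_le_two_mul r B W v y
      _ = 4 * q + 2 := by
          rw [← mul_sum, ← edgeCount_eq_sum, hdB]
          ring
  have hone : ∀ y ∈ P, weight r B W v y ≤ 1 := fun y hy =>
    (weight_le_of_not_solo (hns y hy)).trans (hsingle y hy).le
  rcases Nat.lt_or_ge 1 #P with h2 | h2
  · have := key 1 (fun y hy => by have := hone y hy; omega)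
    omega
  rcases Nat.eq_zero_or_pos #P with h0 | h0
  · exfalso
    have hev : 2 ∣ edgeCount r v B := by
      rw [edgeCount_eq_sum]
      refine dvd_sum fun y hy => ?_
      have : ¬ ¬ (r v y ↔ r y v) := fun h => by
        have : y ∈ P := mem_filter.2 ⟨hy, h⟩
        rw [card_eq_zero.1 h0] at this
        simp at this
      unfold pairCount
      by_cases h1 : r v y <;> by_cases h2 : r y v <;> simp_all
    omega
  · have hP1 : #P = 1 := by omega
    obtain ⟨y₀, hy₀⟩ := card_eq_one.1 hP1
    have hidle : IsIdle r B W v y₀ := by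
      have hy₀P : y₀ ∈ P := by rw [hy₀]; exact mem_singleton_self _
      refine ⟨hiso, (mem_filter.1 hy₀P).2, fun y' hy' hne => ?_⟩
      by_contra hc
      have : y' ∈ P := mem_filter.2 ⟨hy', hc⟩
      rw [hy₀, mem_singleton] at this
      exact hne this
    have := key 2 (fun y hy => by
      rw [hy₀, mem_singleton] at hy
      subst hy
      rw [weight, outWeight_eq_zero_of_idle hidle,
        outWeight_eq_zero_of_idle (isIdle_swap.2 hidle)])
    omega

/-- If no solo vertex of a class `W` has too many edges outside `B ∪ W`, then some vertex of `W`
has many edges to `B`. -/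
theorem exists_lt_edgeCount {r : V → V → Prop} {B W : Finset V} {q s : ℕ}
    (hr : ∀ v, ¬ r v v) (hW : Acyc r W)
    (hB : ∀ y ∈ B, ¬ Acyc r (insert y W)) (hWs : #W ≤ s) (hBs : q * s < #B)
    (hsolo : ∀ v ∈ W, (∃ y ∈ B, Solo r B W v y) →
      edgeCount r v B + edgeCount r v W ≤ 2 * q + 1) :
    ∃ v ∈ W, 4 * q < edgeCount r v B := by
  by_contra hcon
  push Not at hcon
  have hup : ∀ v ∈ W, ∑ y ∈ B, weight r B W v y ≤ 4 * q := by
    intro v hv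
    by_cases hs : ∃ y ∈ B, Solo r B W v y
    · exact sum_weight_le_of_solo hr hW hB (hsolo v hv hs)
    · push Not at hs
      refine le_trans ?_ (hcon v hv)
      rw [edgeCount_eq_sum]
      exact sum_le_sum fun y hy => weight_le_of_not_solo (hs y hy)
  have hlow : ∀ y ∈ B, 4 ≤ ∑ v ∈ W, weight r B W v y := by
    intro y hy
    obtain ⟨u, hu, -⟩ := outN_nonempty (B := B) hr hW (hB y hy)
    obtain ⟨u', hu', -⟩ := outN_nonempty (r := Function.swap r) (B := B) hr hW.swap
      (not_acyc_insert_swap (hB y hy))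
    have h1 := two_le_sum_outWeight ⟨u, hu⟩
    have h2 := two_le_sum_outWeight ⟨u', hu'⟩
    simp only [weight, sum_add_distrib]
    omega
  have h1 : ∑ y ∈ B, 4 ≤ ∑ y ∈ B, ∑ v ∈ W, weight r B W v y := sum_le_sum hlow
  have h2 : ∑ v ∈ W, ∑ y ∈ B, weight r B W v y ≤ ∑ v ∈ W, 4 * q := sum_le_sum hup
  rw [sum_comm] at h2
  have h3 := h1.trans h2
  simp only [sum_const, smul_eq_mul] at h3
  have h4 : #W * (4 * q) ≤ s * (4 * q) := Nat.mul_le_mul_right _ hWs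
  nlinarith

theorem Acyc.exists_maximal {r : V → V → Prop} {B I₀ : Finset V} (h : Acyc r I₀) (hB : I₀ ⊆ B) :
    ∃ I, I₀ ⊆ I ∧ I ⊆ B ∧ Acyc r I ∧ ∀ x ∈ B \ I, ¬ Acyc r (insert x I) := by
  obtain ⟨I, hI, hmax⟩ := exists_max_image {I ∈ B.powerset | I₀ ⊆ I ∧ Acyc r I} card
    ⟨I₀, mem_filter.2 ⟨mem_powerset.2 hB, Subset.rfl, h⟩⟩
  obtain ⟨hIB, hI₀, hIa⟩ := mem_filter.1 hI
  rw [mem_powerset] at hIB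
  refine ⟨I, hI₀, hIB, hIa, fun x hx hxa => ?_⟩
  obtain ⟨hxB, hxI⟩ := mem_sdiff.1 hx
  have := hmax (insert x I) (mem_filter.2 ⟨mem_powerset.2 (insert_subset hxB hIB),
    hI₀.trans (subset_insert _ _), hxa⟩)
  rw [card_insert_of_notMem hxI] at this
  omega

/-- `y` has no neighbour in `I`. -/
def IsolatedIn (r : V → V → Prop) (I : Finset V) (y : V) : Prop :=
  ∀ w ∈ I, ¬ r y w ∧ ¬ r w y

theorem one_add_sum_le_sum_out {r : V → V → Prop} {I : Finset V} {x : V}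
    (hr : ∀ v, ¬ r v v) (hI : Acyc r I) (hx : ¬ Acyc r (insert x I)) :
    1 + ∑ y ∈ I, (if IsolatedIn r I y ∧ r x y ∧ ¬ r y x then 1 else 0) ≤
      ∑ y ∈ I, if r x y then 1 else 0 := by
  obtain ⟨u, hu, hxu, h3⟩ := exists_out_of_not_acyc_insert hr hI hx
  rw [add_comm, Nat.add_one_le_iff]
  refine sum_lt_sum (fun y _ => ?_) ⟨u, hu, ?_⟩
  · split_ifs <;> simp_all
  · rw [if_pos hxu, if_neg]
    · exact one_pos
    · rintro ⟨h1, -, h2⟩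
      rcases h3 with h3 | ⟨w, hw, h3⟩
      · exact h2 h3
      · exact (h1 w hw).1 h3

/-- Simple edges from `x` to isolated vertices of `I` do not help to block `x`. -/
theorem two_add_sum_le_sum_pairCount {r : V → V → Prop} {I : Finset V} {x : V}
    (hr : ∀ v, ¬ r v v) (hI : Acyc r I) (hx : ¬ Acyc r (insert x I)) :
    2 + ∑ y ∈ I, (if IsolatedIn r I y ∧ ¬ (r x y ↔ r y x) then 1 else 0) ≤
      ∑ y ∈ I, pairCount r y x := by
  have h1 := one_add_sum_le_sum_out hr hI hx
  have h2 := one_add_sum_le_sum_out (r := Function.swap r) hr hI.swap (not_acyc_insert_swap hx)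
  have h3 : ∑ y ∈ I, (if IsolatedIn r I y ∧ ¬ (r x y ↔ r y x) then 1 else 0) =
      ∑ y ∈ I, (if IsolatedIn r I y ∧ r x y ∧ ¬ r y x then 1 else 0) +
      ∑ y ∈ I, (if IsolatedIn (Function.swap r) I y ∧ Function.swap r x y ∧
        ¬ Function.swap r y x then 1 else 0) := by
    rw [← sum_add_distrib]
    refine sum_congr rfl fun y _ => ?_
    have : IsolatedIn (Function.swap r) I y ↔ IsolatedIn r I y := by
      simp only [IsolatedIn, Function.swap, and_comm]
    rw [this]
    simp only [Function.swap]
    by_cases h : IsolatedIn r I y <;> by_cases h1 : r x y <;> by_cases h2 : r y x <;>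
      simp [h, h1, h2]
  have h4 : ∑ y ∈ I, pairCount r y x = (∑ y ∈ I, if r x y then 1 else 0) +
      ∑ y ∈ I, if Function.swap r x y then 1 else 0 := by
    rw [← sum_add_distrib]
    refine sum_congr rfl fun y _ => ?_
    simp only [pairCount, Function.swap]
    omega
  omega

theorem le_sum_edgeCount_of_maximal {r : V → V → Prop} {B I : Finset V}
    (hr : ∀ v, ¬ r v v) (hI : Acyc r I) (hIB : I ⊆ B)
    (hmax : ∀ x ∈ B \ I, ¬ Acyc r (insert x I)) :
    2 * #B + ∑ y ∈ I, (if IsolatedIn r I y ∧ Even (edgeCount r y B) then 0 else 1) ≤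
      2 * #I + ∑ y ∈ I, edgeCount r y B := by
  have hsplit : ∑ y ∈ I, edgeCount r y B =
      ∑ y ∈ I, edgeCount r y I + ∑ x ∈ B \ I, ∑ y ∈ I, pairCount r y x := by
    rw [sum_comm, ← sum_add_distrib]
    refine sum_congr rfl fun y _ => ?_
    rw [edgeCount_eq_sum, edgeCount_eq_sum, add_comm, sum_sdiff hIB]
  have hout : ∑ x ∈ B \ I,
      (2 + ∑ y ∈ I, (if IsolatedIn r I y ∧ ¬ (r x y ↔ r y x) then 1 else 0)) ≤
      ∑ x ∈ B \ I, ∑ y ∈ I, pairCount r y x :=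
    sum_le_sum fun x hx => two_add_sum_le_sum_pairCount hr hI (hmax x hx)
  rw [sum_add_distrib, sum_const, smul_eq_mul, sum_comm] at hout
  have hcard : #(B \ I) + #I = #B := card_sdiff_add_card_eq_card hIB
  have hpt : ∑ y ∈ I, (if IsolatedIn r I y ∧ Even (edgeCount r y B) then 0 else 1) ≤
      ∑ y ∈ I, edgeCount r y I +
      ∑ y ∈ I, ∑ x ∈ B \ I, (if IsolatedIn r I y ∧ ¬ (r x y ↔ r y x) then 1 else 0) := by
    rw [← sum_add_distrib]
    refine sum_le_sum fun y hy => ?_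
    by_cases hiso : IsolatedIn r I y
    · by_cases hev : Even (edgeCount r y B)
      · simp [hiso, hev]
      · rw [if_neg (fun h => hev h.2)]
        have hex : ∃ x ∈ B \ I, ¬ (r x y ↔ r y x) := by
          by_contra hno
          push Not at hno
          refine hev (even_iff_two_dvd.2 ?_)
          rw [edgeCount_eq_sum]
          refine dvd_sum fun x hx => ?_
          by_cases hxI : x ∈ I
          · simp [pairCount, hiso x hxI]
          · have := hno x (mem_sdiff.2 ⟨hx, hxI⟩)
            unfold pairCount
            by_cases h1 : r x y <;> simp_all
        obtain ⟨x, hx, hxy⟩ := hex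
        have := single_le_sum (f := fun x => if IsolatedIn r I y ∧ ¬ (r x y ↔ r y x) then 1 else 0)
          (fun _ _ => Nat.zero_le _) hx
        simp only [hiso, hxy, not_false_eq_true, and_self, if_true, true_and] at this ⊢
        omega
    · rw [if_neg (fun h => hiso h.1)]
      have : 0 < edgeCount r y I := by
        by_contra h0
        apply hiso
        simp only [edgeCount, not_lt, Nat.le_zero, Nat.add_eq_zero_iff, card_eq_zero,
          filter_eq_empty_iff] at h0
        exact fun w hw => ⟨h0.1 hw, h0.2 hw⟩
      omega
  omega

/-- How much the class vertex `z` is used by `y`: solo edges count `1`, but a solo neighbour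
that is isolated in `I` counts `2` altogether. -/
noncomputable def soloCharge (r : V → V → Prop) (B W I : Finset V) (z y : V) : ℕ :=
  if IsolatedIn r I y then 2 * (if Solo r B W z y then 1 else 0)
  else (if outN r B W y = {z} then 1 else 0) + (if outN (Function.swap r) B W y = {z} then 1 else 0)

theorem one_le_sum_of_card_outN {r : V → V → Prop} {B W : Finset V} {y : V}
    (h : #(outN r B W y) = 1) : 1 ≤ ∑ z ∈ W, if outN r B W y = {z} then 1 else 0 := by
  obtain ⟨z, hz⟩ := card_eq_one.1 h
  have hzW : z ∈ W := Solo.mem (Or.inl hz)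
  have := single_le_sum (f := fun z => if outN r B W y = {z} then 1 else 0)
    (fun _ _ => Nat.zero_le _) hzW
  simpa [hz] using this

theorem card_outN_add_card_outN_le (r : V → V → Prop) (B W : Finset V) (y : V) :
    #(outN r B W y) + #(outN (Function.swap r) B W y) ≤ edgeCount r y W := by
  refine Nat.add_le_add (card_le_card ?_) (card_le_card ?_)
  · exact fun u hu => mem_filter.2 ⟨(mem_filter.1 hu).1, (mem_filter.1 hu).2.1⟩
  · exact fun u hu => mem_filter.2 ⟨(mem_filter.1 hu).1, (mem_filter.1 hu).2.1⟩

theorem four_le_add_sum_soloCharge {r : V → V → Prop} {B W I : Finset V} {y : V}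
    (hr : ∀ v, ¬ r v v) (hW : Acyc r W) (hy : ¬ Acyc r (insert y W)) :
    4 ≤ (if IsolatedIn r I y then 2 * (edgeCount r y W / 2) else edgeCount r y W) +
      ∑ z ∈ W, soloCharge r B W I z y := by
  obtain ⟨u, hu, -⟩ := outN_nonempty (B := B) hr hW hy
  obtain ⟨u', hu', -⟩ := outN_nonempty (r := Function.swap r) (B := B) hr hW.swap
    (not_acyc_insert_swap hy)
  have h1 := card_pos.2 ⟨u, hu⟩
  have h2 := card_pos.2 ⟨u', hu'⟩
  have h12 := card_outN_add_card_outN_le r B W y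
  by_cases hiso : IsolatedIn r I y
  · simp only [soloCharge, hiso, if_true, ← mul_sum]
    by_cases h3 : edgeCount r y W ≤ 3
    · have : 1 ≤ ∑ z ∈ W, if Solo r B W z y then 1 else 0 := by
        by_cases h4 : #(outN r B W y) = 1
        · refine (one_le_sum_of_card_outN h4).trans (sum_le_sum fun z _ => ?_)
          by_cases h : outN r B W y = {z} <;> simp [Solo, h]
        · have h5 : #(outN (Function.swap r) B W y) = 1 := by omega
          refine (one_le_sum_of_card_outN h5).trans (sum_le_sum fun z _ => ?_)
          by_cases h : outN (Function.swap r) B W y = {z} <;> simp [Solo, h]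
      omega
    · omega
  · simp only [soloCharge, hiso, if_false, sum_add_distrib]
    have h3 : #(outN r B W y) = 1 → _ := one_le_sum_of_card_outN
    have h4 : #(outN (Function.swap r) B W y) = 1 → _ := one_le_sum_of_card_outN
    omega

theorem sum_soloCharge_le {r : V → V → Prop} {B W I : Finset V} {z : V}
    (hI : Acyc r I)
    (hout : ∀ y₁ ∈ I, ∀ y₂ ∈ I, y₁ ≠ y₂ → Solo r B W z y₁ → outN r B W y₂ = {z} → r y₂ y₁)
    (hin : ∀ y₁ ∈ I, ∀ y₂ ∈ I, y₁ ≠ y₂ → Solo r B W z y₁ →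
      outN (Function.swap r) B W y₂ = {z} → r y₁ y₂) :
    ∑ y ∈ I, soloCharge r B W I z y ≤ 2 := by
  have hno : ∀ y₁ ∈ I, ∀ y₂ ∈ I, r y₁ y₂ → r y₂ y₁ → False := by
    intro y₁ h₁ y₂ h₂ h12 h21
    obtain ⟨v, hv, hs⟩ := hI {y₁, y₂} (by simp [insert_subset_iff, h₁, h₂]) (by simp)
    rcases mem_insert.1 hv with rfl | hv
    · exact hs y₂ (by simp) h12
    · rw [mem_singleton] at hv
      subst hv
      exact hs y₁ (by simp) h21
  by_cases hex : ∃ y₀ ∈ I, IsolatedIn r I y₀ ∧ Solo r B W z y₀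
  · obtain ⟨y₀, hy₀, hiso, hs⟩ := hex
    rw [sum_eq_single_of_mem y₀ hy₀]
    · simp [soloCharge, hiso, hs]
    · intro y hy hne
      have h1 : outN r B W y ≠ {z} := fun h => (hiso y hy).2 (hout y₀ hy₀ y hy hne.symm hs h)
      have h2 : outN (Function.swap r) B W y ≠ {z} := fun h =>
        (hiso y hy).1 (hin y₀ hy₀ y hy hne.symm hs h)
      simp [soloCharge, Solo, h1, h2]
  · push Not at hex
    have hle : ∑ y ∈ I, soloCharge r B W I z y ≤ ∑ y ∈ I, ((if outN r B W y = {z} then 1 else 0) +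
        (if outN (Function.swap r) B W y = {z} then 1 else 0)) := by
      refine sum_le_sum fun y hy => ?_
      by_cases hiso : IsolatedIn r I y
      · simp [soloCharge, hiso, hex y hy hiso]
      · simp [soloCharge, hiso]
    refine hle.trans ?_
    rw [sum_add_distrib, ← card_filter, ← card_filter]
    have h1 : #{y ∈ I | outN r B W y = {z}} ≤ 1 := by
      refine card_le_one.2 fun a ha b hb => ?_
      obtain ⟨ha, ha'⟩ := mem_filter.1 ha
      obtain ⟨hb, hb'⟩ := mem_filter.1 hb
      by_contra hne
      exact hno a ha b hb (hout b hb a ha (Ne.symm hne) (Or.inl hb') ha')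
        (hout a ha b hb hne (Or.inl ha') hb')
    have h2 : #{y ∈ I | outN (Function.swap r) B W y = {z}} ≤ 1 := by
      refine card_le_one.2 fun a ha b hb => ?_
      obtain ⟨ha, ha'⟩ := mem_filter.1 ha
      obtain ⟨hb, hb'⟩ := mem_filter.1 hb
      by_contra hne
      exact hno a ha b hb (hin a ha b hb hne (Or.inr ha') hb')
        (hin b hb a ha (Ne.symm hne) (Or.inr hb') ha')
    omega

/-- With at least `q` classes available, some solo vertex `z` can be exchanged for one of its solo
neighbours so that a further vertex of `B` may join the class. -/
theorem exists_exchange {r : V → V → Prop} {B I₀ : Finset V} {T : Finset K}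
    {cl : K → Finset V} {q s : ℕ} (hr : ∀ v, ¬ r v v) (hcl : ∀ W ∈ T, Acyc r (cl W))
    (hB : ∀ W ∈ T, ∀ y ∈ B, ¬ Acyc r (insert y (cl W))) (hsz : ∀ W ∈ T, #(cl W) ≤ s)
    (hBs : q * s < #B) (hqt : q ≤ #T)
    (hdeg : ∀ y ∈ B, edgeCount r y B + ∑ W ∈ T, edgeCount r y (cl W) + 1 ≤ 2 * q + 2 * #T)
    (hI₀B : I₀ ⊆ B) (hI₀ : Acyc r I₀) (hI₀s : s ≤ #I₀) :
    ∃ W ∈ T, ∃ z, ∃ y₁ ∈ B, ∃ y₂ ∈ B, y₁ ≠ y₂ ∧ Solo r B (cl W) z y₁ ∧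
      Acyc r (insert y₂ (insert y₁ ((cl W).erase z))) := by
  by_contra hcon
  push Not at hcon
  obtain ⟨I, hI₀I, hIB, hI, hmax⟩ := hI₀.exists_maximal hI₀B
  have hup : ∑ W ∈ T, ∑ z ∈ cl W, ∑ y ∈ I, soloCharge r B (cl W) I z y ≤ #T * (s * 2) := by
    rw [← smul_eq_mul, ← sum_const]
    refine sum_le_sum fun W hW => ?_
    refine le_trans (sum_le_sum (g := fun _ => 2) fun z hz => ?_) ?_
    · refine sum_soloCharge_le hI (fun y₁ h₁ y₂ h₂ hne hs ho => ?_)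
        (fun y₁ h₁ y₂ h₂ hne hs ho => ?_)
      · by_contra hn
        exact hcon W hW z y₁ (hIB h₁) y₂ (hIB h₂) hne hs
          (acyc_insert_exchange_of_out hs ho (hIB h₁) hne hr (hcl W hW) hn)
      · by_contra hn
        exact hcon W hW z y₁ (hIB h₁) y₂ (hIB h₂) hne hs
          (acyc_insert_exchange_of_in hs ho (hIB h₁) hne hr (hcl W hW) hn)
    · rw [sum_const, smul_eq_mul]
      exact Nat.mul_le_mul_right _ (hsz W hW)
  have hlow : ∀ y ∈ I, 2 * #T + edgeCount r y B + 2 ≤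
      2 * q + (if IsolatedIn r I y ∧ Even (edgeCount r y B) then 0 else 1) +
        ∑ W ∈ T, ∑ z ∈ cl W, soloCharge r B (cl W) I z y := by
    intro y hy
    have hyB := hIB hy
    have hd := hdeg y hyB
    have hfour : ∑ W ∈ T, 4 ≤ ∑ W ∈ T, ((if IsolatedIn r I y then
        2 * (edgeCount r y (cl W) / 2) else edgeCount r y (cl W)) +
        ∑ z ∈ cl W, soloCharge r B (cl W) I z y) :=
      sum_le_sum fun W hW => four_le_add_sum_soloCharge hr (hcl W hW) (hB W hW y hyB)
    rw [sum_const, smul_eq_mul, sum_add_distrib] at hfour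
    by_cases hiso : IsolatedIn r I y
    · simp only [hiso, if_true, true_and, ← mul_sum] at hfour ⊢
      have hhalf : 2 * ∑ W ∈ T, edgeCount r y (cl W) / 2 ≤ ∑ W ∈ T, edgeCount r y (cl W) := by
        rw [mul_sum]
        exact sum_le_sum fun W _ => Nat.mul_div_le _ _
      by_cases hev : Even (edgeCount r y B)
      · obtain ⟨m, hm⟩ := hev
        rw [if_pos ⟨m, hm⟩]
        omega
      · rw [if_neg hev]
        omega
    · simp only [hiso, if_false, false_and] at hfour ⊢
      omega
  have hmid := le_sum_edgeCount_of_maximal hr hI hIB hmax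
  have hsum := sum_le_sum hlow
  simp only [sum_add_distrib, sum_const, smul_eq_mul] at hsum
  have hcomm : ∑ y ∈ I, ∑ W ∈ T, ∑ z ∈ cl W, soloCharge r B (cl W) I z y =
      ∑ W ∈ T, ∑ z ∈ cl W, ∑ y ∈ I, soloCharge r B (cl W) I z y := by
    rw [sum_comm]
    exact sum_congr rfl fun W _ => sum_comm
  rw [hcomm] at hsum
  have hIs : s ≤ #I := hI₀s.trans (card_le_card hI₀I)
  obtain ⟨m, hm⟩ := Nat.exists_eq_add_of_le hqt
  obtain ⟨n, hn⟩ := Nat.exists_eq_add_of_le hIs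
  rw [hm, hn] at *
  nlinarith [Nat.zero_le (m * n)]

/-- The steps of `M` that neither start nor end at `U`. -/
def Avoid (M : K → K → Prop) (U : K) (a b : K) : Prop := a ≠ U ∧ b ≠ U ∧ M a b

theorem reflTransGen_of_avoid {M : K → K → Prop} {U a b : K}
    (h : ReflTransGen (Avoid M U) a b) : ReflTransGen M a b :=
  ReflTransGen.mono (fun _ _ h => h.2.2) _ _ h

theorem reflTransGen_source_ne {M : K → K → Prop} {c d : K} (h : ReflTransGen M c d) :
    ReflTransGen (fun a b => a ≠ d ∧ M a b) c d := by
  induction h using ReflTransGen.head_induction_on with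
  | refl => exact .refl
  | @head a b hab _ ih =>
    by_cases had : a = d
    · subst had
      exact .refl
    · exact .head ⟨had, hab⟩ ih

theorem reflTransGen_avoid_of_source_ne {M : K → K → Prop} {c d e : K}
    (h : ReflTransGen (fun a b => a ≠ d ∧ M a b) c e) (hed : e ≠ d) :
    c ≠ d ∧ ReflTransGen (Avoid M d) c e := by
  induction h using ReflTransGen.head_induction_on with
  | refl => exact ⟨hed, .refl⟩
  | head hab _ ih => exact ⟨hab.1, .head ⟨hab.1, ih.1, hab.2⟩ ih.2⟩

theorem reflTransGen_avoid_or {M : K → K → Prop} {c d x : K} (hcd : d ≠ c)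
    (h : ReflTransGen M x d) : (x ≠ c ∧ ReflTransGen (Avoid M c) x d) ∨
      ∃ c' ≠ c, M c c' ∧ ReflTransGen (Avoid M c) c' d := by
  induction h using ReflTransGen.head_induction_on with
  | refl => exact Or.inl ⟨hcd, .refl⟩
  | @head a b hab _ ih =>
    rcases ih with ⟨hb, ih⟩ | ih
    · by_cases hac : a = c
      · subst hac
        exact Or.inr ⟨b, hb, hab, ih⟩
      · exact Or.inl ⟨hac, .head ⟨hac, hb, hab⟩ ih⟩
    · exact Or.inr ih

theorem reflTransGen_avoid_of_not {M : K → K → Prop} {U W d X : K}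
    (hW : ¬ ReflTransGen (Avoid M U) W d) (h : ReflTransGen (Avoid M U) X d) :
    X ≠ W ∧ ReflTransGen (Avoid M W) X d := by
  induction h using ReflTransGen.head_induction_on with
  | refl => exact ⟨fun h => hW (h ▸ .refl), .refl⟩
  | @head a b hab hbd ih =>
    have ha : a ≠ W := fun h => hW (h ▸ .head hab hbd)
    exact ⟨ha, .head ⟨ha, ih.1, hab.2.2⟩ ih.2⟩

/-- Among the points that reach `d` there is a nonempty family `T` of terminal ones (no other
point needs them in order to reach `d`) whose steps only lead to `T` or to a single `U`. -/
theorem exists_terminal {M : K → K → Prop} {A : Finset K} {d : K}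
    (hA : ∀ c ∈ A, ReflTransGen M c d) (hd : d ∈ A) (hne : ∃ c ∈ A, c ≠ d) :
    ∃ U ∈ A, ∃ T ⊆ A, T.Nonempty ∧ U ∉ T ∧ d ∉ T ∧
      (∀ W ∈ T, ∀ X ∈ A, X ≠ W → ReflTransGen (Avoid M W) X d) ∧
      ∀ W ∈ T, ∀ Y ∈ A, Y ∉ T → Y ≠ U → ¬ M W Y := by
  let T : K → Finset K := fun U => {X ∈ A | X ≠ U ∧ ¬ ReflTransGen (Avoid M U) X d}
  have hTd : (T d).Nonempty := by
    obtain ⟨c, hc, hcd⟩ := hne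
    refine ⟨c, mem_filter.2 ⟨hc, hcd, fun h => ?_⟩⟩
    rcases ReflTransGen.cases_tail h with h | ⟨e, -, h⟩
    · exact hcd h.symm
    · exact h.2.1 rfl
  obtain ⟨U, hU, hmin⟩ := exists_min_image {U ∈ A | (T U).Nonempty} (fun U => #(T U))
    ⟨d, mem_filter.2 ⟨hd, hTd⟩⟩
  obtain ⟨hUA, hUne⟩ := mem_filter.1 hU
  refine ⟨U, hUA, T U, filter_subset _ _, hUne, fun h => (mem_filter.1 h).2.1 rfl,
    fun h => (mem_filter.1 h).2.2 .refl, ?_, ?_⟩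
  · intro W hW X hX hXW
    by_contra hcon
    obtain ⟨hWA, hWU, hWn⟩ := mem_filter.1 hW
    have hlt : #(T W) < #(T U) := by
      refine card_lt_card ((ssubset_iff_of_subset fun Y hY => ?_).2
        ⟨W, hW, fun h => (mem_filter.1 h).2.1 rfl⟩)
      obtain ⟨hYA, hYW, hYn⟩ := mem_filter.1 hY
      refine mem_filter.2 ⟨hYA, ?_, fun h => hYn (reflTransGen_avoid_of_not hWn h).2⟩
      rintro rfl
      by_cases hdY : d = Y
      · subst hdY
        exact hYn .refl
      · have : ∃ c' ≠ Y, M Y c' ∧ ReflTransGen (Avoid M Y) c' d := by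
          rcases reflTransGen_avoid_or hdY (hA Y hYA) with h | h
          · exact absurd rfl h.1
          · exact h
        obtain ⟨c', -, hc', hp⟩ := this
        have := reflTransGen_avoid_of_not hWn hp
        exact hYn (.head ⟨hYW, this.1, hc'⟩ this.2)
    exact absurd (hmin W (mem_filter.2 ⟨hWA, X, mem_filter.2 ⟨hX, hXW, hcon⟩⟩)) (not_le.2 hlt)
  · intro W hW Y hYA hYT hYU hM
    obtain ⟨hWA, hWU, hWn⟩ := mem_filter.1 hW
    have hY : ReflTransGen (Avoid M U) Y d := by
      by_contra h
      exact hYT (mem_filter.2 ⟨hYA, hYU, h⟩)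
    exact hWn (.head ⟨hWU, hYU, hM⟩ hY)

/-- The class of colour `c` in `X`. -/
noncomputable def cls (X : Finset V) (f : V → K) (c : K) : Finset V := {v ∈ X | f v = c}

theorem mem_cls {X : Finset V} {f : V → K} {c : K} {v : V} : v ∈ cls X f c ↔ v ∈ X ∧ f v = c :=
  mem_filter

/-- `f` colours `X` acyclically with colours from `C`. -/
def IsCol (r : V → V → Prop) (X : Finset V) (C : Finset K) (f : V → K) : Prop :=
  (∀ v ∈ X, f v ∈ C) ∧ ∀ c ∈ C, Acyc r (cls X f c)

/-- Some vertex of class `a` can be moved to class `b`. -/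
def Mov (r : V → V → Prop) (X : Finset V) (C : Finset K) (f : V → K) (a b : K) : Prop :=
  a ∈ C ∧ b ∈ C ∧ a ≠ b ∧ ∃ v ∈ cls X f a, Acyc r (insert v (cls X f b))

theorem cls_update_self {X : Finset V} {f : V → K} {x : V} {d : K} (hx : x ∈ X) :
    cls X (Function.update f x d) d = insert x (cls X f d) := by
  ext v
  by_cases hv : v = x
  · subst hv
    simp [mem_cls, hx]
  · simp [mem_cls, hv]

theorem cls_update_of_ne {X : Finset V} {f : V → K} {x : V} {d e : K} (h : e ≠ d) :
    cls X (Function.update f x d) e = (cls X f e).erase x := by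
  ext v
  by_cases hv : v = x
  · subst hv
    simp [mem_cls, h.symm]
  · simp [mem_cls, hv]

theorem isCol_update {r : V → V → Prop} {X : Finset V} {C : Finset K} {f : V → K} {x : V} {d : K}
    (hf : IsCol r X C f) (hx : x ∈ X) (hd : d ∈ C) (h : Acyc r (insert x (cls X f d))) :
    IsCol r X C (Function.update f x d) := by
  refine ⟨fun v hv => ?_, fun c hc => ?_⟩
  · by_cases hvx : v = x
    · subst hvx
      simpa using hd
    · simpa [hvx] using hf.1 v hv
  · by_cases hcd : c = d
    · subst hcd
      rwa [cls_update_self hx]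
    · rw [cls_update_of_ne hcd]
      exact (hf.2 c hc).mono (erase_subset _ _)

theorem card_cls_update {X : Finset V} {f : V → K} {x : V} {d : K} (hx : x ∈ X) (hd : f x ≠ d)
    (e : K) : #(cls X (Function.update f x d) e) + (if e = f x then 1 else 0) =
      #(cls X f e) + if e = d then 1 else 0 := by
  by_cases hed : e = d
  · subst hed
    rw [cls_update_self hx, card_insert_of_notMem (fun h => hd (mem_cls.1 h).2)]
    simp [Ne.symm hd]
  · rw [cls_update_of_ne hed]
    by_cases hex : e = f x
    · subst hex
      rw [if_pos rfl, if_neg hed, card_erase_add_one (mem_cls.2 ⟨hx, rfl⟩), add_zero]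
    · rw [erase_eq_of_notMem (fun h => hex (mem_cls.1 h).2.symm)]
      simp [hed, hex]

/-- Shifting vertices along a path from `c` to `d` decreases class `c` and increases class `d`. -/
theorem exists_shift {r : V → V → Prop} {X : Finset V} {C : Finset K} {c : K} :
    ∀ (n : ℕ) (Z : Finset K) (d : K) (f : V → K), #(C \ Z) = n → IsCol r X C f → d ∈ C → d ∉ Z →
      ReflTransGen (fun a b => a ∉ Z ∧ b ∉ Z ∧ Mov r X C f a b) c d →
      ∃ f', IsCol r X C f' ∧ (∀ e ∈ Z, cls X f' e = cls X f e) ∧ cls X f' c ⊆ cls X f c ∧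
        ∀ e, #(cls X f' e) + (if e = c then 1 else 0) = #(cls X f e) + if e = d then 1 else 0 := by
  intro n
  induction n using Nat.strong_induction_on with
  | _ n ih =>
  intro Z d f hn hf hdC hdZ hpath
  rcases ReflTransGen.cases_tail (reflTransGen_source_ne hpath) with h | ⟨e, hce, hed, heZ, -, hmov⟩
  · subst h
    exact ⟨f, hf, fun _ _ => rfl, Subset.rfl, fun _ => rfl⟩
  obtain ⟨heC, -, -, x, hx, hxa⟩ := hmov
  obtain ⟨hxX, hxe⟩ := mem_cls.1 hx
  obtain ⟨hcd, hce⟩ := reflTransGen_avoid_of_source_ne hce hed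
  set f₁ := Function.update f x d with hf₁
  have hpath₁ : ReflTransGen (fun a b => a ∉ insert d Z ∧ b ∉ insert d Z ∧ Mov r X C f₁ a b) c e := by
    refine ReflTransGen.mono ?_ _ _ (reflTransGen_source_ne hce)
    rintro a b ⟨hae, had, hbd, haZ, hbZ, haC, hbC, hab, v, hv, hva⟩
    refine ⟨by simp [had, haZ], by simp [hbd, hbZ], haC, hbC, hab, v, ?_, ?_⟩
    · rw [cls_update_of_ne had]
      refine mem_erase.2 ⟨?_, hv⟩
      rintro rfl
      exact hae ((mem_cls.1 hv).2.symm.trans hxe)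
    · rw [cls_update_of_ne hbd]
      exact hva.mono (insert_subset_insert _ (erase_subset _ _))
  have hlt : #(C \ insert d Z) < n := by
    rw [← hn]
    refine card_lt_card ((ssubset_iff_of_subset (sdiff_subset_sdiff Subset.rfl
      (subset_insert _ _))).2 ⟨d, mem_sdiff.2 ⟨hdC, hdZ⟩, by simp⟩)
  obtain ⟨f', h1, h2, h3, h4⟩ := ih _ hlt (insert d Z) e f₁ rfl
    (isCol_update hf hxX hdC hxa) heC (by simp [hed, heZ]) hpath₁
  refine ⟨f', h1, fun e' he' => ?_, ?_, fun e₁ => ?_⟩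
  · rw [h2 e' (mem_insert_of_mem he'), cls_update_of_ne (ne_of_mem_of_not_mem he' hdZ),
      erase_eq_of_notMem]
    intro h
    exact heZ (hxe.symm.trans (mem_cls.1 h).2 ▸ he')
  · rw [cls_update_of_ne hcd] at h3
    exact h3.trans (erase_subset _ _)
  · have := card_cls_update hxX (hxe.trans_ne hed) e₁
    rw [hxe] at this
    rw [h4 e₁, this]

/-- `X` can be coloured acyclically with colours from `C`, all classes having size `s`. -/
def Equit (r : V → V → Prop) (X : Finset V) (C : Finset K) (s : ℕ) : Prop :=
  ∃ f : V → K, IsCol r X C f ∧ ∀ c ∈ C, #(cls X f c) = s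

/-- An acyclic colouring with class sizes `s`, except that class `d` is one too small and
class `c` is one too large. -/
structure Near (r : V → V → Prop) (X : Finset V) (C : Finset K) (s : ℕ) (f : V → K) (d c : K) :
    Prop where
  col : IsCol r X C f
  small_mem : d ∈ C
  large_mem : c ∈ C
  card : ∀ e ∈ C, #(cls X f e) + (if e = d then 1 else 0) = s + if e = c then 1 else 0

/-- The colours from which `d` can be reached by moving vertices. -/
noncomputable def acc (r : V → V → Prop) (X : Finset V) (C : Finset K) (f : V → K) (d : K) :
    Finset K :=
  {e ∈ C | ReflTransGen (Mov r X C f) e d}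

/-- The vertices whose colour cannot reach `d`. -/
noncomputable def rest (r : V → V → Prop) (X : Finset V) (C : Finset K) (f : V → K) (d : K) :
    Finset V :=
  {v ∈ X | f v ∉ acc r X C f d}

/-- Recolour `B` without `y` by `g`, give `y` the colour `W` and `z` the colour `Y`. -/
noncomputable def recolor (B : Finset V) (f g : V → K) (y z : V) (W Y : K) (v : V) : K :=
  if v ∈ B.erase y then g v else if v = y then W else if v = z then Y else f v

section Recolor

variable {X B : Finset V} {A : Finset K} {f g : V → K} {y z : V} {W Y e : K}

theorem cls_recolor_of_notMem (hB : ∀ v, v ∈ B ↔ v ∈ X ∧ f v ∉ A) (hW : W ∈ A)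
    (hz : z ∈ cls X f W) (hy : y ∈ B) (he : e ∉ A) :
    cls X (recolor B f g y z W Y) e =
      if e = Y then insert z (cls (B.erase y) g e) else cls (B.erase y) g e := by
  obtain ⟨hzX, hzW⟩ := mem_cls.1 hz
  have hzB : z ∉ B := fun h => ((hB z).1 h).2 (hzW ▸ hW)
  ext v
  have := hB v
  split_ifs <;> simp only [mem_cls, recolor, mem_insert, mem_erase] <;> grind

theorem cls_recolor_of_mem (hB : ∀ v, v ∈ B ↔ v ∈ X ∧ f v ∉ A) (hW : W ∈ A)
    (hz : z ∈ cls X f W) (hy : y ∈ B) (hg : ∀ v ∈ B.erase y, g v ∉ A) (he : e ∈ A) (heW : e ≠ W) :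
    cls X (recolor B f g y z W Y) e =
      if e = Y then insert z (cls X f e) else cls X f e := by
  obtain ⟨hzX, hzW⟩ := mem_cls.1 hz
  have hzB : z ∉ B := fun h => ((hB z).1 h).2 (hzW ▸ hW)
  ext v
  have := hB v
  have := hg v
  rw [mem_erase] at this
  split_ifs <;> simp only [mem_cls, recolor, mem_insert, mem_erase] <;> grind

theorem cls_recolor_self (hB : ∀ v, v ∈ B ↔ v ∈ X ∧ f v ∉ A) (hW : W ∈ A)
    (hz : z ∈ cls X f W) (hy : y ∈ B) (hg : ∀ v ∈ B.erase y, g v ∉ A) (hYW : Y ≠ W) :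
    cls X (recolor B f g y z W Y) W = insert y ((cls X f W).erase z) := by
  obtain ⟨hzX, hzW⟩ := mem_cls.1 hz
  have hzB : z ∉ B := fun h => ((hB z).1 h).2 (hzW ▸ hW)
  ext v
  have := hB v
  have := hg v
  rw [mem_erase] at this
  simp only [mem_cls, recolor, mem_insert, mem_erase]
  grind

end Recolor

section Near

variable {r : V → V → Prop} {X : Finset V} {C : Finset K} {s : ℕ} {f : V → K} {d c : K}

theorem mem_rest {v : V} : v ∈ rest r X C f d ↔ v ∈ X ∧ f v ∉ acc r X C f d :=
  mem_filter

theorem mem_acc {e : K} : e ∈ acc r X C f d ↔ e ∈ C ∧ ReflTransGen (Mov r X C f) e d :=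
  mem_filter

theorem acc_subset : acc r X C f d ⊆ C :=
  filter_subset _ _

theorem Near.mem_acc (h : Near r X C s f d c) : d ∈ acc r X C f d :=
  mem_filter.2 ⟨h.small_mem, .refl⟩

theorem not_acyc_insert_of_mem_rest (hf : IsCol r X C f) {W : K} {y : V}
    (hW : W ∈ acc r X C f d) (hy : y ∈ rest r X C f d) : ¬ Acyc r (insert y (cls X f W)) := by
  intro h
  obtain ⟨hyX, hyA⟩ := mem_rest.1 hy
  obtain ⟨hWC, hWd⟩ := mem_acc.1 hW
  refine hyA (mem_acc.2 ⟨hf.1 y hyX, .head ⟨hf.1 y hyX, hWC, ?_, y,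
    mem_cls.2 ⟨hyX, rfl⟩, h⟩ hWd⟩)
  exact fun h' => hyA (h' ▸ hW)

theorem edgeCount_eq_add_sum (v : V) : edgeCount r v X =
    edgeCount r v (rest r X C f d) + ∑ W ∈ acc r X C f d, edgeCount r v (cls X f W) := by
  simp only [edgeCount_eq_sum]
  have h1 : ∑ W ∈ acc r X C f d, ∑ y ∈ cls X f W, pairCount r v y =
      ∑ y ∈ X with f y ∈ acc r X C f d, pairCount r v y := by
    rw [← sum_fiberwise_of_maps_to (g := f) (t := acc r X C f d)]
    · refine sum_congr rfl fun W hW => sum_congr ?_ fun _ _ => rfl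
      ext y
      simp only [mem_cls, mem_filter]
      constructor
      · rintro ⟨h, rfl⟩
        exact ⟨⟨h, hW⟩, rfl⟩
      · exact fun h => ⟨h.1.1, h.2⟩
    · exact fun y hy => (mem_filter.1 hy).2
  rw [h1, add_comm]
  exact (sum_filter_add_sum_filter_not X (fun y => f y ∈ acc r X C f d) _).symm

theorem card_rest (h : Near r X C s f d c) (hc : c ∉ acc r X C f d) :
    #(rest r X C f d) = #(C \ acc r X C f d) * s + 1 := by
  have hmaps : ∀ v ∈ rest r X C f d, f v ∈ C \ acc r X C f d := fun v hv =>
    mem_sdiff.2 ⟨h.col.1 v (mem_rest.1 hv).1, (mem_rest.1 hv).2⟩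
  have hcl : ∀ e ∈ C \ acc r X C f d,
      #{v ∈ rest r X C f d | f v = e} = s + if e = c then 1 else 0 := by
    intro e he
    obtain ⟨heC, heA⟩ := mem_sdiff.1 he
    have hed : e ≠ d := fun hed => heA (hed ▸ h.mem_acc)
    rw [← h.card e heC, if_neg hed, add_zero]
    congr 1
    ext v
    simp only [mem_filter, mem_cls, mem_rest]
    constructor
    · exact fun hv => ⟨hv.1.1, hv.2⟩
    · rintro ⟨hv, rfl⟩
      exact ⟨⟨hv, heA⟩, rfl⟩
  rw [card_eq_sum_card_fiberwise hmaps, sum_congr rfl hcl, sum_add_distrib, sum_const,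
    sum_ite_eq' , if_pos (mem_sdiff.2 ⟨h.large_mem, hc⟩), smul_eq_mul]

theorem two_mul_card_le_sum {v : V} {S : Finset K} (hr : ∀ v, ¬ r v v) (hf : IsCol r X C f)
    (hS : ∀ W ∈ S, W ∈ C ∧ ¬ Acyc r (insert v (cls X f W))) :
    2 * #S ≤ ∑ W ∈ S, edgeCount r v (cls X f W) := by
  rw [mul_comm, ← smul_eq_mul]
  exact card_nsmul_le_sum _ _ _ fun W hW =>
    two_le_edgeCount hr (hf.2 W (hS W hW).1) (hS W hW).2

theorem reflTransGen_avoid_mem_acc {W a : K} (h : ReflTransGen (Avoid (Mov r X C f) W) a d) :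
    ReflTransGen (fun a b => a ∉ insert W (C \ acc r X C f d) ∧ b ∉ insert W (C \ acc r X C f d) ∧
      Mov r X C f a b) a d := by
  induction h using ReflTransGen.head_induction_on with
  | refl => exact .refl
  | @head a b hab hbd ih =>
    refine .head ⟨?_, ?_, hab.2.2⟩ ih
    · simp only [mem_insert, mem_sdiff, not_or, not_and, not_not]
      exact ⟨hab.1, fun ha => mem_acc.2
        ⟨ha, .head hab.2.2 (reflTransGen_of_avoid hbd)⟩⟩
    · simp only [mem_insert, mem_sdiff, not_or, not_and, not_not]
      exact ⟨hab.2.1, fun hb => mem_acc.2 ⟨hb, reflTransGen_of_avoid hbd⟩⟩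

/-- The vertices that cannot reach the small class, minus one, split equitably by induction. -/
theorem exists_equit_erase (hr : ∀ v, ¬ r v v) (hdeg : ∀ v ∈ X, edgeCount r v X < 2 * #C)
    (ih : ∀ X' ⊂ X, ∀ C' ⊆ C, #X' = #C' * s → (∀ v ∈ X', edgeCount r v X' < 2 * #C') →
      Equit r X' C' s)
    (h : Near r X C s f d c) (hc : c ∉ acc r X C f d) {y : V} (hy : y ∈ rest r X C f d) :
    Equit r ((rest r X C f d).erase y) (C \ acc r X C f d) s := by
  have hsub : rest r X C f d ⊆ X := filter_subset _ _
  refine ih _ ((erase_ssubset hy).trans_subset hsub) _ sdiff_subset ?_ fun v hv => ?_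
  · rw [card_erase_of_mem hy, card_rest h hc, Nat.add_sub_cancel]
  · have hv' := mem_of_mem_erase hv
    have h1 := two_mul_card_le_sum (S := acc r X C f d) (v := v) hr h.col fun W hW =>
      ⟨acc_subset hW, not_acyc_insert_of_mem_rest h.col hW hv'⟩
    have h2 := edgeCount_eq_add_sum (r := r) (X := X) (C := C) (f := f) (d := d) v
    have h3 := hdeg v (hsub hv')
    have h4 := card_sdiff_add_card_eq_card (acc_subset (r := r) (X := X) (C := C) (f := f) (d := d))
    have h5 := edgeCount_mono (r := r) (v := v) (erase_subset y (rest r X C f d))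
    omega

theorem equit_of_mem_acc (h : Near r X C s f d c) (hc : c ∈ acc r X C f d) : Equit r X C s := by
  obtain ⟨f', h1, -, -, h2⟩ := exists_shift (r := r) (X := X) (c := c) _ ∅ d f rfl h.col
    h.small_mem (notMem_empty d) (ReflTransGen.mono
      (fun a b hab => ⟨notMem_empty a, notMem_empty b, hab⟩) _ _ (mem_acc.1 hc).2)
  refine ⟨f', h1, fun e he => ?_⟩
  have := h2 e
  have := h.card e he
  omega

/-- If the solo vertex `z` of a terminal class can be moved, its solo neighbour replaces it. -/
theorem equit_of_movable_solo (hr : ∀ v, ¬ r v v) (hdeg : ∀ v ∈ X, edgeCount r v X < 2 * #C)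
    (ih : ∀ X' ⊂ X, ∀ C' ⊆ C, #X' = #C' * s → (∀ v ∈ X', edgeCount r v X' < 2 * #C') →
      Equit r X' C' s)
    (h : Near r X C s f d c) (hc : c ∉ acc r X C f d) {W Y : K} {y z : V}
    (hW : W ∈ acc r X C f d) (hWd : W ≠ d) (hy : y ∈ rest r X C f d)
    (hs : Solo r (rest r X C f d) (cls X f W) z y) (hY : Y ∈ acc r X C f d) (hYW : Y ≠ W)
    (hzY : Acyc r (insert z (cls X f Y))) (hp : ReflTransGen (Avoid (Mov r X C f) W) Y d) :
    Equit r X C s := by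
  obtain ⟨g, hg, hgs⟩ := exists_equit_erase hr hdeg ih h hc hy
  obtain ⟨φ, hφ, hφZ, hφY, hφs⟩ := exists_shift (r := r) (X := X) (c := Y) _
    (insert W (C \ acc r X C f d)) d f rfl h.col h.small_mem
    (by simp [Ne.symm hWd, h.mem_acc]) (reflTransGen_avoid_mem_acc hp)
  set A := acc r X C f d
  set B := rest r X C f d with hBdef
  have hφW : cls X φ W = cls X f W := hφZ W (mem_insert_self _ _)
  have hB : ∀ v, v ∈ B ↔ v ∈ X ∧ φ v ∉ A := by
    intro v
    rw [hBdef, mem_rest]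
    refine and_congr_right fun hv => ?_
    constructor
    · intro hfv
      have : v ∈ cls X φ (f v) := by
        rw [hφZ _ (mem_insert_of_mem (mem_sdiff.2 ⟨h.col.1 v hv, hfv⟩))]
        exact mem_cls.2 ⟨hv, rfl⟩
      rwa [(mem_cls.1 this).2]
    · intro hfv
      have : v ∈ cls X f (φ v) := by
        rw [← hφZ _ (mem_insert_of_mem (mem_sdiff.2 ⟨hφ.1 v hv, hfv⟩))]
        exact mem_cls.2 ⟨hv, rfl⟩
      rwa [(mem_cls.1 this).2]
  have hz : z ∈ cls X φ W := hφW ▸ hs.mem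
  have hgA : ∀ v ∈ B.erase y, g v ∉ A := fun v hv => (mem_sdiff.1 (hg.1 v hv)).2
  have hyW : y ∉ (cls X f W).erase z := fun hy' => (mem_rest.1 hy).2
    ((mem_cls.1 (mem_of_mem_erase hy')).2 ▸ hW)
  have hzφ : z ∉ cls X φ Y := fun hz' => hYW ((mem_cls.1 hz').2.symm.trans (mem_cls.1 hz).2)
  have hcW : c ≠ W := fun h' => hc (h' ▸ hW)
  refine ⟨recolor B φ g y z W Y, ⟨fun v hv => ?_, fun e he => ?_⟩, fun e he => ?_⟩
  · unfold recolor
    split_ifs with h1 h2 h3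
    · exact (mem_sdiff.1 (hg.1 v h1)).1
    · exact acc_subset hW
    · exact acc_subset hY
    · exact hφ.1 v hv
  · by_cases heA : e ∈ A
    · by_cases heW : e = W
      · subst heW
        rw [cls_recolor_self hB hW hz hy hgA hYW, hφW]
        exact hs.acyc_exchange hr (h.col.2 e he)
      · rw [cls_recolor_of_mem hB hW hz hy hgA heA heW]
        split_ifs with heY
        · subst heY
          exact hzY.mono (insert_subset_insert _ hφY)
        · exact hφ.2 e he
    · rw [cls_recolor_of_notMem hB hW hz hy heA, if_neg (ne_of_mem_of_not_mem hY heA).symm]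
      exact hg.2 e (mem_sdiff.2 ⟨he, heA⟩)
  · have h1 := h.card e he
    have h2 := hφs e
    by_cases heA : e ∈ A
    · have hec : e ≠ c := fun h' => hc (h' ▸ heA)
      by_cases heW : e = W
      · subst heW
        rw [cls_recolor_self hB hW hz hy hgA hYW, hφW, card_insert_of_notMem hyW,
          card_erase_add_one hs.mem]
        simpa [hWd, hec] using h1
      · rw [cls_recolor_of_mem hB hW hz hy hgA heA heW]
        rw [if_neg hec] at h1
        split_ifs with heY
        · subst heY
          rw [card_insert_of_notMem hzφ]
          rw [if_pos rfl] at h2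
          omega
        · rw [if_neg heY] at h2
          omega
    · rw [cls_recolor_of_notMem hB hW hz hy heA, if_neg (ne_of_mem_of_not_mem hY heA).symm]
      exact hgs e (mem_sdiff.2 ⟨he, heA⟩)

theorem sum_edgeCount_cls (hf : ∀ v ∈ X, f v ∈ C) (v : V) :
    ∑ e ∈ C, edgeCount r v (cls X f e) = edgeCount r v X := by
  simp only [edgeCount_eq_sum]
  exact sum_fiberwise_of_maps_to hf _

theorem exists_acyc_insert_cls (hr : ∀ v, ¬ r v v) (hf : IsCol r X C f) {z : V}
    (hz : edgeCount r z X < 2 * #C) : ∃ e ∈ C, Acyc r (insert z (cls X f e)) := by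
  by_contra! hcon
  have := two_mul_card_le_sum hr hf fun e he => ⟨he, hcon e he⟩
  rw [sum_edgeCount_cls hf.1] at this
  omega

/-- A vertex of an accessible class that cannot be moved to another accessible class. -/
theorem edgeCount_add_le_of_unmovable (hr : ∀ v, ¬ r v v)
    (hdeg : ∀ v ∈ X, edgeCount r v X < 2 * #C) (hf : IsCol r X C f) {W : K} {z : V}
    (hW : W ∈ acc r X C f d) (hz : z ∈ cls X f W)
    (hzm : ∀ Y ∈ acc r X C f d, Y ≠ W → ¬ Acyc r (insert z (cls X f Y))) :
    edgeCount r z (rest r X C f d) + edgeCount r z (cls X f W) ≤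
      2 * #(C \ acc r X C f d) + 1 := by
  have h1 := two_mul_card_le_sum (S := (acc r X C f d).erase W) hr hf fun Y hY =>
    ⟨acc_subset (mem_of_mem_erase hY), hzm Y (mem_of_mem_erase hY) (ne_of_mem_erase hY)⟩
  have h2 := edgeCount_eq_add_sum (r := r) (X := X) (C := C) (f := f) (d := d) z
  have h3 := hdeg z (mem_cls.1 hz).1
  have h4 := card_sdiff_add_card_eq_card (acc_subset (r := r) (X := X) (C := C) (f := f) (d := d))
  rw [← add_sum_erase _ _ hW] at h2
  have h5 := card_erase_add_one hW
  omega

theorem edgeCount_erase_lt_of_solo {B W : Finset V} {q : ℕ} {y z : V} (hr : ∀ v, ¬ r v v)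
    (hW : Acyc r W) (hy : y ∈ B) (hyW : ¬ Acyc r (insert y W)) (hs : Solo r B W z y)
    (hle : edgeCount r z B + edgeCount r z W ≤ 2 * q + 1) :
    edgeCount r z (B.erase y) < 2 * q := by
  have h1 : edgeCount r z B = pairCount r z y + edgeCount r z (B.erase y) := by
    rw [edgeCount_eq_sum, edgeCount_eq_sum, add_sum_erase _ _ hy]
  by_cases hz : ∀ w ∈ W, ¬ r z w ∧ ¬ r w z
  · obtain ⟨h2, h3⟩ := hs.double hr hW hyW hz
    have : pairCount r z y = 2 := by simp [pairCount, h2, h3]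
    omega
  · have h2 : 0 < edgeCount r z W := by
      push Not at hz
      obtain ⟨w, hw, hzw⟩ := hz
      by_cases h : r z w
      · exact Nat.add_pos_left (card_pos.2 ⟨w, mem_filter.2 ⟨hw, h⟩⟩) _
      · exact Nat.add_pos_right _ (card_pos.2 ⟨w, mem_filter.2 ⟨hw, hzw h⟩⟩)
    have h3 : 0 < pairCount r z y := by
      rcases hs.adj with h | h <;> simp [pairCount, h]
    omega

/-- If the solo vertex `z` of a terminal class cannot be moved, replace it by `y₁` in such a way
that `y₂` can be moved afterwards; this makes more classes accessible. -/
theorem exists_near_of_exchange (hr : ∀ v, ¬ r v v) (hdeg : ∀ v ∈ X, edgeCount r v X < 2 * #C)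
    (ih : ∀ X' ⊂ X, ∀ C' ⊆ C, #X' = #C' * s → (∀ v ∈ X', edgeCount r v X' < 2 * #C') →
      Equit r X' C' s)
    (h : Near r X C s f d c) (hc : c ∉ acc r X C f d) {W : K} {y₁ y₂ z : V}
    (hW : W ∈ acc r X C f d) (hWd : W ≠ d)
    (hterm : ∀ Y ∈ acc r X C f d, Y ≠ W → ReflTransGen (Avoid (Mov r X C f) W) Y d)
    (hy₁ : y₁ ∈ rest r X C f d) (hy₂ : y₂ ∈ rest r X C f d) (hne : y₁ ≠ y₂)
    (hs : Solo r (rest r X C f d) (cls X f W) z y₁)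
    (hzm : ∀ Y ∈ acc r X C f d, Y ≠ W → ¬ Acyc r (insert z (cls X f Y)))
    (hex : Acyc r (insert y₂ (insert y₁ ((cls X f W).erase z)))) :
    ∃ f' c', Near r X C s f' d c' ∧ #(C \ acc r X C f' d) < #(C \ acc r X C f d) := by
  obtain ⟨g, hg, hgs⟩ := exists_equit_erase hr hdeg ih h hc hy₁
  obtain ⟨Y, hY, hzY⟩ := exists_acyc_insert_cls hr hg (edgeCount_erase_lt_of_solo hr
    (h.col.2 W (acc_subset hW)) hy₁ (not_acyc_insert_of_mem_rest h.col hW hy₁) hs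
    (edgeCount_add_le_of_unmovable hr hdeg h.col hW hs.mem hzm))
  obtain ⟨hYC, hYA⟩ := mem_sdiff.1 hY
  have hdA := h.mem_acc
  have hpath : ∀ Y ∈ acc r X C f d, Y ≠ W → _ := fun Y hY hYW =>
    reflTransGen_avoid_mem_acc (hterm Y hY hYW)
  have hWpath := (mem_acc.1 hW).2
  have hAC : acc r X C f d ⊆ C := acc_subset
  have hback : ∀ b ∈ C, ReflTransGen (Mov r X C f) b d → b ∈ acc r X C f d :=
    fun b hb hbd => mem_acc.2 ⟨hb, hbd⟩
  have hB : ∀ v, v ∈ rest r X C f d ↔ v ∈ X ∧ f v ∉ acc r X C f d := fun v => mem_rest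
  generalize hA : acc r X C f d = A at *
  generalize rest r X C f d = B at *
  have hz : z ∈ cls X f W := hs.mem
  have hgA : ∀ v ∈ B.erase y₁, g v ∉ A := fun v hv => (mem_sdiff.1 (hg.1 v hv)).2
  have hyW : y₁ ∉ (cls X f W).erase z := fun hy' => ((hB y₁).1 hy₁).2
    ((mem_cls.1 (mem_of_mem_erase hy')).2 ▸ hW)
  have hzB : z ∉ cls (B.erase y₁) g Y := fun hz' =>
    ((hB z).1 (mem_of_mem_erase (mem_cls.1 hz').1)).2 ((mem_cls.1 hz).2 ▸ hW)
  have hYW : Y ≠ W := (ne_of_mem_of_not_mem hW hYA).symm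
  set f' := recolor B f g y₁ z W Y with hf'
  have hclsW : cls X f' W = insert y₁ ((cls X f W).erase z) :=
    cls_recolor_self hB hW hz hy₁ hgA hYW
  have hclsA : ∀ e ∈ A, e ≠ W → cls X f' e = cls X f e := fun e he heW => by
    rw [hf', cls_recolor_of_mem hB hW hz hy₁ hgA he heW, if_neg (ne_of_mem_of_not_mem he hYA)]
  have hclsB : ∀ e ∉ A, cls X f' e =
      if e = Y then insert z (cls (B.erase y₁) g e) else cls (B.erase y₁) g e :=
    fun e he => cls_recolor_of_notMem hB hW hz hy₁ he
  have hnear : Near r X C s f' d Y := by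
    refine ⟨⟨fun v hv => ?_, fun e he => ?_⟩, h.small_mem, hYC, fun e he => ?_⟩
    · rw [hf']
      unfold recolor
      split_ifs with h1 h2 h3
      · exact (mem_sdiff.1 (hg.1 v h1)).1
      · exact hAC hW
      · exact hYC
      · exact h.col.1 v hv
    · by_cases heA : e ∈ A
      · by_cases heW : e = W
        · rw [heW, hclsW]
          exact hex.mono (subset_insert _ _)
        · rw [hclsA e heA heW]
          exact h.col.2 e he
      · rw [hclsB e heA]
        split_ifs with heY
        · exact heY ▸ hzY
        · exact hg.2 e (mem_sdiff.2 ⟨he, heA⟩)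
    · by_cases heA : e ∈ A
      · have h1 := h.card e he
        rw [if_neg (ne_of_mem_of_not_mem heA hc)] at h1
        rw [if_neg (ne_of_mem_of_not_mem heA hYA), ← h1]
        by_cases heW : e = W
        · rw [heW, hclsW, card_insert_of_notMem hyW, card_erase_add_one hz]
        · rw [hclsA e heA heW]
      · rw [hclsB e heA, if_neg (ne_of_mem_of_not_mem hdA heA).symm, add_zero]
        split_ifs with heY
        · rw [heY, card_insert_of_notMem hzB, hgs Y hY]
        · exact hgs e (mem_sdiff.2 ⟨he, heA⟩)
  have hreach : ∀ e ∈ A, e ≠ W → ReflTransGen (Mov r X C f') e d := by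
    intro e he heW
    refine ReflTransGen.mono ?_ _ _ (hpath e he heW)
    rintro a b ⟨ha, hb, haC, hbC, hab, v, hv, hva⟩
    simp only [mem_insert, mem_sdiff, not_or, not_and, not_not] at ha hb
    refine ⟨haC, hbC, hab, v, ?_, ?_⟩
    · rwa [hclsA a (ha.2 haC) ha.1]
    · rwa [hclsA b (hb.2 hbC) hb.1]
  have hreachW : ReflTransGen (Mov r X C f') W d := by
    rcases ReflTransGen.cases_head hWpath with h' | ⟨b, ⟨hWC, hbC, hWb, w, hw, hwa⟩, hbd⟩
    · exact absurd h' hWd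
    · have hbA := hback b hbC hbd
      refine .head ⟨hWC, hbC, hWb, w, ?_, ?_⟩ (hreach b hbA hWb.symm)
      · rw [hclsW]
        refine mem_insert_of_mem (mem_erase.2 ⟨?_, hw⟩)
        rintro rfl
        exact hzm b hbA hWb.symm hwa
      · rwa [hclsA b hbA hWb.symm]
  have hy₂' : y₂ ∈ B.erase y₁ := mem_erase.2 ⟨hne.symm, hy₂⟩
  have hg₂ := mem_sdiff.1 (hg.1 y₂ hy₂')
  have hf₂ : f' y₂ = g y₂ := if_pos hy₂'
  refine ⟨f', Y, hnear, card_lt_card ((ssubset_iff_of_subset ?_).2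
    ⟨g y₂, mem_sdiff.2 hg₂, fun h' => (mem_sdiff.1 h').2 (mem_acc.2 ⟨hg₂.1, ?_⟩)⟩)⟩
  · refine sdiff_subset_sdiff Subset.rfl fun e he => mem_acc.2 ⟨hAC he, ?_⟩
    by_cases heW : e = W
    · exact heW ▸ hreachW
    · exact hreach e he heW
  · refine .head ⟨hg₂.1, hAC hW, (ne_of_mem_of_not_mem hW hg₂.2).symm, y₂,
      mem_cls.2 ⟨((hB y₂).1 hy₂).1, hf₂⟩, ?_⟩ hreachW
    rwa [hclsW]

/-- A nearly equitable colouring whose large class is not accessible can be improved. -/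
theorem equit_or_exists_near (hr : ∀ v, ¬ r v v) (hdeg : ∀ v ∈ X, edgeCount r v X < 2 * #C)
    (ih : ∀ X' ⊂ X, ∀ C' ⊆ C, #X' = #C' * s → (∀ v ∈ X', edgeCount r v X' < 2 * #C') →
      Equit r X' C' s)
    (h : Near r X C s f d c) (hc : c ∉ acc r X C f d) :
    Equit r X C s ∨
      ∃ f' c', Near r X C s f' d c' ∧ #(C \ acc r X C f' d) < #(C \ acc r X C f d) := by
  have hAC : acc r X C f d ⊆ C := acc_subset
  have hcard := card_sdiff_add_card_eq_card hAC
  have hBW : ∀ W ∈ acc r X C f d, ∀ y ∈ rest r X C f d, ¬ Acyc r (insert y (cls X f W)) :=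
    fun W hW y hy => not_acyc_insert_of_mem_rest h.col hW hy
  have hBs : #(C \ acc r X C f d) * s < #(rest r X C f d) := by
    rw [card_rest h hc]
    exact Nat.lt_succ_self _
  have hsize : ∀ W ∈ acc r X C f d, #(cls X f W) ≤ s := fun W hW => by
    have := h.card W (hAC hW)
    rw [if_neg (ne_of_mem_of_not_mem hW hc)] at this
    omega
  have hq : 0 < #(C \ acc r X C f d) := card_pos.2 ⟨c, mem_sdiff.2 ⟨h.large_mem, hc⟩⟩
  by_cases hne : ∃ e ∈ acc r X C f d, e ≠ d
  · obtain ⟨U, hU, T, hTA, ⟨W₀, hW₀⟩, hUT, hdT, hterm, hout⟩ :=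
      exists_terminal (fun e he => (mem_acc.1 he).2) h.mem_acc hne
    by_cases hmov : ∃ W ∈ T, ∃ z, ∃ y ∈ rest r X C f d, Solo r (rest r X C f d) (cls X f W) z y ∧
        ∃ Y ∈ acc r X C f d, Y ≠ W ∧ Acyc r (insert z (cls X f Y))
    · obtain ⟨W, hW, z, y, hy, hs, Y, hY, hYW, hzY⟩ := hmov
      exact Or.inl (equit_of_movable_solo hr hdeg ih h hc (hTA hW) (ne_of_mem_of_not_mem hW hdT) hy
        hs hY hYW hzY (hterm W hW Y hY hYW))
    · push Not at hmov
      right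
      obtain ⟨v, hv, hlt⟩ := exists_lt_edgeCount hr (h.col.2 W₀ (hAC (hTA hW₀)))
        (hBW W₀ (hTA hW₀)) (hsize W₀ (hTA hW₀)) hBs fun v hv ⟨y, hy, hs⟩ =>
          edgeCount_add_le_of_unmovable hr hdeg h.col (hTA hW₀) hv (hmov W₀ hW₀ v y hy hs)
      have hqT : #(C \ acc r X C f d) ≤ #T := by
        have h1 := two_mul_card_le_sum (v := v) (S := acc r X C f d \ insert U T) hr h.col
          fun Y hY => by
            simp only [mem_sdiff, mem_insert, not_or] at hY
            exact ⟨hAC hY.1, fun hva => hout W₀ hW₀ Y hY.1 hY.2.2 hY.2.1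
              ⟨hAC (hTA hW₀), hAC hY.1, ne_of_mem_of_not_mem hW₀ hY.2.2, v, hv, hva⟩⟩
        have h2 := edgeCount_eq_add_sum (r := r) (X := X) (C := C) (f := f) (d := d) v
        have h3 := hdeg v (mem_cls.1 hv).1
        have h4 := card_sdiff_add_card_eq_card (insert_subset hU hTA)
        have h5 := sum_le_sum_of_subset (f := fun W => edgeCount r v (cls X f W))
          (sdiff_subset (s := acc r X C f d) (t := insert U T))
        rw [card_insert_of_notMem hUT] at h4
        omega
      obtain ⟨W, hW, z, y₁, hy₁, y₂, hy₂, hy, hs, hex⟩ := exists_exchange hr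
        (fun W hW => h.col.2 W (hAC (hTA hW))) (fun W hW => hBW W (hTA hW))
        (fun W hW => hsize W (hTA hW)) hBs hqT (I₀ := cls X f c) (fun y hy => by
          have h1 := two_mul_card_le_sum (v := y) (S := acc r X C f d \ T) hr h.col fun Y hY =>
            ⟨hAC (mem_sdiff.1 hY).1, hBW Y (mem_sdiff.1 hY).1 y hy⟩
          have h2 := edgeCount_eq_add_sum (r := r) (X := X) (C := C) (f := f) (d := d) y
          have h3 := hdeg y (mem_rest.1 hy).1
          have h4 := card_sdiff_add_card_eq_card hTA
          rw [← sum_sdiff hTA] at h2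
          omega) (fun y hy => mem_rest.2 ⟨(mem_cls.1 hy).1, (mem_cls.1 hy).2 ▸ hc⟩)
          (h.col.2 c h.large_mem) (by
            have := h.card c h.large_mem
            rw [if_neg (ne_of_mem_of_not_mem h.mem_acc hc).symm, if_pos rfl] at this
            omega)
      exact exists_near_of_exchange hr hdeg ih h hc (hTA hW) (ne_of_mem_of_not_mem hW hdT)
        (hterm W hW) hy₁ hy₂ hy hs (hmov W hW z y₁ hy₁ hs) hex
  · push Not at hne
    have hle : ∀ v ∈ cls X f d, edgeCount r v (rest r X C f d) + edgeCount r v (cls X f d) ≤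
        2 * #(C \ acc r X C f d) + 1 := fun v hv =>
      edgeCount_add_le_of_unmovable hr hdeg h.col h.mem_acc hv fun Y hY hYd =>
        absurd (hne Y hY) hYd
    obtain ⟨v, hv, hlt⟩ := exists_lt_edgeCount hr (h.col.2 d h.small_mem) (hBW d h.mem_acc)
      (hsize d h.mem_acc) hBs fun v hv _ => hle v hv
    have := hle v hv
    omega

theorem equit_of_near (hr : ∀ v, ¬ r v v) (hdeg : ∀ v ∈ X, edgeCount r v X < 2 * #C)
    (ih : ∀ X' ⊂ X, ∀ C' ⊆ C, #X' = #C' * s → (∀ v ∈ X', edgeCount r v X' < 2 * #C') →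
      Equit r X' C' s)
    (h : Near r X C s f d c) : Equit r X C s := by
  induction hn : #(C \ acc r X C f d) using Nat.strong_induction_on generalizing f c with
  | _ n ihn =>
  by_cases hc : c ∈ acc r X C f d
  · exact equit_of_mem_acc h hc
  · rcases equit_or_exists_near hr hdeg ih h hc with h' | ⟨f', c', h', hlt⟩
    · exact h'
    · exact ihn _ (hn ▸ hlt) h' rfl

end Near

theorem exists_card_cls_eq [Nonempty K] (C : Finset K) (s : ℕ) (X : Finset V)
    (h : #X = #C * s) : ∃ f : V → K, (∀ v ∈ X, f v ∈ C) ∧ ∀ c ∈ C, #(cls X f c) = s := by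
  induction C using Finset.induction_on generalizing X with
  | empty =>
    obtain rfl : X = ∅ := card_eq_zero.1 (by simpa using h)
    exact ⟨fun _ => Classical.arbitrary K, by simp, by simp⟩
  | insert c C hc ih =>
    rw [card_insert_of_notMem hc, Nat.add_mul, one_mul] at h
    obtain ⟨S, hSX, hS⟩ := exists_subset_card_eq (s := X) (n := s) (by omega)
    obtain ⟨f, hf, hfs⟩ := ih (X \ S) (by
      have := card_sdiff_add_card_eq_card hSX
      omega)
    refine ⟨fun v => if v ∈ S then c else f v, fun v hv => ?_, fun e he => ?_⟩
    · by_cases hvS : v ∈ S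
      · simp [hvS]
      · simp only [if_neg hvS]
        exact mem_insert_of_mem (hf v (mem_sdiff.2 ⟨hv, hvS⟩))
    · rcases mem_insert.1 he with rfl | heC
      · rw [← hS]
        congr 1
        ext v
        have := hf v
        rw [mem_sdiff] at this
        rw [mem_cls]
        grind
      · rw [← hfs e heC]
        congr 1
        ext v
        simp only [mem_cls, mem_sdiff]
        grind

theorem edgeCount_le_of_imp {r r' : V → V → Prop} (h : ∀ a b, r' a b → r a b) (v : V)
    (S : Finset V) : edgeCount r' v S ≤ edgeCount r v S :=
  Nat.add_le_add (card_le_card (monotone_filter_right _ fun _ _ => h _ _))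
    (card_le_card (monotone_filter_right _ fun _ _ => h _ _))

theorem Acyc.congr {r r' : V → V → Prop} {S : Finset V} (h : Acyc r S)
    (hrr : ∀ a ∈ S, ∀ b ∈ S, r' a b → r a b) : Acyc r' S := by
  intro T hT hne
  obtain ⟨v, hv, hs⟩ := h T hT hne
  exact ⟨v, hv, fun u hu hvu => hs u hu (hrr v (hT hv) u (hT hu) hvu)⟩

/-- A digraph on `#C * s` vertices of degree less than `2 * #C` has an acyclic colouring with all
classes of size `s`. -/
theorem equit_of_edgeCount_lt [Nonempty K] {r : V → V → Prop} {X : Finset V} {C : Finset K} {s : ℕ}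
    (hr : ∀ v, ¬ r v v) (hX : #X = #C * s) (hdeg : ∀ v ∈ X, edgeCount r v X < 2 * #C) :
    Equit r X C s := by
  induction X using Finset.strongInduction generalizing r C with
  | H X ih =>
  have key : ∀ Z ⊆ X, Equit (fun a b => r a b ∧ a ∈ Z ∧ b ∈ Z) X C s := by
    intro Z
    induction Z using Finset.induction_on with
    | empty =>
      intro _
      obtain ⟨f, hf, hfs⟩ := exists_card_cls_eq C s X hX
      exact ⟨f, ⟨hf, fun _ _ T _ ⟨v, hv⟩ => ⟨v, hv, by simp⟩⟩, hfs⟩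
    | insert u Z hu ihZ =>
      intro hZ
      obtain ⟨f, hf, hfs⟩ := ihZ ((subset_insert _ _).trans hZ)
      have huX : u ∈ X := hZ (mem_insert_self _ _)
      set r' : V → V → Prop := fun a b => r a b ∧ a ∈ insert u Z ∧ b ∈ insert u Z
      have hr'l : ∀ v, ¬ r' v v := fun v h => hr v h.1
      have hdeg' : ∀ v ∈ X, edgeCount r' v X < 2 * #C := fun v hv =>
        (edgeCount_le_of_imp (fun _ _ h => h.1) v X).trans_lt (hdeg v hv)
      have hmaps : ∀ v ∈ X.erase u, f v ∈ C := fun v hv => hf.1 v (mem_of_mem_erase hv)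
      have hcol : IsCol r' (X.erase u) C f := by
        refine ⟨hmaps, fun e he => ?_⟩
        have hsub : cls (X.erase u) f e ⊆ cls X f e := fun v hv =>
          mem_cls.2 ⟨mem_of_mem_erase (mem_cls.1 hv).1, (mem_cls.1 hv).2⟩
        refine ((hf.2 e he).mono hsub).congr fun a ha b hb hab => ⟨hab.1, ?_, ?_⟩
        · exact mem_of_mem_insert_of_ne hab.2.1 (ne_of_mem_erase (mem_cls.1 ha).1)
        · exact mem_of_mem_insert_of_ne hab.2.2 (ne_of_mem_erase (mem_cls.1 hb).1)
      obtain ⟨Y, hY, hYa⟩ := exists_acyc_insert_cls (z := u) hr'l hcol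
        ((edgeCount_mono (erase_subset _ _)).trans_lt (hdeg' u huX))
      have hcls : ∀ e, cls X (Function.update f u Y) e =
          if e = Y then insert u (cls (X.erase u) f e) else cls (X.erase u) f e := by
        intro e
        ext v
        by_cases hv : v = u
        · subst hv
          split_ifs with h <;> simp [mem_cls, huX, h, Ne.symm (a := e)]
        · split_ifs <;> simp [mem_cls, hv]
      have hcls' : ∀ e, cls (X.erase u) f e = (cls X f e).erase u := by
        intro e
        ext v
        simp [mem_cls, and_assoc]
      have hnear : Near r' X C s (Function.update f u Y) (f u) Y := by
        refine ⟨⟨fun v hv => ?_, fun e he => ?_⟩, hf.1 u huX, hY, fun e he => ?_⟩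
        · by_cases hvu : v = u
          · simpa [hvu] using hY
          · simpa [hvu] using hf.1 v hv
        · rw [hcls]
          split_ifs with heY
          · exact heY ▸ hYa
          · exact hcol.2 e he
        · have h1 : #(cls (X.erase u) f e) + (if e = f u then 1 else 0) = s := by
            rw [hcls', ← hfs e he]
            split_ifs with heu
            · exact card_erase_add_one (mem_cls.2 ⟨huX, heu.symm⟩)
            · rw [erase_eq_of_notMem fun h => heu (mem_cls.1 h).2.symm, add_zero]
          rw [hcls]
          by_cases heY : e = Y
          · rw [if_pos heY, if_pos heY,
              card_insert_of_notMem fun h => ne_of_mem_erase (mem_cls.1 h).1 rfl, ← h1]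
            omega
          · rw [if_neg heY, if_neg heY, h1, add_zero]
      exact equit_of_near hr'l hdeg' (fun X' hX' C' _ hc hd => ih X' hX' hr'l hc hd) hnear
  obtain ⟨f, hf, hfs⟩ := key X Subset.rfl
  exact ⟨f, ⟨hf.1, fun c hc => (hf.2 c hc).congr fun a ha b hb hab =>
    ⟨hab, (mem_cls.1 ha).1, (mem_cls.1 hb).1⟩⟩, hfs⟩

theorem Acyc.not_transGen {r : V → V → Prop} {S : Finset V} (h : Acyc r S) (v : V) :
    ¬ TransGen (fun a b => a ∈ S ∧ b ∈ S ∧ r a b) v v := by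
  intro hv
  have hvS : v ∈ S := by
    obtain ⟨b, hb, -⟩ := TransGen.head'_iff.1 hv
    exact hb.1
  obtain ⟨w, hw, hs⟩ := h {u ∈ S | TransGen (fun a b => a ∈ S ∧ b ∈ S ∧ r a b) u v}
    (filter_subset _ _) ⟨v, mem_filter.2 ⟨hvS, hv⟩⟩
  obtain ⟨b, hb, hbv⟩ := TransGen.head'_iff.1 (mem_filter.1 hw).2
  refine hs b (mem_filter.2 ⟨hb.2.1, ?_⟩) hb.2.2
  rcases reflTransGen_iff_eq_or_transGen.1 hbv with rfl | hbv
  · exact hv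
  · exact hbv

/-- The disjoint union of the digraph `r` with the complete digraph on `P`. -/
def sumComplete (r : V → V → Prop) (P : Type*) : V ⊕ P → V ⊕ P → Prop
  | .inl a, .inl b => r a b
  | .inr a, .inr b => a ≠ b
  | _, _ => False

theorem not_sumComplete_self {r : V → V → Prop} (hr : ∀ v, ¬ r v v) (P : Type*) (v : V ⊕ P) :
    ¬ sumComplete r P v v := by
  rcases v with v | v
  · exact hr v
  · exact fun h => h rfl

theorem edgeCount_sumComplete_inl [Fintype V] {P : Type*} [Fintype P] (r : V → V → Prop) (v : V) :
    edgeCount (sumComplete r P) (.inl v) univ = edgeCount r v univ := by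
  have h : ∀ u : P, pairCount (sumComplete r P) (.inl v) (.inr u) = 0 := fun u => by
    simp [pairCount, sumComplete]
  rw [edgeCount_eq_sum, edgeCount_eq_sum, Fintype.sum_sum_type, sum_eq_zero fun u _ => h u, add_zero]
  rfl

theorem edgeCount_sumComplete_inr_le [Fintype V] {P : Type*} [Fintype P] (r : V → V → Prop)
    (v : P) : edgeCount (sumComplete r P) (.inr v) univ ≤ (Fintype.card P - 1) * 2 := by
  have h : ∀ u : V, pairCount (sumComplete r P) (.inr v) (.inl u) = 0 := fun u => by
    simp [pairCount, sumComplete]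
  have hv : pairCount (sumComplete r P) (.inr v) (.inr v) = 0 := by
    simp [pairCount, sumComplete]
  rw [edgeCount_eq_sum, Fintype.sum_sum_type, sum_eq_zero fun u _ => h u, zero_add,
    ← add_sum_erase _ _ (mem_univ v), hv, zero_add, ← card_univ, ← card_erase_of_mem (mem_univ v)]
  refine sum_le_card_nsmul _ _ _ fun u _ => ?_
  unfold pairCount
  split_ifs <;> omega

theorem card_inr_le_one {P : Type*} {r : V → V → Prop} {S : Finset (V ⊕ P)}
    (h : Acyc (sumComplete r P) S) (T : Finset P) (hT : ∀ a ∈ T, Sum.inr a ∈ S) : #T ≤ 1 := by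
  refine card_le_one.2 fun a ha b hb => ?_
  by_contra hab
  obtain ⟨v, hv, hs⟩ := h {.inr a, .inr b} (by simp [insert_subset_iff, hT a ha, hT b hb])
    (by simp)
  rcases mem_insert.1 hv with rfl | hv
  · exact hs (.inr b) (by simp) hab
  · rw [mem_singleton.1 hv] at hs
    exact hs (.inr a) (by simp) (Ne.symm hab)

theorem exists_equitable [Fintype V] {r : V → V → Prop} (hr : ∀ v, ¬ r v v) {k : ℕ} (hk : 0 < k)
    (hdeg : ∀ v, edgeCount r v univ < 2 * k) : ∃ f : V → Fin k,
      (∀ c c', #{v | f v = c} ≤ #{v | f v = c'} + 1) ∧ ∀ c, Acyc r {v | f v = c} := by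
  have : Nonempty (Fin k) := ⟨⟨0, hk⟩⟩
  obtain ⟨p, hpk, s, hs⟩ : ∃ p < k, ∃ s, Fintype.card V + p = k * s := by
    rcases Nat.eq_zero_or_pos (Fintype.card V % k) with h0 | h0
    · exact ⟨0, hk, _, (Nat.mul_div_cancel' (Nat.dvd_of_mod_eq_zero h0)).symm⟩
    · refine ⟨k - Fintype.card V % k, by omega, Fintype.card V / k + 1, ?_⟩
      have h1 := Nat.div_add_mod (Fintype.card V) k
      have h2 := Nat.mod_lt (Fintype.card V) hk
      rw [Nat.mul_add, mul_one]
      omega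
  obtain ⟨f, hf, hfs⟩ := equit_of_edgeCount_lt (r := sumComplete r (Fin p)) (X := univ)
    (C := (univ : Finset (Fin k))) (s := s) (not_sumComplete_self hr _) (by simpa using hs) (by
      rintro (v | v) -
      · rw [edgeCount_sumComplete_inl, card_univ, Fintype.card_fin]
        exact hdeg v
      · refine (edgeCount_sumComplete_inr_le r v).trans_lt ?_
        rw [card_univ, Fintype.card_fin, Fintype.card_fin]
        omega)
  have hsize : ∀ c, #{v | f (.inl v) = c} ≤ s ∧ s ≤ #{v | f (.inl v) = c} + 1 := by
    intro c
    have h1 : #{v | f (.inl v) = c} + #{a | f (.inr a) = c} = s := by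
      rw [← hfs c (mem_univ c), cls, card_filter, card_filter, card_filter, Fintype.sum_sum_type]
      congr!
    have h2 := card_inr_le_one (hf.2 c (mem_univ c)) {a | f (.inr a) = c} (by simp [mem_cls])
    omega
  refine ⟨fun v => f (.inl v), fun c c' => (hsize c).1.trans (hsize c').2, fun c T hT hne => ?_⟩
  obtain ⟨w, hw, hsink⟩ := hf.2 c (mem_univ c) (T.map .inl) (fun x hx => by
    obtain ⟨v, hv, rfl⟩ := mem_map.1 hx
    exact mem_cls.2 ⟨mem_univ _, (mem_filter.1 (hT hv)).2⟩) (hne.map)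
  obtain ⟨v, hv, rfl⟩ := mem_map.1 hw
  exact ⟨v, hv, fun u hu => hsink (.inl u) (mem_map_of_mem _ hu)⟩

end EquitableAcyclic

/-- **Equitable acyclic coloring of digraphs (Czygrinow–DeBiasio–Kierstead–Molla).**
A simple directed graph is modelled by an irreflexive relation `r : V → V → Prop`
(`r x y` meaning there is an edge from `x` to `y`). If `d⁻(v) + d⁺(v) < 2k` for every
vertex `v`, then the vertices can be partitioned into `k` classes whose sizes pairwise
differ by at most `1`, each class containing no directed cycle (no vertex lies on a
nontrivial directed walk staying inside its own class that returns to itself). -/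
theorem equitable_acyclic_coloring_digraph {V : Type*} [Fintype V]
    (r : V → V → Prop) [DecidableRel r] (hloopless : ∀ v : V, ¬ r v v)
    (k : ℕ) (hk : 0 < k)
    (hdeg : ∀ v : V,
      (Finset.univ.filter fun u => r u v).card +
        (Finset.univ.filter fun u => r v u).card < 2 * k) :
    ∃ f : V → Fin k,
      (∀ c c' : Fin k,
        (Finset.univ.filter fun v => f v = c).card ≤
          (Finset.univ.filter fun v => f v = c').card + 1) ∧
      (∀ c : Fin k, ∀ v : V, f v = c →
        ¬ Relation.TransGen (fun a b => f a = c ∧ f b = c ∧ r a b) v v) := by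
  obtain ⟨f, hf, ha⟩ := EquitableAcyclic.exists_equitable hloopless hk fun v => by
    refine lt_of_eq_of_lt ?_ (hdeg v)
    rw [EquitableAcyclic.edgeCount, add_comm]
    congr!
  refine ⟨f, fun c c' => ?_, fun c v _ h => ?_⟩
  · convert hf c c'
  · refine (ha c).not_transGen v (Relation.TransGen.mono (fun a b hab => ?_) _ _ h)
    simpa using hab
end
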